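/- arXiv:1809.03460 — 4 statements merged into one kernel-verified Lean document; each statement's English description precedes it below -/
import Mathlib

section
/- Let G be a group and let g ∈ G be a nontrivial element of finite order. Let l, k be integers, not both zero. Let Q be the quotient of the free product G ∗ F(x) (F(x) the free group on one generator x) by the normal closure of the element x^l · g · x^k · g. Then the natural homomorphism G → Q (induced by the inclusion of G into the free product) is bijective if and only if |l + k| = 1 and (l = 0 or k = 0). -/
open Monoid Monoid.Coprod

universe u

/-- The family of groups `G`, `H` indexed by `true`, `false`. -/
def boolFamily (G H : Type u) : Bool → Type u
  | true => G
  | false => H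

instance boolFamily.instGroup (G H : Type u) [hG : Group G] [hH : Group H] :
    ∀ b, Group (boolFamily G H b)
  | true => hG
  | false => hH

/-- The pair of homomorphisms `φ`, `ψ` indexed by `true`, `false`. -/
def boolFamilyHom {K : Type*} {G H : Type u} [Group K] [Group G] [Group H] (φ : K →* G)
    (ψ : K →* H) : ∀ b, K →* boolFamily G H b
  | true => φ
  | false => ψ

/-- Two groups amalgamated along cyclic subgroups of the same order. -/
theorem exists_amalgam_of_orderOf_eq {G H : Type u} [Group G] [Group H] (g : G) (a : H)
    (h : orderOf g = orderOf a) :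
    ∃ (P : Type u) (_ : Group P) (i : G →* P) (j : H →* P),
      i g = j a ∧ ∀ w y, i w = j y → y ∈ Subgroup.zpowers a := by
  let K := Subgroup.zpowers (g, a)
  let φ : ∀ b, K →* boolFamily G H b :=
    boolFamilyHom ((MonoidHom.fst G H).comp K.subtype) ((MonoidHom.snd G H).comp K.subtype)
  have hinj : ∀ b, Function.Injective (φ b) := by
    intro b
    rw [injective_iff_map_eq_one]
    rintro ⟨_, z, rfl⟩ hz
    have key : g ^ z = 1 ∧ a ^ z = 1 := by
      cases b with
      | true =>
        have hz' : g ^ z = 1 := hz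
        exact ⟨hz', by rwa [← orderOf_dvd_iff_zpow_eq_one, ← h, orderOf_dvd_iff_zpow_eq_one]⟩
      | false =>
        have hz' : a ^ z = 1 := hz
        exact ⟨by rwa [← orderOf_dvd_iff_zpow_eq_one, h, orderOf_dvd_iff_zpow_eq_one], hz'⟩
    exact Subtype.ext (Prod.ext key.1 key.2)
  refine ⟨PushoutI φ, inferInstance, PushoutI.of (φ := φ) true, PushoutI.of (φ := φ) false, ?_, ?_⟩
  · exact (PushoutI.of_apply_eq_base φ true ⟨(g, a), Subgroup.mem_zpowers _⟩).trans
      (PushoutI.of_apply_eq_base φ false ⟨(g, a), Subgroup.mem_zpowers _⟩).symm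
  · intro w y hwy
    have hmem : PushoutI.of (φ := φ) false y ∈
        (PushoutI.of (φ := φ) true).range ⊓ (PushoutI.of (φ := φ) false).range :=
      ⟨⟨w, hwy⟩, ⟨_, rfl⟩⟩
    rw [PushoutI.inf_of_range_eq_base_range hinj (by decide)] at hmem
    obtain ⟨⟨_, z, rfl⟩, hz⟩ := hmem
    rw [← PushoutI.of_apply_eq_base φ false] at hz
    exact ⟨z, PushoutI.of_injective hinj false hz⟩

/-- If `c * c = x ^ (2 * k - 1)`, then `g = x⁻¹ * c * x ^ (1 - k)` satisfies
`x ^ k * g * x ^ (1 - k) * g = 1`. -/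
theorem zpow_mul_mul_zpow_mul_eq_one {H : Type*} [Group H] {x c : H} {k : ℤ}
    (h : c * c = x ^ (2 * k - 1)) :
    x ^ k * (x⁻¹ * c * x ^ (1 - k)) * x ^ (1 - k) * (x⁻¹ * c * x ^ (1 - k)) = 1 := by
  have hc : Commute c (x ^ (2 * k - 1)) := h ▸ (Commute.refl c).mul_right (Commute.refl c)
  have e : x ^ (1 - k) * x ^ (1 - k) * x⁻¹ = (x ^ (2 * k - 1))⁻¹ := by group
  calc _ = x ^ k * x⁻¹ * (c * (x ^ (1 - k) * x ^ (1 - k) * x⁻¹) * c) * x ^ (1 - k) := by group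
    _ = x ^ k * x⁻¹ * x ^ (1 - k) := by
      rw [e, hc.inv_right.eq, mul_assoc _ c c, h, inv_mul_cancel, mul_one]
    _ = 1 := by group

theorem pow_eq_one_of_mul_self_eq {K A : Type*} [Field K] [Ring A] [Algebra K A] {a : A} {η : K}
    (ha : a * a = (1 + η) • a - η • 1) (hη : η ≠ 1) {n : ℕ} (hn : η ^ n = 1) : a ^ n = 1 := by
  have key : ∀ j : ℕ, (η - 1) • a ^ j = (η ^ j - 1) • a + (η - η ^ j) • (1 : A) := by
    intro j
    induction j with
    | zero => simp
    | succ j ih =>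
      rw [pow_succ, ← smul_mul_assoc, ih, add_mul, smul_mul_assoc, smul_mul_assoc, ha, one_mul]
      module
  have h := key n
  rw [hn, sub_self, zero_smul, zero_add] at h
  exact smul_right_injective A (sub_ne_zero.mpr hη) h

/-- The diagonal torus of `GL₂`. -/
def diagGL (K : Type*) [Field K] : (Fin 2 → Kˣ) →* GL (Fin 2) K :=
  (Units.map (Matrix.diagonalRingHom (Fin 2) K).toMonoidHom).comp
    (MulEquiv.piUnits (M := fun _ : Fin 2 => K)).symm.toMonoidHom

theorem coe_diagGL {K : Type*} [Field K] (u v : Kˣ) :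
    (diagGL K ![u, v] : Matrix (Fin 2) (Fin 2) K) = !![(u : K), 0; 0, (v : K)] := by
  ext i j
  fin_cases i <;> fin_cases j <;> simp [diagGL, MulEquiv.piUnits]

theorem diagGL_zpow {K : Type*} [Field K] (u v : Kˣ) (k : ℤ) :
    diagGL K ![u, v] ^ k = diagGL K ![u ^ k, v ^ k] := by
  rw [← map_zpow]
  congr 1
  ext i
  fin_cases i <;> simp

theorem exists_units_orderOf_eq {n : ℕ} (hn : n ≠ 0) : ∃ η : ℂˣ, orderOf η = n := by
  have h := Complex.isPrimitiveRoot_exp n hn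
  obtain ⟨u, hu⟩ := h.isUnit hn
  exact ⟨u, by rw [← orderOf_units, hu]; exact h.eq_orderOf.symm⟩

/-- A linear group in which the relation `x ^ k a x ^ (1 - k) a = 1` holds, with `a` a complex
reflection of order `n` not commuting with `x`. -/
theorem exists_GL_relation {n : ℕ} (hn : 2 ≤ n) {k : ℤ} (hk0 : k ≠ 0) (hk1 : k ≠ 1) :
    ∃ a x : GL (Fin 2) ℂ, orderOf a = n ∧ x ^ k * a * x ^ (1 - k) * a = 1 ∧ ¬ Commute a x := by
  obtain ⟨η, hη⟩ := exists_units_orderOf_eq (n := n) (by omega)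
  obtain ⟨ω, hω⟩ := exists_units_orderOf_eq (n := (2 * k - 1).natAbs) (by omega)
  have hη1 : η ≠ 1 := by rintro rfl; rw [orderOf_one] at hη; omega
  have hω1 : ω ≠ 1 := by rintro rfl; rw [orderOf_one] at hω; omega
  have hωm : ω ^ (2 * k - 1) = 1 := by
    rw [← orderOf_dvd_iff_zpow_eq_one, hω]; simp
  have hωk : ω ^ (-k) ≠ 1 := by
    intro h
    apply hω1
    have : ω = (ω ^ (-k))⁻¹ * (ω ^ (-k))⁻¹ * (ω ^ (2 * k - 1))⁻¹ := by group
    rw [this, h, hωm]; simp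
  obtain ⟨α, hα⟩ : ∃ α : ℂˣ, α = -(ω ^ (-k) * η⁻¹) := ⟨_, rfl⟩
  obtain ⟨β, hβ⟩ : ∃ β : ℂˣ, β = α * ω := ⟨_, rfl⟩
  obtain ⟨μ, hμ⟩ : ∃ μ : ℂˣ, μ = α ^ (2 * k - 1) := ⟨_, rfl⟩
  have hμβ : μ = β ^ (2 * k - 1) := by rw [hβ, mul_zpow, hωm, mul_one, hμ]
  have hdet : -(μ * (α ^ (-k) * β ^ (-k))) = η := by
    have e : μ * (α ^ (-k) * β ^ (-k)) = α⁻¹ * ω ^ (-k) := by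
      rw [hβ, mul_zpow, hμ, ← mul_assoc, ← mul_assoc, ← zpow_add, ← zpow_add]
      congr 2
      rw [← zpow_neg_one]; congr 1; ring
    rw [e, hα, inv_neg, neg_mul, neg_neg]
    group
  have hdiff : ((α ^ (-k) : ℂˣ) : ℂ) - (β ^ (-k) : ℂˣ) ≠ 0 := by
    rw [sub_ne_zero, Ne, Units.val_inj, hβ, mul_zpow]
    simpa using hωk
  obtain ⟨p, hp⟩ : ∃ p : ℂ, p * (((α ^ (-k) : ℂˣ) : ℂ) - (β ^ (-k) : ℂˣ)) = 1 + η :=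
    ⟨(1 + η) / _, div_mul_cancel₀ _ hdiff⟩
  have hαβ : (α : ℂ) ≠ β := by
    rw [Ne, Units.val_inj, hβ]
    simpa using hω1
  let M : Matrix (Fin 2) (Fin 2) ℂ := !![p, 1; μ - p ^ 2, -p]
  have hM : M.det = -μ := by simp [M, Matrix.det_fin_two]; ring
  let c : GL (Fin 2) ℂ := Matrix.GeneralLinearGroup.mkOfDetNeZero M (by simp [hM])
  have hcM : (c : Matrix (Fin 2) (Fin 2) ℂ) = M := rfl
  let x := diagGL ℂ ![α, β]
  have hcc : c * c = x ^ (2 * k - 1) := by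
    rw [diagGL_zpow, ← hμ, ← hμβ]
    apply Units.ext
    rw [coe_diagGL, Units.val_mul, hcM]
    simp only [M, Matrix.mul_fin_two]
    ext i j
    fin_cases i <;> fin_cases j <;> simp <;> ring
  have hcoe : ((x⁻¹ * c * x ^ (1 - k) : GL (Fin 2) ℂ) : Matrix (Fin 2) (Fin 2) ℂ) =
      !![p * (α ^ (-k) : ℂˣ), (α⁻¹ * β ^ (1 - k) : ℂˣ);
        (μ - p ^ 2) * (β⁻¹ * α ^ (1 - k) : ℂˣ), -p * (β ^ (-k) : ℂˣ)] := by
    have e : ∀ u : ℂˣ, u ^ (-k) = u⁻¹ * u ^ (1 - k) := fun u => by group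
    rw [← zpow_neg_one, diagGL_zpow, diagGL_zpow, Units.val_mul, Units.val_mul, coe_diagGL,
      coe_diagGL, hcM, e, e]
    simp only [M, Matrix.mul_fin_two, zpow_neg_one, Units.val_mul]
    ext i j
    fin_cases i <;> fin_cases j <;> simp <;> ring
  have hdetA : ((x⁻¹ * c * x ^ (1 - k) : GL (Fin 2) ℂ) : Matrix (Fin 2) (Fin 2) ℂ).det = η := by
    have e : (α⁻¹ * β ^ (1 - k)) * (β⁻¹ * α ^ (1 - k)) = α ^ (-k) * β ^ (-k) := by
      have e' : ∀ u : ℂˣ, u ^ (-k) = u⁻¹ * u ^ (1 - k) := fun u => by group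
      rw [e', e', mul_mul_mul_comm, mul_mul_mul_comm α⁻¹ (α ^ (1 - k)), mul_comm (β ^ (1 - k))]
    have e1 := congrArg (Units.val) e
    have e2 := congrArg (Units.val) hdet
    rw [Units.val_mul, Units.val_mul (α ^ (-k))] at e1
    rw [Units.val_neg, Units.val_mul, Units.val_mul] at e2
    rw [hcoe, Matrix.det_fin_two_of]
    linear_combination e2 - (μ - p ^ 2) * e1
  refine ⟨x⁻¹ * c * x ^ (1 - k), x, ?_, zpow_mul_mul_zpow_mul_eq_one hcc, ?_⟩
  · apply Nat.dvd_antisymm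
    · apply orderOf_dvd_of_pow_eq_one
      apply Units.ext
      rw [Units.val_pow_eq_pow_val, Units.val_one]
      refine pow_eq_one_of_mul_self_eq (η := (η : ℂ)) ?_ (by simpa using hη1)
        (by rw [← Units.val_pow_eq_pow_val, ← hη, pow_orderOf_eq_one, Units.val_one])
      rw [← hdetA]
      have htr : 1 + ((x⁻¹ * c * x ^ (1 - k) : GL (Fin 2) ℂ) : Matrix (Fin 2) (Fin 2) ℂ).det =
          ((x⁻¹ * c * x ^ (1 - k) : GL (Fin 2) ℂ) : Matrix (Fin 2) (Fin 2) ℂ).trace := by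
        rw [hdetA, hcoe, Matrix.trace_fin_two_of]
        linear_combination -hp
      rw [htr]
      generalize ((x⁻¹ * c * x ^ (1 - k) : GL (Fin 2) ℂ) : Matrix (Fin 2) (Fin 2) ℂ) = A
      ext i j
      fin_cases i <;> fin_cases j <;>
        simp [Matrix.mul_apply, Matrix.det_fin_two, Matrix.trace_fin_two] <;> ring
    · have h : Matrix.GeneralLinearGroup.det (x⁻¹ * c * x ^ (1 - k)) = η := Units.ext hdetA
      rw [← hη, ← h]
      exact orderOf_map_dvd _ _
  · intro h
    have hc : Commute c x := by
      have h' := ((Commute.refl x).mul_left h).mul_left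
        ((Commute.refl x).zpow_left (1 - k)).inv_left
      have e : x * (x⁻¹ * c * x ^ (1 - k)) * (x ^ (1 - k))⁻¹ = c := by group
      rwa [e] at h'
    have h1 := congrArg (fun B : GL (Fin 2) ℂ => (B : Matrix (Fin 2) (Fin 2) ℂ) 0 1) hc.eq
    simp only [Units.val_mul, hcM, x, coe_diagGL] at h1
    simp [M, Matrix.mul_apply] at h1
    exact hαβ h1.symm

theorem exists_GL_relation_of_abs_add_eq_one {n : ℕ} (hn : 2 ≤ n) {l k : ℤ} (h : |l + k| = 1)
    (hl : l ≠ 0) (hk : k ≠ 0) :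
    ∃ a x : GL (Fin 2) ℂ, orderOf a = n ∧ x ^ l * a * x ^ k * a = 1 ∧ ¬ Commute a x := by
  rcases (abs_eq zero_le_one).mp h with h | h
  · obtain rfl : k = 1 - l := by omega
    exact exists_GL_relation hn hl (by omega)
  · obtain rfl : k = -1 - l := by omega
    obtain ⟨a, x, ha, hr, hc⟩ := exists_GL_relation hn (k := -l) (by omega) (by omega)
    refine ⟨a, x⁻¹, ha, ?_, fun h => hc (by simpa using h.inv_right)⟩
    rw [inv_zpow', inv_zpow']
    convert hr using 4
    ring

/-- A homomorphism out of `⟨G, x | xˡ g xᵏ g⟩`, given by its values on `G` and on `x`. -/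
theorem exists_hom_of_relation {G P : Type*} [Group G] [Group P] (g : G) (l k : ℤ) (i : G →* P)
    (y : P) (h : y ^ l * i g * y ^ k * i g = 1) :
    ∃ F : Coprod G (FreeGroup Unit) ⧸ Subgroup.normalClosure
          ({(Coprod.inr (FreeGroup.of ()) : Coprod G (FreeGroup Unit)) ^ l * Coprod.inl g *
            (Coprod.inr (FreeGroup.of ()) : Coprod G (FreeGroup Unit)) ^ k * Coprod.inl g} :
            Set (Coprod G (FreeGroup Unit))) →* P,
      (∀ w : G, F (QuotientGroup.mk' _ (Coprod.inl w)) = i w) ∧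
        F (QuotientGroup.mk' _ (Coprod.inr (FreeGroup.of ()))) = y := by
  refine ⟨QuotientGroup.lift _ (Coprod.lift i (FreeGroup.lift fun _ => y)) ?_, ?_, ?_⟩
  · refine Subgroup.normalClosure_le_normal ?_
    rw [Set.singleton_subset_iff, SetLike.mem_coe, MonoidHom.mem_ker]
    simpa using h
  · intro w
    simp
  · simp

theorem comp_inl_surjective {G Q : Type*} [Group G] [Group Q] {f : Coprod G (FreeGroup Unit) →* Q}
    (hf : Function.Surjective f)
    (hx : f (Coprod.inr (FreeGroup.of ())) ∈ (f.comp Coprod.inl).range) :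
    Function.Surjective (f.comp (Coprod.inl : G →* Coprod G (FreeGroup Unit))) := by
  have hle : (f.comp (Coprod.inr : FreeGroup Unit →* Coprod G (FreeGroup Unit))).range ≤
      (f.comp (Coprod.inl : G →* Coprod G (FreeGroup Unit))).range := by
    rw [MonoidHom.range_eq_map, ← FreeGroup.closure_range_of, MonoidHom.map_closure,
      Subgroup.closure_le]
    rintro _ ⟨_, ⟨⟨⟩, rfl⟩, rfl⟩
    exact hx
  rw [← MonoidHom.range_eq_top, ← sup_eq_left.mpr hle, ← Coprod.range_eq]
  exact MonoidHom.range_eq_top.mpr hf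

theorem mem_of_zpow_mul_mul_zpow_mul_eq_one {Q : Type*} [Group Q] {S : Subgroup Q} {l k : ℤ}
    (habs : |l + k| = 1) (h0 : l = 0 ∨ k = 0) {a y : Q} (ha : a ∈ S)
    (hr : y ^ l * a * y ^ k * a = 1) : y ∈ S := by
  have hy : y ^ (l + k) ∈ S := by
    rcases h0 with rfl | rfl
    · have e : y ^ (0 + k) = a⁻¹ * (y ^ (0 : ℤ) * a * y ^ k * a) * a⁻¹ := by group
      rw [e, hr]
      exact mul_mem (mul_mem (inv_mem ha) (one_mem _)) (inv_mem ha)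
    · have e : y ^ (l + 0) = (y ^ l * a * y ^ (0 : ℤ) * a) * a⁻¹ * a⁻¹ := by group
      rw [e, hr]
      exact mul_mem (mul_mem (one_mem _) (inv_mem ha)) (inv_mem ha)
  rcases (abs_eq zero_le_one).mp habs with h | h
  · simpa [h] using hy
  · simpa [h] using hy

/-- Case (Z) of Theorem 4.2: for `g ∈ G` a nontrivial element of finite order and
integers `l, k` not both zero, the natural map `G → ⟨G, x | xˡ g xᵏ g⟩` is an
isomorphism iff `|l + k| = 1` and (`l = 0` or `k = 0`). -/
theorem stmt_1 {G : Type*} [Group G] (g : G) (hg : g ≠ 1) (hfin : IsOfFinOrder g)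
    (l k : ℤ) (hlk : ¬(l = 0 ∧ k = 0)) :
    Function.Bijective
      ((QuotientGroup.mk' (Subgroup.normalClosure
          ({(Coprod.inr (FreeGroup.of ()) : Coprod G (FreeGroup Unit)) ^ l * Coprod.inl g *
            (Coprod.inr (FreeGroup.of ()) : Coprod G (FreeGroup Unit)) ^ k * Coprod.inl g} :
            Set (Coprod G (FreeGroup Unit))))).comp
        (Coprod.inl : G →* Coprod G (FreeGroup Unit))) ↔
      (|l + k| = 1 ∧ (l = 0 ∨ k = 0)) := by
  constructor
  · rintro ⟨-, hsurj⟩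
    have himage : ∀ {P : Type u_1} [Group P] (i : G →* P) (y : P),
        y ^ l * i g * y ^ k * i g = 1 → ∃ w, i w = y := by
      intro P _ i y h
      obtain ⟨F, hF, hFy⟩ := exists_hom_of_relation g l k i y h
      obtain ⟨w, hw⟩ := hsurj (QuotientGroup.mk' _ (Coprod.inr (FreeGroup.of ())))
      exact ⟨w, by rw [← hF, ← hFy, ← hw]; rfl⟩
    have habs : |l + k| = 1 := by
      obtain ⟨w, hw⟩ := himage (P := ULift (Multiplicative (ZMod (l + k).natAbs))) 1
        (ULift.up (Multiplicative.ofAdd 1)) (by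
          rw [MonoidHom.one_apply, mul_one, mul_one, ← zpow_add]
          apply ULift.ext
          change Multiplicative.ofAdd ((1 : ZMod (l + k).natAbs)) ^ (l + k) = 1
          rw [← ofAdd_zsmul, ofAdd_eq_one, zsmul_one, ZMod.intCast_zmod_eq_zero_iff_dvd]
          simp)
      have h1 : (1 : ZMod (l + k).natAbs) = 0 := by
        have := congrArg ULift.down hw
        exact (ofAdd_eq_one.mp this.symm)
      have h2 : ((1 : ℤ) : ZMod (l + k).natAbs) = 0 := by simpa using h1
      rw [ZMod.intCast_zmod_eq_zero_iff_dvd] at h2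
      rw [Int.abs_eq_natAbs]
      exact_mod_cast Int.natCast_dvd_natCast.mp h2 |> Nat.dvd_one.mp
    refine ⟨habs, ?_⟩
    by_contra! hne
    have hn : 2 ≤ orderOf g := by
      have h0 := hfin.orderOf_pos
      have h1 := orderOf_eq_one_iff.not.mpr hg
      omega
    obtain ⟨a, x, ha, hr, hc⟩ := exists_GL_relation_of_abs_add_eq_one hn habs hne.1 hne.2
    let e : ULift.{u_1} (GL (Fin 2) ℂ) ≃* GL (Fin 2) ℂ := MulEquiv.ulift
    obtain ⟨P, _, i, j, hij, hmem⟩ := exists_amalgam_of_orderOf_eq g (e.symm a)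
      (by rw [MulEquiv.orderOf_eq, ha])
    obtain ⟨w, hw⟩ := himage i (j (e.symm x)) (by
      rw [hij]
      simp only [← map_zpow, ← map_mul, hr, map_one])
    obtain ⟨z, hz⟩ := hmem w (e.symm x) hw
    have hx : a ^ z = x := congrArg ULift.down hz
    exact hc (hx ▸ (Commute.refl a).zpow_right z)
  · rintro ⟨habs, h0⟩
    have hlk1 : (l + k) * (l + k) = 1 := by rw [← abs_mul_abs_self, habs, one_mul]
    constructor
    · obtain ⟨F, hF, -⟩ := exists_hom_of_relation g l k (MonoidHom.id G)
        (g ^ (-2 * (l + k))) (by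
          rw [MonoidHom.id_apply, ← zpow_mul, ← zpow_mul, ← zpow_add_one, ← zpow_add,
            ← zpow_add_one]
          convert zpow_zero g using 2
          linear_combination (-2) * hlk1)
      exact Function.LeftInverse.injective (g := F) hF
    · refine comp_inl_surjective (QuotientGroup.mk'_surjective _) ?_
      refine mem_of_zpow_mul_mul_zpow_mul_eq_one habs h0
        (a := QuotientGroup.mk' _ (Coprod.inl g)) ⟨g, rfl⟩ ?_
      exact (QuotientGroup.eq_one_iff _).mpr
        (Subgroup.subset_normalClosure (Set.mem_singleton _))
end

section
/- The group defined by the presentation ⟨g, h, x | g², h³, (g h)² (g⁻¹ h⁻¹)², x² g x⁻¹ h⟩ (the quotient of the free group on three generators g, h, x by the normal closure of these four relators) is finite of order 27216. -/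
/-- The relators `g²`, `h³`, `(g h)² (g⁻¹ h⁻¹)²`, `x² g x⁻¹ h` in the free group
on three generators `g = of 0`, `h = of 1`, `x = of 2`. -/
def stmt7Rels : Set (FreeGroup (Fin 3)) :=
  {FreeGroup.of 0 ^ 2,
   FreeGroup.of 1 ^ 3,
   (FreeGroup.of 0 * FreeGroup.of 1) ^ 2 * ((FreeGroup.of 0)⁻¹ * (FreeGroup.of 1)⁻¹) ^ 2,
   FreeGroup.of 2 ^ 2 * FreeGroup.of 0 * (FreeGroup.of 2)⁻¹ * FreeGroup.of 1}

/-- An exponent of an element of order three. -/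
inductive Syllable
  | zero
  | one
  | two
  deriving DecidableEq

namespace Syllable

/-- The exponent as a natural number. -/
def toNat : Syllable → ℕ
  | zero => 0
  | one => 1
  | two => 2

/-- Addition modulo three. -/
def add : Syllable → Syllable → Syllable
  | zero, b => b
  | a, zero => a
  | one, one => two
  | one, two => zero
  | two, one => zero
  | two, two => one

/-- Subtraction modulo three. -/
def sub : Syllable → Syllable → Syllable
  | a, zero => a
  | a, one => a.add two
  | a, two => a.add one

/-- Apply `k` to `a` once the kernel has evaluated `a`. -/
def force {α : Type*} : Syllable → (Syllable → α) → α
  | zero, k => k zero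
  | one, k => k one
  | two, k => k two

/-- Put a syllable in front of a word, cancelling `g * g` if the word starts with `zero`. -/
def cons (a : Syllable) : List Syllable → List Syllable
  | zero :: b :: w => a.add b :: w
  | w => a :: w

end Syllable

open Syllable

/-- A finite set of rules `u ↦ (e, v, j)` on words in syllables, stored as a trie: a vertex
`rule e v j` at the end of the path `u` records that `u = y ^ j * v * c ^ e`. -/
inductive CosetTrie
  | leaf
  | rule (e : ℤ) (v : List Syllable) (j : Syllable)
  | node (l m r : CosetTrie)

namespace CosetTrie

section Strict

variable {α : Type*}

/-- Apply `k` to `n` once the kernel has evaluated `n`. -/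
def forceNat : ℕ → (ℕ → α) → α
  | 0, k => k 0
  | n + 1, k => k (n + 1)

/-- Apply `k` to `e` once the kernel has evaluated `e`. -/
def forceInt : ℤ → (ℤ → α) → α
  | .ofNat n, k => forceNat n fun n => k (.ofNat n)
  | .negSucc n, k => forceNat n fun n => k (.negSucc n)

/-- Apply `k` to `t` once the kernel has evaluated the root of `t`. -/
def force : CosetTrie → (CosetTrie → α) → α
  | leaf, k => k leaf
  | rule e v j, k => k (rule e v j)
  | node l m r, k => k (node l m r)

/-- Evaluate a word and apply `k` to its initial part and its last syllable. -/
def splitThen (d : α) : List Syllable → (List Syllable → Syllable → α) → α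
  | [], _ => d
  | [a], k => a.force fun a => k [] a
  | a :: b :: w, k => a.force fun a => splitThen d (b :: w) fun u z => k (a :: u) z

/-- Apply `k` to the trie obtained from `t` by adding the rule `u ↦ (e, v, j)`. -/
def insertThen (e : ℤ) (v : List Syllable) (j : Syllable) :
    CosetTrie → List Syllable → (CosetTrie → α) → α
  | _, [], k => k (rule e v j)
  | rule e' v' j', _ :: _, k => k (rule e' v' j')
  | leaf, zero :: u, k => insertThen e v j leaf u fun l => k (node l leaf leaf)
  | leaf, one :: u, k => insertThen e v j leaf u fun m => k (node leaf m leaf)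
  | leaf, two :: u, k => insertThen e v j leaf u fun r => k (node leaf leaf r)
  | node l m r, zero :: u, k => insertThen e v j l u fun l => k (node l m r)
  | node l m r, one :: u, k => insertThen e v j m u fun m => k (node l m r)
  | node l m r, two :: u, k => insertThen e v j r u fun r => k (node l m r)

/-- Evaluate a word and apply `k` to it. -/
def forceWord {α : Type*} : List Syllable → (List Syllable → α) → α
  | [], k => k []
  | a :: w, k => a.force fun a => forceWord w fun w => k (a :: w)

end Strict

/-- Rewrite a prefix of a word, if some rule applies. -/
def find : CosetTrie → List Syllable → Option (ℤ × List Syllable)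
  | _, [] => none
  | leaf, _ :: _ => none
  | rule e v j, a :: w => some (e, v.foldr cons ((j.add a).cons w))
  | node l _ _, zero :: w => l.find w
  | node _ m _, one :: w => m.find w
  | node _ _ r, two :: w => r.find w

/-- Apply at most `n` rules to a word, adding up the exponents. -/
def reduce (t : CosetTrie) : ℕ → ℤ → List Syllable → ℤ × List Syllable
  | 0, e, w => (e, w)
  | n + 1, e, w =>
    match t.find w with
    | none => (e, w)
    | some (f, v) => t.reduce n (e + f) v

/-- The normal form of a word. -/
def nf (t : CosetTrie) (w : List Syllable) : ℤ × List Syllable := t.reduce 1000 0 (w.foldr cons [])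

/-- The subtrie below a word. -/
def subtrie : CosetTrie → List Syllable → CosetTrie
  | t, [] => t
  | node l _ _, zero :: u => l.subtrie u
  | node _ m _, one :: u => m.subtrie u
  | node _ _ r, two :: u => r.subtrie u
  | leaf, _ :: _ => leaf
  | rule _ _ _, _ :: _ => leaf

/-- The left-hand sides of the rules of a trie. -/
def lhs : CosetTrie → List (List Syllable)
  | leaf => []
  | rule _ _ _ => [[]]
  | node l m r => l.lhs.map (zero :: ·) ++ m.lhs.map (one :: ·) ++ r.lhs.map (two :: ·)

/-- The facts recorded by the rules whose left-hand side extends `u`. -/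
def factsBelow (t : CosetTrie) (u : List Syllable) :
    List (List Syllable × ℤ × List Syllable) :=
  (t.subtrie u).lhs.map fun p => (u ++ p ++ [zero], t.nf (u ++ p ++ [zero]))

/-- Order words by length, and words of the same length by their last difference; `tie` is the
outcome for equal words. -/
def precedes (tie : Bool) : List Syllable → List Syllable → Bool
  | [], [] => tie
  | [], _ :: _ => true
  | _ :: _, [] => false
  | a :: u, b :: v =>
    precedes (match a, b with
      | zero, zero | one, one | two, two => tie
      | zero, _ | one, two => true
      | _, _ => false) u v

/-- Make a trie imply the facts `u = v * c ^ e` on a list. -/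
def addFacts : ℕ → CosetTrie → List (List Syllable × ℤ × List Syllable) → CosetTrie
  | 0, t, _ => t
  | _ + 1, t, [] => t
  | n + 1, t, (u, e, v) :: q =>
    match t.nf u, t.nf v with
    | (f, u'), (h, v') =>
      splitThen t u' fun u a => splitThen t v' fun v b => forceInt (e + h - f) fun e =>
        match precedes false v u, precedes false u v with
        | true, _ => (b.sub a).force fun j => insertThen e v j t u fun s =>
          addFacts n s ((v ++ [j, zero], -e, u) :: (t.factsBelow u ++ q))
        | false, true => (a.sub b).force fun j => insertThen (-e) u j t v fun s =>
          addFacts n s ((u ++ [j, zero], e, v) :: (t.factsBelow v ++ q))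
        | false, false => addFacts n t q

/-- The facts expressing that the relator `r` acts trivially on the three elements `y ^ a * w`. -/
def relatorFacts (w : List Syllable) : List Syllable → List (List Syllable × ℤ × List Syllable)
  | [] => []
  | b :: r => [zero, one, two].map fun a => (w ++ a.add b :: (r ++ [zero]), 0, w ++ [a])

/-- Todd–Coxeter enumeration: let the relator act trivially on every irreducible word, where
`ws` holds words still to be treated and `next` longer words to be treated afterwards. -/
def enumerate (r : List Syllable) :
    ℕ → CosetTrie → List (List Syllable) → List (List Syllable) → CosetTrie
  | 0, t, _, _ => t
  | _ + 1, t, [], [] => t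
  | n + 1, t, [], w :: next => enumerate r n t (w :: next) []
  | n + 1, t, w :: ws, next =>
    match t.find (w ++ [zero]) with
    | some _ => enumerate r n t ws next
    | none =>
      force (addFacts 1000 t (relatorFacts w r)) fun t =>
        enumerate r n t ws ((w ++ [one]) :: (w ++ [two]) :: next)

section Table

/-- The words leading from the root of a trie to a child of an inner vertex. -/
def vertices : CosetTrie → List (List Syllable)
  | leaf => []
  | rule _ _ _ => []
  | node l m r =>
    [zero] :: [one] :: [two] ::
      (l.vertices.map (zero :: ·) ++ m.vertices.map (one :: ·) ++ r.vertices.map (two :: ·))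

/-- Whether a word leads from the root of a trie to a child of an inner vertex. -/
def isVertex : CosetTrie → List Syllable → Bool
  | node _ _ _, [_] => true
  | node l _ _, zero :: w => l.isVertex w
  | node _ m _, one :: w => m.isVertex w
  | node _ _ r, two :: w => r.isVertex w
  | _, _ => false

/-- Append letters to a word one by one, passing to the normal form each time. -/
def run (t : CosetTrie) : List Syllable → ℤ → List Syllable → ℤ × List Syllable
  | [], e, w => (e, w)
  | a :: r, e, w =>
    match t.nf (w ++ [a]) with
    | (f, v) => forceInt (e + f) fun e => forceWord v fun v => t.run r e v

/-- Rewrite a word in the letters `zero` and `one`. -/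
def expand : List Syllable → List Syllable
  | [] => []
  | two :: w => one :: zero :: one :: expand w
  | a :: w => a :: expand w

/-- Whether a word acts trivially on a vertex, with exponents modulo `n`. -/
def fixes (t : CosetTrie) (n : ℕ) (w r : List Syllable) : Bool :=
  match t.run r 0 w with
  | (e, v) => v == w && e % n == 0

/-- Whether a trie describes a transitive action of the group with relator `r` on the
cosets of a cyclic subgroup. -/
def isTable (t : CosetTrie) (n : ℕ) (r c : List Syllable) : Bool :=
  (t.vertices.all fun w =>
    ([zero, one, two].all fun a => t.isVertex (t.nf (w ++ [a])).2) &&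
    t.fixes n w [zero, zero] && t.fixes n w [one, zero, one, zero, one, zero] &&
    t.fixes n w (expand r) && (t.run (expand (zero :: w)) 0 [zero]).2 == w) &&
  t.isVertex [zero] && t.run (expand c) 0 [zero] == (1, [zero]) &&
  t.vertices.any fun w => t.run (expand r) 0 w == ((n : ℤ), w)

end Table
end CosetTrie

namespace Syllable

variable {G : Type*} [Group G] (g y : G)

/-- The value of a word, where a syllable `k` stands for `g * y ^ k` and words are read from
right to left. -/
def eval : List Syllable → G
  | [] => 1
  | k :: w => eval w * (g * y ^ k.toNat)

variable {g y}

@[simp]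
theorem toNat_zero : zero.toNat = 0 := rfl

@[simp]
theorem toNat_one : one.toNat = 1 := rfl

@[simp]
theorem toNat_two : two.toNat = 2 := rfl

theorem eval_append (u v : List Syllable) : eval g y (u ++ v) = eval g y v * eval g y u := by
  induction u with
  | nil => simp [eval]
  | cons a u ih => simp [eval, ih, mul_assoc]

theorem eval_concat (w : List Syllable) (a : Syllable) :
    eval g y (w ++ [a]) = g * y ^ a.toNat * eval g y w := by
  simp [eval_append, eval]

theorem pow_add_toNat (hy : y ^ 3 = 1) (a b : Syllable) :
    y ^ (a.add b).toNat = y ^ a.toNat * y ^ b.toNat := by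
  have h4 : y = y ^ 4 := by rw [pow_succ, hy, one_mul]
  rw [← pow_add]
  cases a <;> cases b <;> simp [add, hy, ← h4]

theorem pow_sub_toNat (hy : y ^ 3 = 1) (a b : Syllable) :
    y ^ (a.sub b).toNat = y ^ a.toNat * (y ^ b.toNat)⁻¹ := by
  rw [eq_mul_inv_iff_mul_eq, ← pow_add_toNat hy]
  cases a <;> cases b <;> rfl

theorem eval_cons (hg : g ^ 2 = 1) (hy : y ^ 3 = 1) (a : Syllable) (w : List Syllable) :
    eval g y (a.cons w) = eval g y w * (g * y ^ a.toNat) := by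
  fun_cases Syllable.cons a w with
  | case1 b w =>
    have hc : y ^ (a.add b).toNat = y ^ b.toNat * y ^ a.toNat := by
      rw [pow_add_toNat hy, ← pow_add, add_comm, pow_add]
    simp only [eval, hc, toNat_zero, pow_zero, mul_one, mul_assoc]
    rw [← mul_assoc g g, ← pow_two, hg, one_mul]
  | case2 => rfl

theorem eval_foldr_cons (hg : g ^ 2 = 1) (hy : y ^ 3 = 1) (v w : List Syllable) :
    eval g y (v.foldr cons w) = eval g y w * eval g y v := by
  induction v with
  | nil => simp [eval]
  | cons a v ih => simp [eval, eval_cons hg hy, ih, mul_assoc]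

@[simp]
theorem force_eq {α : Type*} (a : Syllable) (k : Syllable → α) : a.force k = k a := by
  cases a <;> rfl

end Syllable

namespace CosetTrie

section Strict

variable {α : Type*}

@[simp]
theorem forceNat_eq (n : ℕ) (k : ℕ → α) : forceNat n k = k n := by
  cases n <;> rfl

@[simp]
theorem forceInt_eq (e : ℤ) (k : ℤ → α) : forceInt e k = k e := by
  cases e <;> simp [forceInt]

@[simp]
theorem force_eq (t : CosetTrie) (k : CosetTrie → α) : t.force k = k t := by
  cases t <;> rfl

@[simp]
theorem forceWord_eq (w : List Syllable) (k : List Syllable → α) : forceWord w k = k w := by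
  induction w generalizing k with
  | nil => rfl
  | cons a w ih => simp [forceWord, ih]

theorem splitThen_induction {P : α → Prop} {d : α} (hd : P d) {w : List Syllable}
    {k : List Syllable → Syllable → α} (hk : ∀ u a, w = u ++ [a] → P (k u a)) :
    P (splitThen d w k) := by
  induction w generalizing k with
  | nil => exact hd
  | cons a w ih =>
    cases w with
    | nil => simpa [splitThen] using hk [] a rfl
    | cons b w =>
      simp only [splitThen, Syllable.force_eq]
      exact ih fun u z h => hk (a :: u) z (by simp [h])

end Strict

variable {G : Type*} [Group G] (g y c : G)

/-- The rules of a trie hold in a group if the value of the path to the root is `x`. -/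
def Sound (x : G) : CosetTrie → Prop
  | leaf => True
  | rule e v j => x = y ^ j.toNat * eval g y v * c ^ e
  | node l m r => l.Sound (g * x) ∧ m.Sound (g * y * x) ∧ r.Sound (g * y ^ 2 * x)

/-- The fact `u = v * c ^ e`. -/
def Holds (f : List Syllable × ℤ × List Syllable) : Prop :=
  eval g y f.1 = eval g y f.2.2 * c ^ f.2.1

variable {g y c}

theorem Sound.insertThen {α : Type*} {P : α → Prop} {e : ℤ} {v : List Syllable} {j : Syllable}
    {x : G} {t : CosetTrie} (ht : t.Sound g y c x) {u : List Syllable}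
    (hu : eval g y u * x = y ^ j.toNat * eval g y v * c ^ e) {k : CosetTrie → α}
    (hk : ∀ s : CosetTrie, s.Sound g y c x → P (k s)) : P (insertThen e v j t u k) := by
  induction u generalizing t x k with
  | nil => cases t <;> exact hk _ (by simpa [Sound, eval] using hu)
  | cons a u ih =>
    rw [eval, mul_assoc] at hu
    cases t with
    | rule e' v' j' => exact hk _ ht
    | leaf =>
      cases a <;>
      exact ih (t := leaf) trivial hu fun s hs => hk _ (by simpa [Sound] using hs)
    | node l m r =>
      obtain ⟨hl, hm, hr⟩ := ht
      cases a
      · exact ih hl (by simpa using hu) fun s hs => hk _ ⟨hs, hm, hr⟩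
      · exact ih hm (by simpa using hu) fun s hs => hk _ ⟨hl, hs, hr⟩
      · exact ih hr (by simpa using hu) fun s hs => hk _ ⟨hl, hm, hs⟩

theorem Sound.find (hg : g ^ 2 = 1) (hy : y ^ 3 = 1) {x : G} {t : CosetTrie}
    (ht : t.Sound g y c x) {w v : List Syllable} {e : ℤ} (h : t.find w = some (e, v)) :
    eval g y w * x = eval g y v * c ^ e := by
  induction w generalizing t x with
  | nil => cases t <;> simp [CosetTrie.find] at h
  | cons a w ih =>
    cases t with
    | leaf => simp [CosetTrie.find] at h
    | rule e' v' j' =>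
      simp only [CosetTrie.find, Option.some.injEq, Prod.mk.injEq] at h
      obtain ⟨rfl, rfl⟩ := h
      have hx : x = y ^ j'.toNat * eval g y v' * c ^ e' := ht
      have hc : y ^ (j'.add a).toNat = y ^ a.toNat * y ^ j'.toNat := by
        rw [pow_add_toNat hy, ← pow_add, add_comm, pow_add]
      rw [hx, eval_foldr_cons hg hy, eval_cons hg hy, hc]
      simp only [eval, mul_assoc]
    | node l m r =>
      obtain ⟨hl, hm, hr⟩ := ht
      rw [eval, mul_assoc]
      cases a
      · simpa using ih hl h
      · simpa using ih hm h
      · simpa using ih hr h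

theorem Sound.reduce (hg : g ^ 2 = 1) (hy : y ^ 3 = 1) {t : CosetTrie} (ht : t.Sound g y c 1)
    (n : ℕ) (e : ℤ) (w : List Syllable) :
    eval g y (t.reduce n e w).2 * c ^ (t.reduce n e w).1 = eval g y w * c ^ e := by
  induction n generalizing e w with
  | zero => rfl
  | succ n ih =>
    rw [CosetTrie.reduce]
    split
    · rfl
    · next f v h =>
      have := ht.find hg hy h
      rw [mul_one] at this
      rw [ih, this, mul_assoc, ← zpow_add, add_comm]

theorem Sound.nf (hg : g ^ 2 = 1) (hy : y ^ 3 = 1) {t : CosetTrie} (ht : t.Sound g y c 1)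
    (w : List Syllable) : eval g y w = eval g y (t.nf w).2 * c ^ (t.nf w).1 := by
  rw [CosetTrie.nf, ht.reduce hg hy, eval_foldr_cons hg hy]
  simp [eval]

theorem Sound.factsBelow (hg : g ^ 2 = 1) (hy : y ^ 3 = 1) {t : CosetTrie}
    (ht : t.Sound g y c 1) (u : List Syllable) : ∀ f ∈ t.factsBelow u, Holds g y c f := by
  simp only [CosetTrie.factsBelow, List.mem_map]
  rintro _ ⟨p, -, rfl⟩
  exact ht.nf hg hy _

theorem Sound.addFacts (hg : g ^ 2 = 1) (hy : y ^ 3 = 1) (n : ℕ) {t : CosetTrie}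
    (ht : t.Sound g y c 1) {q : List (List Syllable × ℤ × List Syllable)}
    (hq : ∀ f ∈ q, Holds g y c f) : (addFacts n t q).Sound g y c 1 := by
  have key {u v : List Syllable} {a b : Syllable} {e : ℤ}
      (h : eval g y (u ++ [a]) = eval g y (v ++ [b]) * c ^ e) :
      eval g y u = y ^ (b.sub a).toNat * eval g y v * c ^ e ∧
      Holds g y c (v ++ [b.sub a, zero], -e, u) := by
    have hc : y ^ (b.sub a).toNat = (y ^ a.toNat)⁻¹ * y ^ b.toNat := by
      rw [pow_sub_toNat hy, ← zpow_natCast, ← zpow_natCast, ← zpow_neg, ← zpow_add, ← zpow_add,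
        add_comm]
    have h' : eval g y u = y ^ (b.sub a).toNat * eval g y v * c ^ e := by
      rw [eval_concat, eval_concat, mul_assoc, mul_assoc, mul_assoc] at h
      rw [hc, mul_assoc, mul_assoc, eq_inv_mul_iff_mul_eq]
      exact mul_left_cancel h
    refine ⟨h', ?_⟩
    simp only [Holds, h', eval_append, eval, toNat_zero, pow_zero, mul_one, one_mul, mul_assoc,
      zpow_neg, mul_inv_cancel]
    rw [← mul_assoc g g, ← pow_two, hg, one_mul]
  induction n generalizing t q with
  | zero => exact ht
  | succ n ih =>
    obtain - | ⟨⟨u, e, v⟩, q⟩ := q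
    · exact ht
    have huv : eval g y u = eval g y v * c ^ e := hq _ List.mem_cons_self
    have hq' : ∀ f ∈ q, Holds g y c f := fun f hf => hq f (List.mem_cons_of_mem _ hf)
    simp only [CosetTrie.addFacts]
    refine splitThen_induction ht fun u' a hu => splitThen_induction ht fun v' b hv => ?_
    have heq : eval g y (u' ++ [a]) =
        eval g y (v' ++ [b]) * c ^ (e + (t.nf v).1 - (t.nf u).1) := by
      rw [← hu, ← hv, sub_eq_add_neg, add_comm e, zpow_add, zpow_add, ← mul_assoc, ← mul_assoc,
        ← ht.nf hg hy, ← huv, zpow_neg, eq_mul_inv_iff_mul_eq, ← ht.nf hg hy]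
    rw [forceInt_eq]
    generalize e + (t.nf v).1 - (t.nf u).1 = e at heq
    have heq' : eval g y (v' ++ [b]) = eval g y (u' ++ [a]) * c ^ (-e) := by
      rw [heq, zpow_neg, mul_inv_cancel_right]
    split
    · rw [Syllable.force_eq]
      refine ht.insertThen (by rw [mul_one]; exact (key heq).1) fun s hs => ih hs fun f hf => ?_
      obtain rfl | hf := List.mem_cons.1 hf
      · exact (key heq).2
      · exact (List.mem_append.1 hf).elim (ht.factsBelow hg hy _ f) (hq' f)
    · rw [Syllable.force_eq]
      refine ht.insertThen (by rw [mul_one]; exact (key heq').1) fun s hs => ih hs fun f hf => ?_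
      obtain rfl | hf := List.mem_cons.1 hf
      · simpa using (key heq').2
      · exact (List.mem_append.1 hf).elim (ht.factsBelow hg hy _ f) (hq' f)
    · exact ih ht hq'

theorem holds_relatorFacts (hy : y ^ 3 = 1) {r : List Syllable}
    (hr : eval g y r = 1) (w : List Syllable) : ∀ f ∈ relatorFacts w r, Holds g y c f := by
  cases r with
  | nil => simp [relatorFacts]
  | cons b r =>
    simp only [relatorFacts, List.mem_map]
    rintro _ ⟨a, -, rfl⟩
    have hc : y ^ (a.add b).toNat = y ^ b.toNat * y ^ a.toNat := by
      rw [pow_add_toNat hy, ← pow_add, add_comm, pow_add]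
    rw [eval] at hr
    simp only [Holds, eval_append, eval, hc, toNat_zero, pow_zero, mul_one, one_mul, zpow_zero]
    calc g * eval g y r * (g * (y ^ b.toNat * y ^ a.toNat)) * eval g y w
        = g * (eval g y r * (g * y ^ b.toNat)) * y ^ a.toNat * eval g y w := by group
      _ = _ := by rw [hr, mul_one]

theorem Sound.enumerate (hg : g ^ 2 = 1) (hy : y ^ 3 = 1) {r : List Syllable}
    (hr : eval g y r = 1) (n : ℕ) {t : CosetTrie} (ht : t.Sound g y c 1)
    (ws next : List (List Syllable)) : (enumerate r n t ws next).Sound g y c 1 := by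
  induction n generalizing t ws next with
  | zero => exact ht
  | succ n ih =>
    obtain - | ⟨w, ws⟩ := ws
    · cases next
      · exact ht
      · exact ih ht _ _
    · rw [CosetTrie.enumerate]
      split
      · exact ih ht _ _
      · rw [force_eq]
        exact ih (ht.addFacts hg hy _ (holds_relatorFacts hy hr w)) _ _

theorem mem_vertices {t : CosetTrie} {w : List Syllable} : w ∈ t.vertices ↔ t.isVertex w := by
  induction t generalizing w with
  | leaf => simp [vertices, isVertex]
  | rule => simp [vertices, isVertex]
  | node l m r hl hm hr =>
    obtain - | ⟨a, - | ⟨b, w⟩⟩ := w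
    · simp [vertices, isVertex]
    · cases a <;> simp [vertices, isVertex]
    · cases a <;> simp [vertices, isVertex, hl, hm, hr]

theorem nodup_vertices (t : CosetTrie) : t.vertices.Nodup := by
  have h (t : CosetTrie) : [] ∉ t.vertices := by cases t <;> simp [vertices]
  induction t with
  | leaf => simp [vertices]
  | rule => simp [vertices]
  | node l m r hl hm hr =>
    have hc (a : Syllable) : Function.Injective (a :: · : List Syllable → _) :=
      List.cons_injective
    simp [vertices, List.nodup_append, List.nodup_map_iff (hc _), hl, hm, hr, h]
    rintro w - _ (⟨v, -, rfl⟩ | ⟨v, -, rfl⟩) <;> simp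

theorem run_cons (t : CosetTrie) (a : Syllable) (r : List Syllable) (e : ℤ) (w : List Syllable) :
    t.run (a :: r) e w = t.run r (e + (t.nf (w ++ [a])).1) (t.nf (w ++ [a])).2 := by
  simp [run]

section Sound

variable {G : Type*} [Group G] {g y c : G}

theorem Sound.run (hg : g ^ 2 = 1) (hy : y ^ 3 = 1) {t : CosetTrie} (ht : t.Sound g y c 1)
    (r : List Syllable) (e : ℤ) (w : List Syllable) :
    eval g y (t.run r e w).2 * c ^ (t.run r e w).1 = eval g y (w ++ r) * c ^ e := by
  induction r generalizing e w with
  | nil => simp [CosetTrie.run]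
  | cons a r ih =>
    rw [run_cons, ih, eval_append, mul_assoc, add_comm, zpow_add, ← mul_assoc (eval g y _) (c ^ _),
      ← ht.nf hg hy, ← mul_assoc, ← eval_append, List.append_assoc, List.singleton_append]

theorem eval_expand (hg : g ^ 2 = 1) (w : List Syllable) :
    eval g y (expand w) = eval g y w := by
  induction w with
  | nil => rfl
  | cons a w ih =>
    cases a <;> simp only [expand, eval, ih, toNat_zero, toNat_one, toNat_two]
    simp only [pow_zero, pow_one, mul_one, mul_assoc]
    rw [← mul_assoc g g, ← pow_two, hg, one_mul, pow_two]

end Sound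

/-- The vertices of a trie, with exponents modulo `n`. -/
abbrev Point (t : CosetTrie) (n : ℕ) : Type := {w // t.isVertex w = true} × ZMod n

theorem card_point (t : CosetTrie) (n : ℕ) : Nat.card (t.Point n) = t.vertices.length * n := by
  have h : Nat.card {w // t.isVertex w = true} = t.vertices.length := by
    simp_rw [← mem_vertices, ← List.mem_toFinset]
    rw [Nat.card_eq_fintype_card, Fintype.card_coe, List.toFinset_card_of_nodup t.nodup_vertices]
  rw [Nat.card_prod, h, Nat.card_zmod]

instance (t : CosetTrie) (n : ℕ) [NeZero n] : Finite (t.Point n) :=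
  have : Finite {w // t.isVertex w = true} := by
    simp_rw [← mem_vertices]
    exact t.vertices.finite_toSet
  inferInstance

section Action

variable {t : CosetTrie} {n : ℕ} (ht : ∀ w, t.isVertex w → ∀ a, t.isVertex (t.nf (w ++ [a])).2)

/-- The action of a letter on the points of a trie. -/
def act (a : Syllable) (x : t.Point n) : t.Point n :=
  (⟨(t.nf (x.1.1 ++ [a])).2, ht _ x.1.2 a⟩, x.2 + (t.nf (x.1.1 ++ [a])).1)

/-- The action of a word on the points of a trie, one letter at a time. -/
def actWord (r : List Syllable) (x : t.Point n) : t.Point n :=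
  r.foldl (fun x a => act ht a x) x

theorem actWord_spec (r : List Syllable) (x : t.Point n) (e : ℤ) :
    (actWord ht r x).1.1 = (t.run r e x.1.1).2 ∧
      (actWord ht r x).2 + e = x.2 + (t.run r e x.1.1).1 := by
  induction r generalizing x e with
  | nil => exact ⟨rfl, rfl⟩
  | cons a r ih =>
    rw [run_cons]
    obtain ⟨h₁, h₂⟩ := ih (act ht a x) (e + (t.nf (x.1.1 ++ [a])).1)
    refine ⟨h₁, ?_⟩
    simp only [act, Int.cast_add] at h₂
    simp only [actWord, List.foldl_cons, act] at h₂ ⊢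
    linear_combination h₂

theorem actWord_of_fixes {r : List Syllable} (h : ∀ w, t.isVertex w → t.fixes n w r) :
    actWord ht r = (id : t.Point n → t.Point n) := by
  funext x
  have hx := h _ x.1.2
  obtain ⟨h₁, h₂⟩ := actWord_spec ht r x 0
  simp only [fixes, Bool.and_eq_true, beq_iff_eq] at hx
  refine Prod.ext (Subtype.ext (h₁.trans hx.1)) ?_
  have : (((t.run r 0 x.1.1).1 : ℤ) : ZMod n) = 0 :=
    (ZMod.intCast_zmod_eq_zero_iff_dvd _ _).2 (Int.dvd_of_emod_eq_zero hx.2)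
  simpa [this] using h₂

theorem actWord_append (r s : List Syllable) (x : t.Point n) :
    actWord ht (r ++ s) x = actWord ht s (actWord ht r x) :=
  List.foldl_append

variable {ht}

/-- The first generator as a permutation of the points of a trie. -/
def permG (h : actWord ht [zero, zero] = (id : t.Point n → t.Point n)) :
    Equiv.Perm (t.Point n) where
  toFun := actWord ht [zero]
  invFun := actWord ht [zero]
  left_inv x := by rw [← actWord_append]; exact congrFun h x
  right_inv x := by rw [← actWord_append]; exact congrFun h x

/-- The second generator as a permutation of the points of a trie. -/
def permY (h : actWord ht [one, zero, one, zero, one, zero] = (id : t.Point n → t.Point n)) :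
    Equiv.Perm (t.Point n) where
  toFun := actWord ht [one, zero]
  invFun := actWord ht [one, zero, one, zero]
  left_inv x := by rw [← actWord_append]; exact congrFun h x
  right_inv x := by rw [← actWord_append]; exact congrFun h x

variable (hG : actWord ht [zero, zero] = (id : t.Point n → t.Point n))
  (hY : actWord ht [one, zero, one, zero, one, zero] = (id : t.Point n → t.Point n))

theorem permG_apply (x : t.Point n) : permG hG x = actWord ht [zero] x := rfl

theorem permY_apply (x : t.Point n) : permY hY x = actWord ht [one, zero] x := rfl

theorem permG_sq : permG hG ^ 2 = 1 := by
  ext1 x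
  rw [pow_two, Equiv.Perm.mul_apply, permG_apply, permG_apply, ← actWord_append]
  exact congrFun hG x

theorem permY_cube : permY hY ^ 3 = 1 := by
  ext1 x
  rw [pow_three, Equiv.Perm.mul_apply, Equiv.Perm.mul_apply, permY_apply, permY_apply,
    permY_apply, ← actWord_append, ← actWord_append]
  exact congrFun hY x

theorem eval_perm (w : List Syllable) (x : t.Point n) :
    eval (permG hG) (permY hY) w x = actWord ht (expand w) x := by
  have h (s : List Syllable) (x : t.Point n) :
      actWord ht [zero] (actWord ht (s ++ [zero]) x) = actWord ht s x := by
    rw [actWord_append, ← actWord_append]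
    exact congrFun hG _
  have hsplit : [one, zero] = [one] ++ [zero] := rfl
  induction w generalizing x with
  | nil => rfl
  | cons a w ih =>
    rw [eval, Equiv.Perm.mul_apply, ih, Equiv.Perm.mul_apply, permG_apply]
    cases a
    · rw [toNat_zero, pow_zero, Equiv.Perm.one_apply, ← actWord_append]
      rfl
    · rw [toNat_one, pow_one, permY_apply, hsplit, h, ← actWord_append]
      rfl
    · rw [toNat_two, pow_two, Equiv.Perm.mul_apply, permY_apply, permY_apply, hsplit, h,
        ← actWord_append, ← actWord_append]
      rfl

end Action

section Table

variable {t : CosetTrie} {n : ℕ} {r d : List Syllable}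

theorem isTable_closed (h : t.isTable n r d) :
    ∀ w, t.isVertex w → ∀ a, t.isVertex (t.nf (w ++ [a])).2 := by
  simp only [isTable, Bool.and_eq_true, List.all_eq_true, mem_vertices] at h
  intro w hw a
  exact (h.1.1.1 w hw).1.1.1.1 a (by cases a <;> simp)

theorem isTable_fixes (h : t.isTable n r d) {s : List Syllable}
    (hs : s ∈ [[zero, zero], [one, zero, one, zero, one, zero], expand r]) :
    ∀ w, t.isVertex w → t.fixes n w s := by
  simp only [isTable, Bool.and_eq_true, List.all_eq_true, mem_vertices] at h
  intro w hw
  have := h.1.1.1 w hw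
  simp only [List.mem_cons, List.not_mem_nil, or_false] at hs
  obtain rfl | rfl | rfl := hs
  exacts [this.1.1.1.2, this.1.1.2, this.1.2]

theorem exists_perm [NeZero n] (h : t.isTable n r d) :
    ∃ p q : Equiv.Perm (t.Point n), p ^ 2 = 1 ∧ q ^ 3 = 1 ∧ eval p q r = 1 ∧
      ∃ x, ∀ z, ∃ w, eval p q w x = z := by
  have hclosed := isTable_closed h
  have hG := actWord_of_fixes hclosed (isTable_fixes h (s := [zero, zero]) (by simp))
  have hY := actWord_of_fixes hclosed
    (isTable_fixes h (s := [one, zero, one, zero, one, zero]) (by simp))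
  have hR := actWord_of_fixes hclosed (isTable_fixes h (s := expand r) (by simp))
  refine ⟨permG hG, permY hY, permG_sq hG, permY_cube hY, ?_, ?_⟩
  · ext1 x
    rw [eval_perm]
    exact congrFun hR x
  simp only [isTable, Bool.and_eq_true, List.all_eq_true, mem_vertices, beq_iff_eq] at h
  obtain ⟨⟨⟨hw, h₀⟩, hd⟩, -⟩ := h
  have hcycle (m : ℕ) : ∃ w, 
      eval (permG hG) (permY hY) w (⟨[zero], h₀⟩, 0) = (⟨[zero], h₀⟩, (m : ZMod n)) := by
    induction m with
    | zero => exact ⟨[], by simp [eval]⟩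
    | succ m ih =>
      obtain ⟨w, ih⟩ := ih
      refine ⟨w ++ d, ?_⟩
      obtain ⟨h₁, h₂⟩ := actWord_spec hclosed (expand d) (⟨[zero], h₀⟩, (m : ZMod n)) 0
      rw [hd] at h₁ h₂
      rw [eval_append, Equiv.Perm.mul_apply, ih, eval_perm]
      exact Prod.ext (Subtype.ext h₁) (by simpa using h₂)
  refine ⟨(⟨[zero], h₀⟩, 0), fun ⟨⟨w, h₁⟩, k⟩ => ?_⟩
  obtain ⟨v, hv⟩ := hcycle (k - Int.cast (t.run (expand (zero :: w)) 0 [zero]).1).val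
  refine ⟨v ++ zero :: w, ?_⟩
  obtain ⟨h₂, h₃⟩ := actWord_spec hclosed (expand (zero :: w))
    (⟨[zero], h₀⟩, k - Int.cast (t.run (expand (zero :: w)) 0 [zero]).1) 0
  rw [eval_append, Equiv.Perm.mul_apply, hv, ZMod.natCast_zmod_val, eval_perm]
  exact Prod.ext (Subtype.ext (h₂.trans (hw w h₁).2)) (by simpa using h₃)

/-- The order of a group with a complete and sound coset table. -/
theorem card_eq [NeZero n] (h : t.isTable n r d) {G : Type*} [Group G] {g y c : G}
    (hg : g ^ 2 = 1) (hy : y ^ 3 = 1) (hr : eval g y r = 1) (hgen : Subgroup.closure {g, y} = ⊤)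
    (hs : t.Sound g y c 1)
    (hlift : ∀ p q : Equiv.Perm (t.Point n), p ^ 2 = 1 → q ^ 3 = 1 → eval p q r = 1 →
      ∃ φ : G →* Equiv.Perm (t.Point n), φ g = p ∧ φ y = q) :
    Nat.card G = t.vertices.length * n := by
  have hclosed := isTable_closed h
  obtain ⟨p, q, hp, hq, hpq, x, hx⟩ := exists_perm h
  obtain ⟨φ, rfl, rfl⟩ := hlift p q hp hq hpq
  simp only [isTable, Bool.and_eq_true, List.any_eq_true, beq_iff_eq] at h
  obtain ⟨⟨⟨-, h₀⟩, -⟩, w, -, hw⟩ := h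
  have hc : c ^ n = 1 := by
    have := hs.run hg hy (expand r) 0 w
    rw [hw, eval_append, eval_expand hg, hr, one_mul, zpow_zero, mul_one] at this
    simpa using this
  have hgg (u : G) : g * (g * u) = u := by rw [← mul_assoc, ← pow_two, hg, one_mul]
  have hyy (u : G) : y * (y * (y * u)) = u := by
    rw [← mul_assoc, ← mul_assoc, mul_assoc y, ← pow_three, hy, one_mul]
  let S : Set G := {u | ∃ w, t.isVertex w ∧ ∃ e : ℤ, u = eval g y w * c ^ e}
  have hS (a : Syllable) {u : G} : u ∈ S → g * y ^ a.toNat * u ∈ S := by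
    rintro ⟨w, hw, e, rfl⟩
    refine ⟨_, hclosed w hw a, (t.nf (w ++ [a])).1 + e, ?_⟩
    rw [zpow_add, ← mul_assoc, ← mul_assoc, ← hs.nf hg hy, eval_concat]
  have hSg {u : G} (hu : u ∈ S) : g * u ∈ S := by simpa using hS zero hu
  have hSy {u : G} (hu : u ∈ S) : y * u ∈ S := by
    simpa [mul_assoc, hgg] using hSg (hS one hu)
  have hSmul (z : G) : ∀ u ∈ S, z * u ∈ S ∧ z⁻¹ * u ∈ S := by
    have hz : z ∈ Subgroup.closure {g, y} := hgen ▸ Subgroup.mem_top z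
    induction hz using Subgroup.closure_induction with
    | mem z hz =>
      intro u hu
      obtain rfl | rfl := hz
      · exact ⟨hSg hu, by rw [← hgg u, inv_mul_cancel_left]; exact hSg hu⟩
      · exact ⟨hSy hu, by rw [← hyy u, inv_mul_cancel_left]; exact hSy (hSy hu)⟩
    | one => simp
    | mul z z' _ _ ih ih' =>
      intro u hu
      rw [mul_inv_rev, mul_assoc, mul_assoc]
      exact ⟨(ih _ (ih' u hu).1).1, (ih' _ (ih u hu).2).2⟩
    | inv z _ ih =>
      intro u hu
      rw [inv_inv]
      exact (ih u hu).symm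
  have h1 : (1 : G) ∈ S := by
    have : g ∈ S := ⟨[zero], h₀, 0, by simp [eval]⟩
    simpa [← pow_two, hg] using hSg this
  have hsurj : Function.Surjective fun x : t.Point n => eval g y x.1.1 * c ^ x.2.val := by
    intro z
    obtain ⟨w, hw, e, he⟩ := (hSmul z 1 h1).1
    refine ⟨(⟨w, hw⟩, (e : ZMod n)), ?_⟩
    rw [mul_one] at he
    rw [he, zpow_eq_zpow_emod' e hc, ← ZMod.val_intCast, zpow_natCast]
  have : Finite G := Finite.of_surjective _ hsurj
  have heval (w : List Syllable) : φ (eval g y w) = eval (φ g) (φ y) w := by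
    induction w with
    | nil => exact map_one φ
    | cons a w ih => simp [eval, ih]
  have hsurj' : Function.Surjective fun z : G => φ z x := fun z => by
    obtain ⟨w, hw⟩ := hx z
    exact ⟨eval g y w, by simpa only [heval] using hw⟩
  rw [← card_point]
  exact le_antisymm (Nat.card_le_card_of_surjective _ hsurj)
    (Nat.card_le_card_of_surjective _ hsurj')

end Table

end CosetTrie

open CosetTrie

/-- A relator in `g` and `y = x * g` equivalent to the long relator of `stmt7Rels`. -/
def stmt7Relator : List Syllable :=
  [one, two, two, one, two, one, one, two, one, one, two, two]

/-- The rules found by enumerating, with fuel `n` and `m`, the cosets of the subgroup generated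
by `g * y ^ 2 * g * y`. -/
@[irreducible]
def stmt7TrieOfFuel (n m : ℕ) : CosetTrie :=
  enumerate stmt7Relator n (addFacts m leaf [([one, two, zero], 1, [zero])]) [[], [zero]] []

theorem stmt7TrieOfFuel_sound {G : Type*} [Group G] {g y : G} (hg : g ^ 2 = 1) (hy : y ^ 3 = 1)
    (hr : eval g y stmt7Relator = 1) (n m : ℕ) :
    (stmt7TrieOfFuel n m).Sound g y (g⁻¹ * eval g y [one, two, zero]) 1 := by
  have h₀ : leaf.Sound g y (g⁻¹ * eval g y [one, two, zero]) 1 := trivial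
  have h₁ := h₀.addFacts hg hy m (q := [([one, two, zero], 1, [zero])]) (by simp [Holds, eval])
  unfold stmt7TrieOfFuel
  exact h₁.enumerate hg hy hr n _ _

/-- The complete set of rules. -/
@[irreducible]
def stmt7Trie : CosetTrie :=
  stmt7TrieOfFuel 1000 100

theorem stmt7Trie_isTable : stmt7Trie.vertices.length = 216 ∧
    stmt7Trie.isTable 126 stmt7Relator [zero, one, two, zero] := by
  have h : stmt7Trie.force (fun t => t.vertices.length == 216 &&
      t.isTable 126 stmt7Relator [zero, one, two, zero]) = true := by
    decide +kernel
  simpa only [CosetTrie.force_eq, Bool.and_eq_true, beq_iff_eq] using h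

theorem stmt7Trie_sound {G : Type*} [Group G] {g y : G} (hg : g ^ 2 = 1) (hy : y ^ 3 = 1)
    (hr : eval g y stmt7Relator = 1) :
    stmt7Trie.Sound g y (g⁻¹ * eval g y [one, two, zero]) 1 := by
  unfold stmt7Trie
  exact stmt7TrieOfFuel_sound hg hy hr 1000 100

theorem eval_stmt7Relator_eq_one_iff {G : Type*} [Group G] {g y : G} (hg : g ^ 2 = 1)
    (hy : y ^ 3 = 1) : eval g y stmt7Relator = 1 ↔
      (g * (y * g * y ^ 2 * g * y ^ 2)) ^ 2 * (g⁻¹ * (y * g * y ^ 2 * g * y ^ 2)⁻¹) ^ 2 = 1 := by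
  have hg' : g⁻¹ = g := inv_eq_of_mul_eq_one_left (by rw [← pow_two, hg])
  have hy' : y⁻¹ = y * y := inv_eq_of_mul_eq_one_left (by rw [← pow_three', hy])
  have hyy (u : G) : y * (y * (y * u)) = u := by
    rw [← mul_assoc, ← mul_assoc, mul_assoc y, ← pow_three, hy, one_mul]
  have h₁ : eval g y stmt7Relator =
      eval g y [two, one, one, two, one, one, two, two] * eval g y [one, two, two, one] :=
    eval_append [one, two, two, one] _
  have h₂ : (g * (y * g * y ^ 2 * g * y ^ 2)) ^ 2 * (g⁻¹ * (y * g * y ^ 2 * g * y ^ 2)⁻¹) ^ 2 =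
      eval g y [one, two, two, one] * eval g y [two, one, one, two, one, one, two, two] := by
    simp only [eval, toNat_one, toNat_two, pow_one, pow_two, mul_inv_rev, hg', hy', mul_assoc,
      one_mul, hyy]
  rw [h₁, h₂, mul_eq_one_comm]

/-- Solving the last relator of `stmt7Rels` for `h`. -/
theorem eq_of_stmt7Rels {G : Type*} [Group G] {g h y : G} (hg : g ^ 2 = 1) (hh : h ^ 3 = 1)
    (hx : (y * g) ^ 2 * g * (y * g)⁻¹ * h = 1) :
    y ^ 3 = 1 ∧ h = y * g * y ^ 2 * g * y ^ 2 := by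
  have hg' : g⁻¹ = g := inv_eq_of_mul_eq_one_left (by rw [← pow_two, hg])
  have hgg (u : G) : g * (g * u) = u := by rw [← mul_assoc, ← pow_two, hg, one_mul]
  have hinv : h⁻¹ = (y * g) * y * (y * g)⁻¹ := by
    rw [← eq_inv_of_mul_eq_one_left hx]
    simp [pow_two, mul_assoc, hg', hgg]
  have hy : y ^ 3 = 1 := by
    have := congrArg (· ^ 3) hinv
    simp only [conj_pow, inv_pow, hh, inv_one] at this
    exact conj_eq_one_iff.1 this.symm
  have hy' : y⁻¹ = y ^ 2 := inv_eq_of_mul_eq_one_left (by rw [← pow_succ, hy])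
  refine ⟨hy, ?_⟩
  rw [← inv_inv h, hinv]
  simp [mul_assoc, hg', ← hy']

theorem lift_stmt7Rels_eq_one {G : Type*} [Group G] {g y : G} (hg : g ^ 2 = 1) (hy : y ^ 3 = 1)
    (hr : eval g y stmt7Relator = 1) : ∀ z ∈ stmt7Rels,
      FreeGroup.lift ![g, y * g * y ^ 2 * g * y ^ 2, y * g] z = 1 := by
  have hg' : g⁻¹ = g := inv_eq_of_mul_eq_one_left (by rw [← pow_two, hg])
  have hgg (u : G) : g * (g * u) = u := by rw [← mul_assoc, ← pow_two, hg, one_mul]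
  have hyy (u : G) : y * (y * (y * u)) = u := by
    rw [← mul_assoc, ← mul_assoc, mul_assoc y, ← pow_three, hy, one_mul]
  have hyyy : y * (y * y) = 1 := by rw [← pow_three, hy]
  rintro z (rfl | rfl | rfl | rfl)
  · simpa using hg
  · simp [pow_three, pow_two, mul_assoc, hgg, hyy, hyyy]
  · simpa using (eval_stmt7Relator_eq_one_iff hg hy).1 hr
  · simp [pow_two, mul_assoc, hgg, hyy, hyyy]

/-- The group `⟨g, h, x | g², h³, (g h)² (g⁻¹ h⁻¹)², x² g x⁻¹ h⟩` is finite of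
order `27216`. -/
theorem stmt_7 : Nat.card (PresentedGroup stmt7Rels) = 27216 := by
  have hrel {z : FreeGroup (Fin 3)} (hz : z ∈ stmt7Rels) : PresentedGroup.mk stmt7Rels z = 1 :=
    PresentedGroup.one_of_mem hz
  obtain ⟨g, hg_def⟩ : ∃ g, g = (PresentedGroup.of 0 : PresentedGroup stmt7Rels) := ⟨_, rfl⟩
  obtain ⟨h, hh_def⟩ : ∃ h, h = (PresentedGroup.of 1 : PresentedGroup stmt7Rels) := ⟨_, rfl⟩
  obtain ⟨x, hx_def⟩ : ∃ x, x = (PresentedGroup.of 2 : PresentedGroup stmt7Rels) := ⟨_, rfl⟩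
  have hg : g ^ 2 = 1 := hg_def ▸ hrel (Or.inl rfl)
  have hh : h ^ 3 = 1 := hh_def ▸ hrel (Or.inr (Or.inl rfl))
  have hgh : (g * h) ^ 2 * (g⁻¹ * h⁻¹) ^ 2 = 1 :=
    hg_def ▸ hh_def ▸ hrel (Or.inr (Or.inr (Or.inl rfl)))
  have hx : x ^ 2 * g * x⁻¹ * h = 1 :=
    hg_def ▸ hh_def ▸ hx_def ▸ hrel (Or.inr (Or.inr (Or.inr rfl)))
  obtain ⟨y, rfl⟩ : ∃ y, x = y * g := ⟨x * g⁻¹, by simp⟩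
  obtain ⟨hy, rfl⟩ := eq_of_stmt7Rels hg hh hx
  have hr := (eval_stmt7Relator_eq_one_iff hg hy).2 hgh
  have hgen : Subgroup.closure {g, y} = ⊤ := by
    rw [eq_top_iff, ← PresentedGroup.closure_range_of, Subgroup.closure_le]
    have hg_mem : g ∈ Subgroup.closure {g, y} := Subgroup.subset_closure (by simp)
    have hy_mem : y ∈ Subgroup.closure {g, y} := Subgroup.subset_closure (by simp)
    rintro _ ⟨i, rfl⟩
    fin_cases i
    · exact hg_def ▸ hg_mem
    · exact hh_def ▸ mul_mem (mul_mem (mul_mem (mul_mem hy_mem hg_mem) (pow_mem hy_mem 2)) hg_mem)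
        (pow_mem hy_mem 2)
    · exact hx_def ▸ mul_mem hy_mem hg_mem
  obtain ⟨hlen, htable⟩ := stmt7Trie_isTable
  refine (card_eq htable hg hy hr hgen (stmt7Trie_sound hg hy hr) ?_).trans (by rw [hlen])
  intro p q hp hq hpq
  let φ := PresentedGroup.toGroup (lift_stmt7Rels_eq_one hp hq hpq)
  have hφg : φ g = p := hg_def ▸ PresentedGroup.toGroup.of _
  have hφx : φ (y * g) = q * p := hx_def ▸ PresentedGroup.toGroup.of _
  exact ⟨φ, hφg, by rwa [map_mul, hφg, mul_left_inj] at hφx⟩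
end

section
/- The group defined by the presentation ⟨g, h, x | g³, h³, g h g⁻¹ h⁻¹, x² g x⁻¹ h⟩ (the quotient of the free group on three generators g, h, x by the normal closure of these four relators) is finite of order 13608. -/
/-- The relators `g³`, `h³`, `g h g⁻¹ h⁻¹`, `x² g x⁻¹ h` in the free group on
three generators `g = of 0`, `h = of 1`, `x = of 2`. -/
def stmt8Rels : Set (FreeGroup (Fin 3)) :=
  {FreeGroup.of 0 ^ 3,
   FreeGroup.of 1 ^ 3,
   FreeGroup.of 0 * FreeGroup.of 1 * (FreeGroup.of 0)⁻¹ * (FreeGroup.of 1)⁻¹,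
   FreeGroup.of 2 ^ 2 * FreeGroup.of 0 * (FreeGroup.of 2)⁻¹ * FreeGroup.of 1}

namespace CosetEnum

/-- The generators `x`, `h`, their formal inverses, and a letter `e` for the identity. -/
inductive Letter
  | x | xInv | h | hInv | e

/-- The formal inverse of a letter. -/
def Letter.inv : Letter → Letter
  | x => xInv | xInv => x | h => hInv | hInv => h | e => e

/-- The `k`-th digit of `t` in base `2 ^ 11`; numbers serve as arrays of entries below `2 ^ 11`. -/
def digit (t k : ℕ) : ℕ := (t >>> (11 * k)) % 2048

/-- Replace the `k`-th digit of `t` by `v`; this has no effect if `v` is too large. -/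
def setDigit (t k v : ℕ) : ℕ :=
  bif Nat.blt v 2048 then t ^^^ ((digit t k ^^^ v) <<< (11 * k)) else t

/-- A coset table, with one array for each letter. -/
structure Table where
  x : ℕ
  xInv : ℕ
  h : ℕ
  hInv : ℕ
  e : ℕ

/-- The entry for coset `i` and letter `s`: `0` if undefined, `j + 1` if `s` maps `i` to `j`. The
letter `e` maps a redundant coset to a smaller one it coincides with. -/
def look : Table → ℕ → Letter → ℕ
  | ⟨a, _, _, _, _⟩, i, .x => digit a i
  | ⟨_, a, _, _, _⟩, i, .xInv => digit a i
  | ⟨_, _, a, _, _⟩, i, .h => digit a i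
  | ⟨_, _, _, a, _⟩, i, .hInv => digit a i
  | ⟨_, _, _, _, a⟩, i, .e => digit a i

/-- Overwrite the entry for coset `i` and letter `s`. -/
def put : Table → ℕ → Letter → ℕ → Table
  | ⟨a, b, c, d, e⟩, i, .x, v => ⟨setDigit a i v, b, c, d, e⟩
  | ⟨a, b, c, d, e⟩, i, .xInv, v => ⟨a, setDigit b i v, c, d, e⟩
  | ⟨a, b, c, d, e⟩, i, .h, v => ⟨a, b, setDigit c i v, d, e⟩
  | ⟨a, b, c, d, e⟩, i, .hInv, v => ⟨a, b, c, setDigit d i v, e⟩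
  | ⟨a, b, c, d, e⟩, i, .e, v => ⟨a, b, c, d, setDigit e i v⟩

/-- Record that `s` maps `i` to `j`. -/
def link (t : Table) (i : ℕ) (s : Letter) (j : ℕ) : Table :=
  put (put t i s (j + 1)) j s.inv (i + 1)

/-- Follow a word as far as the table allows; return the endpoint and the unread part. -/
def trace (t : Table) : ℕ → List Letter → ℕ × List Letter
  | f, [] => (f, [])
  | f, s :: w => match look t f s with
    | 0 => (f, s :: w)
    | j + 1 => trace t j w

/-- The formal inverse of a word. -/
def invWord (w : List Letter) : List Letter := (w.map Letter.inv).reverse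

/-- The smallest known number of a coset. -/
def find (t : Table) : ℕ → ℕ → ℕ
  | 0, i => i
  | k + 1, i => match look t i .e with
    | 0 => i
    | j + 1 => find t k j

/-- Transfer the entry for letter `s` of the redundant coset `b` to the coset `a`, recording the
coincidences this reveals. -/
def transfer (a b : ℕ) (p : Table × List (ℕ × ℕ)) (s : Letter) : Table × List (ℕ × ℕ) :=
  match look p.1 b s with
  | 0 => p
  | c + 1 =>
    let t := put (put p.1 b s 0) c s.inv 0
    let c₁ := find t 100 c
    match look t a s with
    | u + 1 => (t, (c₁, u) :: p.2)
    | 0 => match look t c₁ s.inv with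
      | u + 1 => (t, (a, u) :: p.2)
      | 0 => (link t a s c₁, p.2)

/-- Declare `b` redundant because it coincides with `a`. -/
def absorb (t : Table) (q : List (ℕ × ℕ)) (a b : ℕ) : Table × List (ℕ × ℕ) :=
  [.x, .xInv, .h, .hInv].foldl (transfer a b) (put t b .e (a + 1), q)

/-- Process a list of coincidences. -/
def merge : ℕ → Table × List (ℕ × ℕ) → Table
  | 0, p => p.1
  | k + 1, p => match p.2 with
    | [] => p.1
    | (a, b) :: q =>
      let a₁ := find p.1 100 a
      let b₁ := find p.1 100 b
      bif Nat.beq a₁ b₁ then merge k (p.1, q)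
      else bif Nat.blt a₁ b₁ then merge k (absorb p.1 q a₁ b₁)
      else merge k (absorb p.1 q b₁ a₁)

/-- Introduce new cosets so that the given word leads from `f` to `b`. -/
def fill (b : ℕ) : Table → ℕ → ℕ → List Letter → Table × ℕ
  | t, n, _, [] => (t, n)
  | t, n, f, [s] => match look t b s.inv with
    | 0 => (link t f s b, n)
    | u + 1 => (merge 1000 (t, [(f, u)]), n)
  | t, n, f, s :: s₁ :: w => fill b (link t f s n) (n + 1) n (s₁ :: w)

/-- Make the word `w` fix the coset `a`. -/
def scan (a : ℕ) (p : Table × ℕ) (w : List Letter) : Table × ℕ :=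
  match look p.1 a .e with
  | _ + 1 => p
  | 0 => match trace p.1 a w with
    | (f, []) => (merge 1000 (p.1, [(f, a)]), p.2)
    | (f, s :: w₁) => match trace p.1 a (invWord (s :: w₁)) with
      | (b, []) => (merge 1000 (p.1, [(f, b)]), p.2)
      | (b, s₁ :: w₂) => fill b p.1 p.2 f (invWord (s₁ :: w₂))

/-- Scan the relators `rels` at the cosets `a`, `a + 1`, …, stopping after at most `k` cosets. -/
def run (rels : List (List Letter)) : ℕ → ℕ → Table × ℕ → Table × ℕ
  | 0, _, p => p
  | k + 1, a, p => bif Nat.blt a p.2 then run rels k (a + 1) (rels.foldl (scan a) p) else p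

/-- Whether `i` is not known to be redundant. -/
def isLive (t : Table) (i : ℕ) : Bool := Nat.beq (look t i .e) 0

/-- Whether tracing `w` from `i` leads back to `i`. -/
def closes (t : Table) (i : ℕ) (w : List Letter) : Bool :=
  match trace t i w with
  | (f, []) => Nat.beq f i
  | _ => false

/-- Whether the letter `s` maps `i` to a live coset, which the inverse letter maps back to `i`. -/
def isPaired (t : Table) (n i : ℕ) (s : Letter) : Bool :=
  match look t i s with
  | 0 => false
  | j + 1 => Nat.blt j n && (isLive t j && Nat.beq (look t j s.inv) (i + 1))

/-- Whether the row of `i` is complete, satisfies the relators, and, unless `i = 0`, has an entry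
smaller than `i`. -/
def isGoodRow (rels : List (List Letter)) (t : Table) (n i : ℕ) : Bool :=
  [.x, .xInv, .h, .hInv].all (isPaired t n i) && (rels.all (closes t i) &&
    (Nat.beq i 0 || [.x, .xInv, .h, .hInv].any fun s => Nat.ble (look t i s) i))

/-- The numbers of the live cosets. -/
def liveList (t : Table) (n : ℕ) : List ℕ := (List.range n).filter (isLive t)

/-- Whether the table is complete, with `m` live cosets. -/
def isComplete (rels subs : List (List Letter)) (m : ℕ) (p : Table × ℕ) : Bool :=
  Nat.beq (liveList p.1 p.2).length m && ((liveList p.1 p.2).all (isGoodRow rels p.1 p.2) &&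
    (subs.all (closes p.1 0) && (Nat.blt 0 p.2 && isLive p.1 0)))

/-- The relators of the group, as words in `x` and `h`. -/
def relators : List (List Letter) :=
  [[.h, .h, .h], [.hInv, .xInv, .hInv, .xInv, .hInv, .xInv],
    [.xInv, .hInv, .x, .x, .h, .xInv, .h, .x, .hInv, .xInv]]

/-- Generators of the subgroup whose cosets are enumerated. -/
def subgroupGens : List (List Letter) := [[.h], [.x, .hInv, .xInv, .xInv]]

/-- The coset table resulting from the enumeration. -/
def result : Table × ℕ := run relators 2000 0 (subgroupGens.foldl (scan 0) (⟨0, 0, 0, 0, 0⟩, 1))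

section Arrays

theorem digit_lt (t k : ℕ) : digit t k < 2048 := Nat.mod_lt _ (by norm_num)

theorem testBit_digit (t k i : ℕ) :
    (digit t k).testBit i = (decide (i < 11) && t.testBit (11 * k + i)) := by
  rw [digit, show 2048 = 2 ^ 11 by norm_num, Nat.testBit_mod_two_pow, Nat.testBit_shiftRight]

theorem digit_setDigit_self {v : ℕ} (hv : v < 2048) (t k : ℕ) :
    digit (setDigit t k v) k = v := by
  have hb : Nat.blt v 2048 = true := by simpa [Nat.blt_eq] using hv
  refine Nat.eq_of_testBit_eq fun i => ?_
  rw [testBit_digit, setDigit, hb, cond_true, Nat.testBit_xor, Nat.testBit_shiftLeft,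
    Nat.testBit_xor, Nat.add_sub_cancel_left, testBit_digit]
  by_cases hi : i < 11
  · simp [hi]
  · have : v.testBit i = false := Nat.testBit_lt_two_pow
      (lt_of_lt_of_le hv (show 2048 ≤ 2 ^ i from
        Nat.pow_le_pow_right (n := 2) (by norm_num) (show 11 ≤ i by omega)))
    simp [hi, this]

theorem digit_setDigit_of_ne {k j : ℕ} (hjk : j ≠ k) (t v : ℕ) :
    digit (setDigit t k v) j = digit t j := by
  rw [setDigit]
  cases hb : Nat.blt v 2048
  · rfl
  have hv : v < 2 ^ 11 := by simpa [Nat.blt_eq] using hb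
  refine Nat.eq_of_testBit_eq fun i => ?_
  rw [testBit_digit, testBit_digit, cond_true, Nat.testBit_xor, Nat.testBit_shiftLeft]
  by_cases hi : i < 11
  · by_cases hge : 11 * j + i ≥ 11 * k
    · have hlt : digit t k ^^^ v < 2 ^ 11 := Nat.xor_lt_two_pow (digit_lt t k) hv
      rw [Nat.testBit_lt_two_pow (i := 11 * j + i - 11 * k)
        (lt_of_lt_of_le hlt (Nat.pow_le_pow_right (by norm_num) (by omega)))]
      simp
    · simp [hge]
  · simp [hi]

theorem digit_setDigit (t k v j : ℕ) :
    digit (setDigit t k v) j = digit t j ∨ j = k ∧ digit (setDigit t k v) j = v := by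
  by_cases hjk : j = k
  · by_cases hv : v < 2048
    · exact .inr ⟨hjk, hjk ▸ digit_setDigit_self hv t k⟩
    · left
      have hb : Nat.blt v 2048 = false := by
        rw [← Bool.not_eq_true, Nat.blt_eq]
        exact hv
      rw [setDigit, hb, cond_false]
  · exact .inl (digit_setDigit_of_ne hjk t v)

theorem look_put (t : Table) (i : ℕ) (s : Letter) (w j : ℕ) (s₁ : Letter) :
    look (put t i s w) j s₁ = look t j s₁ ∨ j = i ∧ s₁ = s ∧ look (put t i s w) j s₁ = w := by
  cases s <;> cases s₁ <;> simp [look, put, digit_setDigit]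

end Arrays

section Soundness

variable {G X : Type*} [Group G] [MulAction G X] (x h : G)

/-- The element of a group denoted by a letter. -/
def Letter.val : Letter → G
  | .x => x | .xInv => x⁻¹ | .h => h | .hInv => h⁻¹ | .e => 1

theorem Letter.val_inv (s : Letter) : s.inv.val x h = (s.val x h)⁻¹ := by
  cases s <;> simp [Letter.val, Letter.inv]

/-- The element of a group denoted by a word, whose letters act from first to last. -/
def wordVal : List Letter → G
  | [] => 1
  | s :: w => wordVal w * s.val x h

theorem wordVal_append (w w₁ : List Letter) :
    wordVal x h (w ++ w₁) = wordVal x h w₁ * wordVal x h w := by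
  induction w with
  | nil => simp [wordVal]
  | cons s w ih => simp [wordVal, ih, mul_assoc]

theorem wordVal_invWord (w : List Letter) : wordVal x h (invWord w) = (wordVal x h w)⁻¹ := by
  induction w with
  | nil => simp [wordVal, invWord]
  | cons s w ih =>
    have : invWord (s :: w) = invWord w ++ [s.inv] := by simp [invWord]
    rw [this, wordVal_append, ih]
    simp [wordVal, Letter.val_inv]

/-- The entries of `t` are correct if the cosets `i < n` are interpreted as the points `v i`. -/
def Sound (v : ℕ → X) (n : ℕ) (t : Table) : Prop :=
  ∀ i s j, look t i s = j + 1 → i < n ∧ j < n ∧ s.val x h • v i = v j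

/-- The pairs in `q` are pairs of names of the same point. -/
def SoundPairs (v : ℕ → X) (n : ℕ) (q : List (ℕ × ℕ)) : Prop :=
  ∀ c ∈ q, c.1 < n ∧ c.2 < n ∧ v c.1 = v c.2

variable {x h} {v : ℕ → X} {n : ℕ} {t : Table}

theorem Sound.put_zero (ht : Sound x h v n t) (i : ℕ) (s : Letter) :
    Sound x h v n (put t i s 0) := by
  intro i₁ s₁ j hj
  rcases look_put t i s 0 i₁ s₁ with h1 | ⟨-, -, h1⟩
  · exact ht _ _ _ (h1 ▸ hj)
  · omega

theorem Sound.put_succ (ht : Sound x h v n t) {i j : ℕ} {s : Letter} (hi : i < n) (hj : j < n)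
    (hs : s.val x h • v i = v j) : Sound x h v n (put t i s (j + 1)) := by
  intro i₁ s₁ j₁ hj'
  rcases look_put t i s (j + 1) i₁ s₁ with h1 | ⟨rfl, rfl, h1⟩
  · exact ht _ _ _ (h1 ▸ hj')
  · obtain rfl : j = j₁ := by omega
    exact ⟨hi, hj, hs⟩

theorem Sound.link (ht : Sound x h v n t) {i j : ℕ} {s : Letter} (hi : i < n) (hj : j < n)
    (hs : s.val x h • v i = v j) : Sound x h v n (link t i s j) :=
  (ht.put_succ hi hj hs).put_succ hj hi (by rw [Letter.val_inv, ← hs, inv_smul_smul])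

theorem Sound.trace (ht : Sound x h v n t) (w : List Letter) {f : ℕ} (hf : f < n) :
    (trace t f w).1 < n ∧
      wordVal x h w • v f = wordVal x h (trace t f w).2 • v (trace t f w).1 := by
  induction w generalizing f with
  | nil => exact ⟨hf, rfl⟩
  | cons s w ih =>
    rw [CosetEnum.trace]
    split
    · exact ⟨hf, rfl⟩
    · next j hj =>
      obtain ⟨-, h2, h3⟩ := ht _ _ _ hj
      rw [wordVal, mul_smul, h3]
      exact ih h2

theorem Sound.find (ht : Sound x h v n t) (k : ℕ) {i : ℕ} (hi : i < n) :
    find t k i < n ∧ v (find t k i) = v i := by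
  induction k generalizing i with
  | zero => exact ⟨hi, rfl⟩
  | succ k ih =>
    rw [CosetEnum.find]
    split
    · exact ⟨hi, rfl⟩
    · next j hj =>
      obtain ⟨-, h2, h3⟩ := ht _ _ _ hj
      rw [Letter.val, one_smul] at h3
      rw [h3]
      exact ih h2

theorem SoundPairs.cons {q : List (ℕ × ℕ)} (hq : SoundPairs v n q) {a b : ℕ} (ha : a < n)
    (hb : b < n) (hab : v a = v b) : SoundPairs v n ((a, b) :: q) :=
  List.forall_mem_cons.2 ⟨⟨ha, hb, hab⟩, hq⟩

theorem Sound.transfer {p : Table × List (ℕ × ℕ)} (ht : Sound x h v n p.1)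
    (hq : SoundPairs v n p.2) {a b : ℕ} (ha : a < n) (hab : v a = v b) (s : Letter) :
    Sound x h v n (transfer a b p s).1 ∧ SoundPairs v n (transfer a b p s).2 := by
  rw [CosetEnum.transfer]
  split
  · exact ⟨ht, hq⟩
  · next c hc =>
    obtain ⟨-, hcn, hc⟩ := ht _ _ _ hc
    have ht' := (ht.put_zero b s).put_zero c s.inv
    obtain ⟨hfn, hf⟩ := ht'.find 100 hcn
    rw [← hab, ← hf] at hc
    dsimp only
    split
    · next u hu =>
      obtain ⟨-, hun, hu⟩ := ht' _ _ _ hu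
      exact ⟨ht', hq.cons hfn hun (hc.symm.trans hu)⟩
    · split
      · next u hu =>
        obtain ⟨-, hun, hu⟩ := ht' _ _ _ hu
        rw [← hc, Letter.val_inv, inv_smul_smul] at hu
        exact ⟨ht', hq.cons ha hun hu⟩
      · exact ⟨ht'.link ha hfn hc, hq⟩

theorem Sound.absorb (ht : Sound x h v n t) {q : List (ℕ × ℕ)} (hq : SoundPairs v n q) {a b : ℕ}
    (ha : a < n) (hb : b < n) (hab : v a = v b) :
    Sound x h v n (absorb t q a b).1 ∧ SoundPairs v n (absorb t q a b).2 := by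
  rw [CosetEnum.absorb]
  refine List.foldlRecOn (motive := fun p : Table × List (ℕ × ℕ) => Sound x h v n p.1 ∧
    SoundPairs v n p.2) _ _ ⟨ht.put_succ (s := .e) hb ha (by rw [Letter.val, one_smul, hab]), hq⟩
      fun p hp s _ => ?_
  exact hp.1.transfer hp.2 ha hab s

theorem Sound.merge (k : ℕ) {p : Table × List (ℕ × ℕ)} (ht : Sound x h v n p.1)
    (hq : SoundPairs v n p.2) : Sound x h v n (merge k p) := by
  induction k generalizing p with
  | zero => exact ht
  | succ k ih =>
    rw [CosetEnum.merge]
    split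
    · exact ht
    · next a b q hp =>
      rw [hp] at hq
      obtain ⟨⟨ha, hb, hab⟩, hq⟩ := List.forall_mem_cons.1 hq
      obtain ⟨ha', hav⟩ := ht.find 100 ha
      obtain ⟨hb', hbv⟩ := ht.find 100 hb
      have hab' := (hav.trans hab).trans hbv.symm
      dsimp only
      cases Nat.beq (CosetEnum.find p.1 100 a) (CosetEnum.find p.1 100 b)
      · cases Nat.blt (CosetEnum.find p.1 100 a) (CosetEnum.find p.1 100 b)
        · have := ht.absorb hq hb' ha' hab'.symm
          exact ih this.1 this.2
        · have := ht.absorb hq ha' hb' hab'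
          exact ih this.1 this.2
      · exact ih ht hq

theorem Sound.merge_pair (ht : Sound x h v n t) (k : ℕ) {a b : ℕ} (ha : a < n) (hb : b < n)
    (hab : v a = v b) : Sound x h v n (CosetEnum.merge k (t, [(a, b)])) :=
  Sound.merge k ht (SoundPairs.cons (fun _ hc => absurd hc List.not_mem_nil) ha hb hab)

theorem Sound.define (ht : Sound x h v n t) {f : ℕ} (hf : f < n) (s : Letter) :
    Sound x h (Function.update v n (s.val x h • v f)) (n + 1) (CosetEnum.link t f s n) := by
  have hv : ∀ i < n, Function.update v n (s.val x h • v f) i = v i := fun i hi =>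
    Function.update_of_ne hi.ne _ _
  refine Sound.link (fun i s₁ j hj => ?_) (by omega) (by omega) (by simp [hv f hf])
  obtain ⟨h1, h2, h3⟩ := ht _ _ _ hj
  exact ⟨by omega, by omega, by rw [hv i h1, hv j h2, h3]⟩

variable (x h) in
/-- Some interpretation of the table `p.1` with `p.2` cosets, among them `a`, as points of `X` is
correct and interprets `0` as the point `x₀`. -/
def Interpretable (x₀ : X) (a : ℕ) (p : Table × ℕ) : Prop :=
  a < p.2 ∧ ∃ v : ℕ → X, v 0 = x₀ ∧ Sound x h v p.2 p.1

theorem Sound.fill (ht : Sound x h v n t) {a b f : ℕ} (ha : a < n) (hb : b < n) (hf : f < n)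
    (w : List Letter) (hw : wordVal x h w • v f = v b) :
    Interpretable x h (v 0) a (fill b t n f w) := by
  induction w generalizing v n t f with
  | nil => exact ⟨ha, v, rfl, ht⟩
  | cons s w ih =>
    cases w with
    | nil =>
      rw [wordVal, wordVal, one_mul] at hw
      rw [CosetEnum.fill]
      split
      · exact ⟨ha, v, rfl, ht.link hf hb hw⟩
      · next u hu =>
        obtain ⟨-, hun, hu⟩ := ht _ _ _ hu
        rw [← hw, Letter.val_inv, inv_smul_smul] at hu
        exact ⟨ha, v, rfl, ht.merge_pair 1000 hf hun hu⟩
    | cons s₁ w =>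
      rw [CosetEnum.fill]
      have := ih (ht.define hf s) (by omega) (by omega) (Nat.lt_succ_self n) (by
        rw [Function.update_self, Function.update_of_ne hb.ne, ← mul_smul]
        exact hw)
      rwa [Function.update_of_ne (by omega)] at this

variable {x₀ : X} {a : ℕ} {p : Table × ℕ}

theorem Interpretable.scan (hp : Interpretable x h x₀ a p) (w : List Letter)
    (hw : ∀ v : ℕ → X, v 0 = x₀ → wordVal x h w • v a = v a) :
    Interpretable x h x₀ a (scan a p w) := by
  obtain ⟨ha, v, rfl, ht⟩ := hp
  replace hw := hw v rfl
  rw [CosetEnum.scan]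
  split
  · exact ⟨ha, v, rfl, ht⟩
  · obtain ⟨hf, hfw⟩ := ht.trace w ha
    split
    · next f heq =>
      rw [heq, hw, wordVal, one_smul] at hfw
      rw [heq] at hf
      exact ⟨ha, v, rfl, ht.merge_pair 1000 hf ha hfw.symm⟩
    · next f s w₁ heq =>
      rw [heq, hw] at hfw
      rw [heq] at hf
      obtain ⟨hb, hbw⟩ := ht.trace (invWord (s :: w₁)) ha
      rw [wordVal_invWord, inv_smul_eq_iff] at hbw
      split
      · next b heq' =>
        rw [heq', wordVal, one_smul, hfw] at hbw
        rw [heq'] at hb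
        exact ⟨ha, v, rfl, ht.merge_pair 1000 hf hb (smul_left_cancel _ hbw)⟩
      · next b s₁ w₂ heq' =>
        rw [heq', hfw] at hbw
        rw [heq'] at hb
        refine ht.fill ha hb hf _ ?_
        rw [wordVal_invWord, inv_smul_eq_iff]
        exact smul_left_cancel _ hbw

theorem Interpretable.foldl_scan (hp : Interpretable x h x₀ a p) (ws : List (List Letter))
    (hw : ∀ w ∈ ws, ∀ v : ℕ → X, v 0 = x₀ → wordVal x h w • v a = v a) :
    Interpretable x h x₀ a (ws.foldl (CosetEnum.scan a) p) :=
  List.foldlRecOn (motive := Interpretable x h x₀ a) _ _ hp fun _ hq w hmem =>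
    hq.scan w (hw w hmem)

theorem Interpretable.run {rels : List (List Letter)} (hrel : ∀ w ∈ rels, wordVal x h w = 1)
    (k : ℕ) (hp : Interpretable x h x₀ 0 p) : Interpretable x h x₀ 0 (run rels k a p) := by
  induction k generalizing a p with
  | zero => exact hp
  | succ k ih =>
    rw [CosetEnum.run]
    cases hb : Nat.blt a p.2
    · exact hp
    · rw [cond_true]
      have := Interpretable.foldl_scan (a := a) ⟨Nat.blt_eq.mp hb, hp.2⟩ rels
        fun w hmem v _ => by rw [hrel w hmem, one_smul]
      exact ih ⟨by have := this.1; omega, this.2⟩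

theorem interpretable_result (hrel : ∀ w ∈ relators, wordVal x h w = 1)
    (hsub : ∀ w ∈ subgroupGens, wordVal x h w • x₀ = x₀) : Interpretable x h x₀ 0 result := by
  refine Interpretable.run hrel _ (Interpretable.foldl_scan ⟨Nat.zero_lt_one, fun _ => x₀, rfl, ?_⟩
    _ fun w hw v hv => by rw [hv, hsub w hw])
  intro i s j hj
  cases s <;> simp [look, digit] at hj

end Soundness

section Action

variable {rels subs : List (List Letter)} {m : ℕ} {p : Table × ℕ}

theorem mem_liveList {t : Table} {n i : ℕ} :
    i ∈ liveList t n ↔ i < n ∧ isLive t i = true := by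
  simp [liveList]

/-- The set of live cosets. -/
abbrev Live (p : Table × ℕ) : Type := {i : ℕ // i ∈ liveList p.1 p.2}

theorem card_live (hp : isComplete rels subs m p = true) : Nat.card (Live p) = m := by
  rw [isComplete, Bool.and_eq_true] at hp
  have hnd : (liveList p.1 p.2).Nodup := List.nodup_range.filter _
  rw [← Nat.eq_of_beq_eq_true hp.1, ← List.toFinset_card_of_nodup hnd]
  exact Nat.subtype_card _ fun _ => List.mem_toFinset

theorem isGoodRow_of_isComplete (hp : isComplete rels subs m p = true) (i : Live p) :
    isGoodRow rels p.1 p.2 i = true := by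
  simp only [isComplete, Bool.and_eq_true, List.all_eq_true] at hp
  exact hp.2.1 i i.2

theorem closes_subs (hp : isComplete rels subs m p = true) {w : List Letter} (hw : w ∈ subs) :
    closes p.1 0 w = true := by
  simp only [isComplete, Bool.and_eq_true, List.all_eq_true] at hp
  exact hp.2.2.1 w hw

theorem closes_rels (hp : isComplete rels subs m p = true) (i : Live p) {w : List Letter}
    (hw : w ∈ rels) : closes p.1 i w = true := by
  have h := isGoodRow_of_isComplete hp i
  simp only [isGoodRow, Bool.and_eq_true, List.all_eq_true] at h
  exact h.2.1 w hw

/-- The base coset. -/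
def base (hp : isComplete rels subs m p = true) : Live p :=
  ⟨0, by
    simp only [isComplete, Bool.and_eq_true] at hp
    exact mem_liveList.2 ⟨Nat.blt_eq.mp hp.2.2.2.1, hp.2.2.2.2⟩⟩

theorem exists_look_eq (hp : isComplete rels subs m p = true) (i : Live p) {s : Letter}
    (hs : s ≠ .e) : ∃ j : Live p, look p.1 i s = j + 1 ∧ look p.1 j s.inv = i + 1 := by
  have h := isGoodRow_of_isComplete hp i
  simp only [isGoodRow, Bool.and_eq_true, List.all_eq_true] at h
  have hpair : isPaired p.1 p.2 i s = true := h.1 s (by cases s <;> simp_all)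
  rw [isPaired] at hpair
  split at hpair
  · contradiction
  · next j hj =>
    simp only [Bool.and_eq_true] at hpair
    exact ⟨⟨j, mem_liveList.2 ⟨Nat.blt_eq.mp hpair.1, hpair.2.1⟩⟩, hj,
      Nat.eq_of_beq_eq_true hpair.2.2⟩

/-- The image of a live coset under a letter. -/
noncomputable def step (hp : isComplete rels subs m p = true) {s : Letter} (hs : s ≠ .e)
    (i : Live p) : Live p :=
  (exists_look_eq hp i hs).choose

theorem look_eq_step (hp : isComplete rels subs m p = true) {s : Letter} (hs : s ≠ .e)
    (i : Live p) : look p.1 i s = step hp hs i + 1 :=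
  (exists_look_eq hp i hs).choose_spec.1

theorem step_inv_step (hp : isComplete rels subs m p = true) {s : Letter} (hs : s ≠ .e)
    (hs' : s.inv ≠ .e) (i : Live p) : step hp hs' (step hp hs i) = i := by
  have h1 := (exists_look_eq hp i hs).choose_spec.2
  have h2 := look_eq_step hp hs' (step hp hs i)
  exact Subtype.ext (Nat.succ_injective (h2.symm.trans h1))

/-- The permutation of the live cosets given by `x`. -/
noncomputable def permX (hp : isComplete rels subs m p = true) : Equiv.Perm (Live p) where
  toFun := step hp (s := .x) nofun
  invFun := step hp (s := .xInv) nofun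
  left_inv := step_inv_step hp (s := .x) nofun nofun
  right_inv := step_inv_step hp (s := .xInv) nofun nofun

/-- The permutation of the live cosets given by `h`. -/
noncomputable def permH (hp : isComplete rels subs m p = true) : Equiv.Perm (Live p) where
  toFun := step hp (s := .h) nofun
  invFun := step hp (s := .hInv) nofun
  left_inv := step_inv_step hp (s := .h) nofun nofun
  right_inv := step_inv_step hp (s := .hInv) nofun nofun

theorem look_eq_val (hp : isComplete rels subs m p = true) {s : Letter} (hs : s ≠ .e)
    (i : Live p) : look p.1 i s = s.val (permX hp) (permH hp) i + 1 := by
  rw [look_eq_step hp hs]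
  cases s
  · rfl
  · rfl
  · rfl
  · rfl
  · contradiction

theorem trace_eq (hp : isComplete rels subs m p = true) {w : List Letter}
    (hw : ∀ s ∈ w, s ≠ .e) (i : Live p) :
    trace p.1 i w = (↑(wordVal (permX hp) (permH hp) w i), []) := by
  induction w generalizing i with
  | nil => rfl
  | cons s w ih =>
    rw [trace, look_eq_val hp (hw s List.mem_cons_self)]
    exact ih (fun s hs => hw s (List.mem_cons_of_mem _ hs)) _

theorem wordVal_apply_of_closes (hp : isComplete rels subs m p = true) {w : List Letter}
    (hw : ∀ s ∈ w, s ≠ .e) {i : Live p} (hc : closes p.1 i w = true) :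
    wordVal (permX hp) (permH hp) w i = i := by
  rw [closes, trace_eq hp hw] at hc
  exact Subtype.ext (Nat.eq_of_beq_eq_true hc)

variable {G : Type*} [Group G] {x h : G}

theorem exists_apply_base_eq (hp : isComplete rels subs m p = true) (φ : G →* Equiv.Perm (Live p))
    (hx : φ x = permX hp) (hh : φ h = permH hp) (i : Live p) : ∃ a : G, φ a (base hp) = i := by
  obtain ⟨i, hi⟩ := i
  induction i using Nat.strong_induction_on with
  | _ i ih =>
    have hrow := isGoodRow_of_isComplete hp ⟨i, hi⟩
    simp only [isGoodRow, Bool.and_eq_true, Bool.or_eq_true, List.any_eq_true] at hrow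
    rcases hrow.2.2 with h0 | ⟨s, hs, hle⟩
    · obtain rfl : i = 0 := Nat.eq_of_beq_eq_true h0
      exact ⟨1, by simp [base]⟩
    · have hs' : s ≠ .e := by rintro rfl; simp at hs
      have hval : φ (s.val x h) = s.val (permX hp) (permH hp) := by
        cases s <;> simp [Letter.val, hx, hh]
      rw [show look p.1 i s = _ from look_eq_val hp hs' ⟨i, hi⟩, ← hval] at hle
      obtain ⟨a, ha⟩ := ih _ (Nat.le_of_ble_eq_true hle) (φ (s.val x h) ⟨i, hi⟩).2
      refine ⟨(s.val x h)⁻¹ * a, ?_⟩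
      rw [map_mul, Equiv.Perm.mul_apply, ha, map_inv]
      exact Equiv.symm_apply_apply _ _

theorem apply_eq_smul (hp : isComplete rels subs m p = true) (φ : G →* Equiv.Perm (Live p))
    (hx : φ x = permX hp) (hh : φ h = permH hp) (hgen : Subgroup.closure {x, h} = ⊤)
    {X : Type*} [MulAction G X] {v : ℕ → X} (hv : Sound x h v p.2 p.1) (a : G) (i : Live p) :
    v (φ a i) = a • v i := by
  have ha : a ∈ Subgroup.closure {x, h} := hgen ▸ Subgroup.mem_top a
  induction ha using Subgroup.closure_induction generalizing i with
  | mem a ha =>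
    rcases ha with rfl | rfl
    · rw [hx]
      exact (hv i .x _ (look_eq_val hp (s := .x) nofun i)).2.2.symm
    · rw [hh]
      exact (hv i .h _ (look_eq_val hp (s := .h) nofun i)).2.2.symm
  | one => simp
  | mul a b _ _ ha hb => rw [map_mul, Equiv.Perm.mul_apply, ha, hb, mul_smul]
  | inv a _ ha =>
    rw [eq_inv_smul_iff, ← ha, map_inv]
    exact congrArg (fun j : Live p => v j) (Equiv.apply_symm_apply _ _)

theorem index_eq_of_isComplete (hp : isComplete rels subs m p = true)
    (φ : G →* Equiv.Perm (Live p)) (hx : φ x = permX hp) (hh : φ h = permH hp)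
    (hgen : Subgroup.closure {x, h} = ⊤) {H : Subgroup G} (hH : ∀ a ∈ H, φ a (base hp) = base hp)
    (hint : Interpretable x h ((1 : G) : G ⧸ H) 0 p) : H.index = m := by
  obtain ⟨-, v, hv0, hv⟩ := hint
  have hφ : ∀ a : G, v (φ a (base hp)) = (a : G ⧸ H) := fun a => by
    rw [apply_eq_smul hp φ hx hh hgen hv, base, hv0, MulAction.Quotient.smul_coe, smul_eq_mul,
      mul_one]
  rw [Subgroup.index, ← card_live hp]
  refine (Nat.card_eq_of_bijective (fun i : Live p => v i) ⟨fun i j hij => ?_, fun c => ?_⟩).symm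
  · obtain ⟨a, rfl⟩ := exists_apply_base_eq hp φ hx hh i
    obtain ⟨b, rfl⟩ := exists_apply_base_eq hp φ hx hh j
    dsimp only at hij
    rw [hφ, hφ, QuotientGroup.eq] at hij
    have := hH _ hij
    rw [map_mul, map_inv, Equiv.Perm.mul_apply, Equiv.Perm.inv_eq_iff_eq] at this
    exact this.symm
  · obtain ⟨a, rfl⟩ := QuotientGroup.mk_surjective c
    exact ⟨φ a (base hp), hφ a⟩

end Action

theorem isComplete_result : isComplete relators subgroupGens 1512 result = true := by
  decide +kernel

section Group

variable {G : Type*} [Group G] {g h x : G}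

theorem relations_of_wordVal_relators (hrel : ∀ w ∈ relators, wordVal x h w = 1)
    (hg : g = x⁻¹ * x⁻¹ * h⁻¹ * x) :
    g ^ 3 = 1 ∧ h ^ 3 = 1 ∧ g * h * g⁻¹ * h⁻¹ = 1 ∧ x ^ 2 * g * x⁻¹ * h = 1 := by
  simp only [relators, List.forall_mem_cons, wordVal, Letter.val, one_mul] at hrel
  obtain ⟨h1, h2, h3, -⟩ := hrel
  subst hg
  refine ⟨?_, ?_, ?_, by group⟩
  · have : (x⁻¹ * x⁻¹ * h⁻¹ * x) ^ 3 = x⁻¹ * (x⁻¹ * h⁻¹ * x⁻¹ * h⁻¹ * x⁻¹ * h⁻¹) * x := by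
      simp [pow_three, mul_assoc]
    rw [this, h2, mul_one, inv_mul_cancel]
  · rw [← h1, pow_three']
  · have : x⁻¹ * x⁻¹ * h⁻¹ * x * h * (x⁻¹ * x⁻¹ * h⁻¹ * x)⁻¹ * h⁻¹ =
        x⁻¹ * (x⁻¹ * h⁻¹ * x * h * x⁻¹ * h * x * x * h⁻¹ * x⁻¹) * x := by
      simp [mul_assoc]
    rw [this, h3, mul_one, inv_mul_cancel]

theorem wordVal_relators_of_relations (h1 : g ^ 3 = 1) (h2 : h ^ 3 = 1)
    (h3 : g * h * g⁻¹ * h⁻¹ = 1) (hg : g = x⁻¹ * x⁻¹ * h⁻¹ * x) :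
    ∀ w ∈ relators, wordVal x h w = 1 := by
  simp only [relators, List.forall_mem_cons, wordVal, Letter.val, one_mul]
  subst hg
  refine ⟨?_, ?_, ?_, nofun⟩
  · rw [← h2, pow_three']
  · have : x⁻¹ * h⁻¹ * x⁻¹ * h⁻¹ * x⁻¹ * h⁻¹ = x * (x⁻¹ * x⁻¹ * h⁻¹ * x) ^ 3 * x⁻¹ := by
      simp [pow_three, mul_assoc]
    rw [this, h1, mul_one, mul_inv_cancel]
  · have : x⁻¹ * h⁻¹ * x * h * x⁻¹ * h * x * x * h⁻¹ * x⁻¹ =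
        x * (x⁻¹ * x⁻¹ * h⁻¹ * x * h * (x⁻¹ * x⁻¹ * h⁻¹ * x)⁻¹ * h⁻¹) * x⁻¹ := by
      simp [mul_assoc]
    rw [this, h3, mul_one, mul_inv_cancel]

theorem exists_zpow_mul_zpow_of_mem_closure (hc : Commute g h) {a : G}
    (ha : a ∈ Subgroup.closure {g, h}) : ∃ i j : ℤ, a = g ^ i * h ^ j := by
  induction ha using Subgroup.closure_induction with
  | mem a ha =>
    rcases ha with rfl | rfl
    · exact ⟨1, 0, by simp⟩
    · exact ⟨0, 1, by simp⟩
  | one => exact ⟨0, 0, by simp⟩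
  | mul a b _ _ ha hb =>
    obtain ⟨i, j, rfl⟩ := ha
    obtain ⟨k, l, rfl⟩ := hb
    refine ⟨i + k, j + l, ?_⟩
    rw [zpow_add, zpow_add, mul_assoc, mul_assoc, ← mul_assoc (h ^ j),
      (hc.symm.zpow_zpow j k).eq, mul_assoc]
  | inv a _ ha =>
    obtain ⟨i, j, rfl⟩ := ha
    exact ⟨-i, -j, by rw [mul_inv_rev, zpow_neg, zpow_neg, (hc.zpow_zpow i j).inv_inv.eq]⟩

theorem card_closure_pair (h1 : g ^ 3 = 1) (h2 : h ^ 3 = 1) (hc : Commute g h)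
    (ψ : G →* Multiplicative (ZMod 3 × ZMod 3)) (hg : ψ g = .ofAdd (1, 0))
    (hh : ψ h = .ofAdd (0, 1)) : Nat.card (Subgroup.closure {g, h}) = 9 := by
  have hψ : ∀ i j : ℤ, ψ (g ^ i * h ^ j) = .ofAdd ((i : ZMod 3), (j : ZMod 3)) := fun i j => by
    rw [map_mul, map_zpow, map_zpow, hg, hh, ← ofAdd_zsmul, ← ofAdd_zsmul, ← ofAdd_add]
    simp
  have hbij : Function.Bijective fun a : Subgroup.closure {g, h} => ψ a := by
    refine ⟨fun a b hab => Subtype.ext ?_, fun c => ?_⟩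
    · obtain ⟨i, j, ha⟩ := exists_zpow_mul_zpow_of_mem_closure hc a.2
      obtain ⟨k, l, hb⟩ := exists_zpow_mul_zpow_of_mem_closure hc b.2
      dsimp only at hab
      rw [ha, hb, hψ, hψ, Multiplicative.ofAdd.injective.eq_iff, Prod.mk.injEq,
        ZMod.intCast_eq_intCast_iff, ZMod.intCast_eq_intCast_iff] at hab
      rw [ha, hb, zpow_eq_zpow_iff_modEq.2 (hab.1.of_dvd (by
          exact_mod_cast orderOf_dvd_of_pow_eq_one h1)),
        zpow_eq_zpow_iff_modEq.2 (hab.2.of_dvd (by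
          exact_mod_cast orderOf_dvd_of_pow_eq_one h2))]
    · obtain ⟨⟨i, j⟩, rfl⟩ := Multiplicative.ofAdd.surjective c
      obtain ⟨i, rfl⟩ := ZMod.intCast_surjective i
      obtain ⟨j, rfl⟩ := ZMod.intCast_surjective j
      refine ⟨⟨g ^ i * h ^ j, mul_mem (zpow_mem (Subgroup.subset_closure (by simp)) _)
        (zpow_mem (Subgroup.subset_closure (by simp)) _)⟩, hψ i j⟩
  rw [Nat.card_eq_of_bijective _ hbij]
  simp

theorem relators_ne_e : ∀ w ∈ relators, ∀ s ∈ w, s ≠ .e := by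
  simp [relators]

theorem subgroupGens_ne_e : ∀ w ∈ subgroupGens, ∀ s ∈ w, s ≠ .e := by
  simp [subgroupGens]

theorem lift_eq_one_of_relations {f : Fin 3 → G} (h1 : f 0 ^ 3 = 1) (h2 : f 1 ^ 3 = 1)
    (h3 : f 0 * f 1 * (f 0)⁻¹ * (f 1)⁻¹ = 1) (h4 : f 2 ^ 2 * f 0 * (f 2)⁻¹ * f 1 = 1) :
    ∀ r ∈ stmt8Rels, FreeGroup.lift f r = 1 := by
  rintro r (rfl | rfl | rfl | rfl) <;> simpa

end Group

end CosetEnum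

open CosetEnum

/-- The group `⟨g, h, x | g³, h³, g h g⁻¹ h⁻¹, x² g x⁻¹ h⟩` is finite of order
`13608`. -/
theorem stmt_8 : Nat.card (PresentedGroup stmt8Rels) = 13608 := by
  let g := PresentedGroup.mk stmt8Rels (.of 0)
  let h := PresentedGroup.mk stmt8Rels (.of 1)
  let x := PresentedGroup.mk stmt8Rels (.of 2)
  have h1 : g ^ 3 = 1 := PresentedGroup.one_of_mem (.inl rfl)
  have h2 : h ^ 3 = 1 := PresentedGroup.one_of_mem (.inr (.inl rfl))
  have h3 : g * h * g⁻¹ * h⁻¹ = 1 := PresentedGroup.one_of_mem (.inr (.inr (.inl rfl)))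
  have h4 : x ^ 2 * g * x⁻¹ * h = 1 := PresentedGroup.one_of_mem (.inr (.inr (.inr rfl)))
  have hg : g = x⁻¹ * x⁻¹ * h⁻¹ * x := by
    rw [mul_eq_one_iff_eq_inv] at h4
    rw [← h4]
    group
  have hc : Commute g h := by
    rwa [mul_inv_eq_one, mul_inv_eq_iff_eq_mul] at h3
  have hp := isComplete_result
  generalize hres : result = p at hp
  have hperm : ∀ w ∈ relators, wordVal (permX hp) (permH hp) w = 1 := fun w hw =>
    Equiv.ext fun i => wordVal_apply_of_closes hp (relators_ne_e w hw) (closes_rels hp i hw)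
  obtain ⟨r1, r2, r3, r4⟩ := relations_of_wordVal_relators hperm rfl
  let φ := PresentedGroup.toGroup (lift_eq_one_of_relations
    (f := ![(permX hp)⁻¹ * (permX hp)⁻¹ * (permH hp)⁻¹ * permX hp, permH hp, permX hp]) r1 r2 r3 r4)
  have hφg : φ g = (permX hp)⁻¹ * (permX hp)⁻¹ * (permH hp)⁻¹ * permX hp :=
    PresentedGroup.toGroup.of _
  have hφh : φ h = permH hp := PresentedGroup.toGroup.of _
  have hφx : φ x = permX hp := PresentedGroup.toGroup.of _
  let ψ := PresentedGroup.toGroup (lift_eq_one_of_relations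
    (f := ![Multiplicative.ofAdd ((1, 0) : ZMod 3 × ZMod 3), .ofAdd (0, 1), .ofAdd (-1, -1)])
    (by decide) (by decide) (by decide) (by decide))
  have hcard := card_closure_pair h1 h2 hc ψ (PresentedGroup.toGroup.of _)
    (PresentedGroup.toGroup.of _)
  have hgen : Subgroup.closure {x, h} = ⊤ := by
    rw [eq_top_iff, ← PresentedGroup.closure_range_of, Subgroup.closure_le]
    have hxm : x ∈ Subgroup.closure {x, h} := Subgroup.subset_closure (by simp)
    have hhm : h ∈ Subgroup.closure {x, h} := Subgroup.subset_closure (by simp)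
    rintro _ ⟨i, rfl⟩
    fin_cases i
    · change g ∈ _
      rw [hg]
      exact mul_mem (mul_mem (mul_mem (inv_mem hxm) (inv_mem hxm)) (inv_mem hhm)) hxm
    · exact hhm
    · exact hxm
  have hsubs : ∀ {G : Type} [Group G] {x h : G} {P : G → Prop},
      (∀ w ∈ subgroupGens, P (wordVal x h w)) ↔ P h ∧ P (x⁻¹ * x⁻¹ * h⁻¹ * x) := by
    simp [subgroupGens, wordVal, Letter.val]
  have hH : ∀ a ∈ Subgroup.closure {g, h}, φ a (base hp) = base hp := by
    have hfix : ∀ w ∈ subgroupGens, wordVal (permX hp) (permH hp) w (base hp) = base hp :=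
      fun w hw => wordVal_apply_of_closes hp (subgroupGens_ne_e w hw) (closes_subs hp hw)
    obtain ⟨hfh, hfg⟩ := (hsubs (P := fun σ : Equiv.Perm (Live p) => σ (base hp) = base hp)).1 hfix
    rw [← hφh] at hfh
    rw [← hφg] at hfg
    suffices Subgroup.closure {g, h} ≤ (MulAction.stabilizer _ (base hp)).comap φ from
      fun a ha => this ha
    rw [Subgroup.closure_le]
    rintro _ (rfl | rfl)
    exacts [hfg, hfh]
  have hint : Interpretable x h ((1 : PresentedGroup stmt8Rels) :
      PresentedGroup stmt8Rels ⧸ Subgroup.closure {g, h}) 0 p := by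
    rw [← hres]
    refine interpretable_result (wordVal_relators_of_relations h1 h2 h3 hg) ?_
    refine (hsubs (P := fun a => a • ((1 : PresentedGroup stmt8Rels) :
      PresentedGroup stmt8Rels ⧸ Subgroup.closure {g, h}) = (1 : PresentedGroup stmt8Rels))).2 ?_
    rw [← hg]
    simp only [MulAction.Quotient.smul_coe, smul_eq_mul, mul_one, QuotientGroup.eq, inv_mem_iff]
    exact ⟨Subgroup.subset_closure (by simp), Subgroup.subset_closure (by simp)⟩
  rw [← Subgroup.card_mul_index (Subgroup.closure {g, h}), hcard,
    index_eq_of_isComplete hp φ hφx hφh hgen hH hint]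
end

section
/- Let H(9,3) be the group defined by the cyclic presentation ⟨x₀, x₁, …, x₈ | xᵢ x_{i+3} x_{i+1}⁻¹ (0 ≤ i ≤ 8, subscripts mod 9)⟩ and let w = x₀ x₄ x₈ x₃ x₇ x₂ x₆ x₁ x₅ ∈ H(9,3). Then the quotient of H(9,3) by the normal closure of w is finite of order 2¹⁵ · 7 = 229376. -/
/-- The cyclic relators `xᵢ x_{i+3} x_{i+1}⁻¹` (indices mod 9) in the free group
on generators indexed by `ZMod 9`. -/
def H93Rels : Set (FreeGroup (ZMod 9)) :=
  Set.range fun i : ZMod 9 =>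
    FreeGroup.of i * FreeGroup.of (i + 3) * (FreeGroup.of (i + 1))⁻¹

/-- The element `w = x₀ x₄ x₈ x₃ x₇ x₂ x₆ x₁ x₅` of the Gilbert–Howie group
`H(9,3)`. -/
def H93w : PresentedGroup H93Rels :=
  PresentedGroup.of 0 * PresentedGroup.of 4 * PresentedGroup.of 8 *
    PresentedGroup.of 3 * PresentedGroup.of 7 * PresentedGroup.of 2 *
    PresentedGroup.of 6 * PresentedGroup.of 1 * PresentedGroup.of 5

namespace CyclicWord

/-! Words in `x₀, …, x₈` and their inverses: the letters `2 * i` and `2 * i + 1`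
stand for `xᵢ` and `xᵢ⁻¹`. -/

variable {G : Type*} [Group G]

/-- The value of a letter. -/
def letter (x : ZMod 9 → G) (a : ℕ) : G :=
  if a % 2 = 0 then x (a / 2 : ℕ) else (x (a / 2 : ℕ))⁻¹

/-- The value of a word. -/
def eval (x : ZMod 9 → G) (w : List ℕ) : G := (w.map (letter x)).prod

/-- The inverse letter. -/
def invLetter (a : ℕ) : ℕ := a + 1 - 2 * (a % 2)

/-! Most functions on lists below are written with recursors, which the kernel evaluates much
faster than definitions by pattern matching. -/

/-- The formal inverse of `v`, followed by `w`. -/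
noncomputable def invAppend (v : List ℕ) : List ℕ → List ℕ :=
  List.rec (fun w => w) (fun a _ ih w => ih (invLetter a :: w)) v

/-- Add `s` to all the indices of a word. -/
noncomputable def shift (s : ℕ) (w : List ℕ) : List ℕ :=
  List.rec [] (fun a _ ih => (a + 2 * s) % 18 :: ih) w

/-- The first `k` letters of a word. -/
noncomputable def take (w : List ℕ) : ℕ → List ℕ :=
  List.rec (fun _ => []) (fun a _ ih k => Nat.rec [] (fun m _ => a :: ih m) k) w

/-- The other letters of a word. -/
noncomputable def drop (w : List ℕ) : ℕ → List ℕ :=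
  List.rec (fun _ => []) (fun a l ih k => Nat.rec (a :: l) (fun m _ => ih m) k) w

/-- The `n`-th of a list of words, the empty word if there is none. -/
noncomputable def get (db : List (List ℕ)) : ℕ → List ℕ :=
  List.rec (fun _ => []) (fun w _ ih n => Nat.rec w (fun m _ => ih m) n) db

/-- Multiply a freely reduced word by a letter on the left. -/
noncomputable def consRed (a : ℕ) (w : List ℕ) : List ℕ :=
  List.rec [a] (fun b t _ => bif Nat.beq (invLetter a) b then t else a :: b :: t) w

/-- Multiply a freely reduced word `w` by a word on the left. -/
noncomputable def mulRed (v w : List ℕ) : List ℕ := List.rec w (fun a _ ih => consRed a ih) v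

/-- `force w k = k w`, but the kernel computes `w` before it unfolds `k`. -/
noncomputable def force {α : Type} (w : List ℕ) : (List ℕ → α) → α :=
  List.rec (fun k => k [])
    (fun a _ ih k => Nat.rec (ih fun l => k (0 :: l)) (fun m _ => ih fun l => k ((m + 1) :: l)) a) w

/-- Multiply the word `w` by a conjugate of a shift of one of the words in `db`, or of its
inverse, up to conjugacy. The digits of `n` in mixed radix tell which one. -/
noncomputable def step (db : List (List ℕ)) (n : ℕ) (w : List ℕ) : List ℕ :=
  force (shift (n / 2048 % 9) (bif Nat.beq (n / 1024 % 2) 0 then get db (n / 18432)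
    else invAppend (get db (n / 18432)) [])) fun v =>
  mulRed (drop w (n % 64)) (mulRed (take w (n % 64))
    (mulRed (drop v (n / 64 % 16)) (take v (n / 64 % 16))))

/-- Perform a list of steps. -/
noncomputable def run (db : List (List ℕ)) (l : List ℕ) : List ℕ → List ℕ :=
  List.rec (fun w => w) (fun n _ ih w => force (step db n w) ih) l

/-- Each target is reduced to the empty word by the list of steps that goes with it. -/
noncomputable def checkTargets (db : List (List ℕ)) : List (List ℕ) → List (List ℕ) → Bool
  | [], _ => true
  | _ :: _, [] => false
  | w :: ws, l :: ls => (run db l (mulRed w [])).isEmpty && checkTargets db ws ls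

/-- Derive the words of `cert`, then the targets. -/
noncomputable def check (targets targetCert : List (List ℕ)) : List (List ℕ) → List (List ℕ) → Bool
  | [], db => checkTargets db targets targetCert
  | l :: cert, db => force (run db l []) fun w => check targets targetCert cert (w :: db)

theorem force_eq {α : Type} (w : List ℕ) (k : List ℕ → α) : force w k = k w := by
  induction w generalizing k with
  | nil => rfl
  | cons a l ih => cases a <;> exact ih _

theorem letter_invLetter (x : ZMod 9 → G) (a : ℕ) :
    letter x (invLetter a) = (letter x a)⁻¹ := by
  have h : invLetter a / 2 = a / 2 := by unfold invLetter; omega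
  rcases Nat.mod_two_eq_zero_or_one a with h0 | h0
  · have h' : invLetter a % 2 = 1 := by unfold invLetter; omega
    simp [letter, h, h', h0]
  · have h' : invLetter a % 2 = 0 := by unfold invLetter; omega
    simp [letter, h, h', h0]

theorem letter_shift (x : ZMod 9 → G) (s a : ℕ) :
    letter x ((a + 2 * s) % 18) = letter (fun i => x (i + s)) a := by
  have h : (a + 2 * s) % 18 % 2 = a % 2 := by omega
  have h' : (((a + 2 * s) % 18 / 2 : ℕ) : ZMod 9) = (a / 2 : ℕ) + (s : ZMod 9) := by
    rw [← Nat.cast_add, ZMod.natCast_eq_natCast_iff']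
    omega
  simp only [letter, h, h']

theorem eval_nil (x : ZMod 9 → G) : eval x [] = 1 := rfl

theorem eval_cons (x : ZMod 9 → G) (a : ℕ) (w : List ℕ) :
    eval x (a :: w) = letter x a * eval x w := by
  simp [eval]

theorem eval_append (x : ZMod 9 → G) (v w : List ℕ) :
    eval x (v ++ w) = eval x v * eval x w := by
  simp [eval]

theorem eval_invAppend (x : ZMod 9 → G) (v w : List ℕ) :
    eval x (invAppend v w) = (eval x v)⁻¹ * eval x w := by
  induction v generalizing w with
  | nil => simp [invAppend, eval_nil]
  | cons a v ih =>
    refine (ih (invLetter a :: w)).trans ?_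
    rw [eval_cons, eval_cons, letter_invLetter]
    group

theorem eval_shift (x : ZMod 9 → G) (s : ℕ) (w : List ℕ) :
    eval x (shift s w) = eval (fun i => x (i + s)) w := by
  induction w with
  | nil => rfl
  | cons a w ih =>
    rw [eval_cons, ← letter_shift, ← ih, ← eval_cons]
    rfl

theorem eval_take_mul_eval_drop (x : ZMod 9 → G) (w : List ℕ) (k : ℕ) :
    eval x (take w k) * eval x (drop w k) = eval x w := by
  induction w generalizing k with
  | nil => exact one_mul _
  | cons a w ih =>
    cases k with
    | zero => exact one_mul _
    | succ k =>
      rw [eval_cons, ← ih k, ← mul_assoc, ← eval_cons]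
      rfl

theorem get_mem_or_eq_nil (db : List (List ℕ)) (n : ℕ) : get db n ∈ db ∨ get db n = [] := by
  induction db generalizing n with
  | nil => exact .inr rfl
  | cons w db ih =>
    cases n with
    | zero => exact .inl List.mem_cons_self
    | succ n => exact (ih n).imp_left (List.mem_cons_of_mem w)

theorem eval_consRed (x : ZMod 9 → G) (a : ℕ) (w : List ℕ) :
    eval x (consRed a w) = letter x a * eval x w := by
  cases w with
  | nil => exact eval_cons x a []
  | cons b t =>
    change eval x (bif Nat.beq (invLetter a) b then t else a :: b :: t) = _
    cases h : Nat.beq (invLetter a) b with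
    | false => exact eval_cons x a _
    | true =>
      rw [← Nat.eq_of_beq_eq_true h, eval_cons, letter_invLetter]
      simp

theorem eval_mulRed (x : ZMod 9 → G) (v w : List ℕ) :
    eval x (mulRed v w) = eval x v * eval x w := by
  induction v with
  | nil => exact (one_mul _).symm
  | cons a v ih =>
    rw [eval_cons, mul_assoc, ← ih, ← eval_consRed]
    rfl

/-- All words of `db` are trivial at all the shifts of `x`. -/
def Holds (x : ZMod 9 → G) (db : List (List ℕ)) : Prop :=
  ∀ w ∈ db, ∀ s : ZMod 9, eval (fun i => x (i + s)) w = 1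

theorem Holds.eval_step {x : ZMod 9 → G} {db : List (List ℕ)} (h : Holds x db) (n : ℕ)
    (w : List ℕ) (s : ZMod 9) :
    eval (fun i => x (i + s)) (step db n w) = 1 ↔ eval (fun i => x (i + s)) w = 1 := by
  have hget : ∀ i (t : ZMod 9), eval (fun j => x (j + t)) (get db i) = 1 := by
    intro i t
    rcases get_mem_or_eq_nil db i with hi | hi
    · exact h _ hi t
    · rw [hi, eval_nil]
  rw [step, force_eq]
  generalize hv : shift (n / 2048 % 9) _ = v
  have hv1 : eval (fun i => x (i + s)) v = 1 := by
    rw [← hv, eval_shift]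
    simp only [add_assoc]
    cases Nat.beq (n / 1024 % 2) 0
    · rw [cond_false, eval_invAppend, hget, inv_one, one_mul, eval_nil]
    · rw [cond_true, hget]
  have hv2 : eval (fun i => x (i + s)) (drop v (n / 64 % 16)) *
      eval (fun i => x (i + s)) (take v (n / 64 % 16)) = 1 := by
    rw [mul_eq_one_comm, eval_take_mul_eval_drop, hv1]
  rw [eval_mulRed, eval_mulRed, eval_mulRed, hv2, mul_one, mul_eq_one_comm,
    eval_take_mul_eval_drop]

theorem Holds.eval_run {x : ZMod 9 → G} {db : List (List ℕ)} (h : Holds x db) (l w : List ℕ)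
    (s : ZMod 9) :
    eval (fun i => x (i + s)) (run db l w) = 1 ↔ eval (fun i => x (i + s)) w = 1 := by
  induction l generalizing w with
  | nil => rfl
  | cons n l ih =>
    rw [← h.eval_step n w, ← ih (step db n w)]
    exact iff_of_eq (congrArg (eval _ · = 1) (force_eq _ _))

theorem Holds.targets {x : ZMod 9 → G} {db : List (List ℕ)} (h : Holds x db)
    {ts ls : List (List ℕ)} (hc : checkTargets db ts ls = true) : Holds x ts := by
  induction ts generalizing ls with
  | nil => simp [Holds]
  | cons w ts ih =>
    cases ls with
    | nil => cases hc
    | cons l ls =>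
      rw [checkTargets, Bool.and_eq_true, List.isEmpty_iff] at hc
      intro v hv s
      rcases List.mem_cons.mp hv with rfl | hv
      · have hv : eval (fun i => x (i + s)) (mulRed v []) = eval (fun i => x (i + s)) v := by
          rw [eval_mulRed, eval_nil, mul_one]
        rw [← hv, ← h.eval_run l, hc.1, eval_nil]
      · exact ih hc.2 v hv s

/-- Soundness of `check`. -/
theorem Holds.of_check {x : ZMod 9 → G} {db cert ts ls : List (List ℕ)} (h : Holds x db)
    (hc : check ts ls cert db = true) : Holds x ts := by
  induction cert generalizing db with
  | nil => exact h.targets hc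
  | cons l cert ih =>
    rw [check, force_eq] at hc
    refine ih (fun w hw s => ?_) hc
    rcases List.mem_cons.mp hw with rfl | hw
    · rw [h.eval_run, eval_nil]
    · exact h w hw s

end CyclicWord

section ElementaryAbelian

variable {G : Type*} [Group G]

open scoped IsMulCommutative in
/-- The subgroup generated by `n` commuting involutions has order `2 ^ n` when no product of
some of them is trivial. -/
theorem card_closure_range_of_involutions {n : ℕ} {g : Fin n → G}
    (hc : ∀ i j, Commute (g i) (g j)) (h2 : ∀ i, g i * g i = 1)
    (hne : ∀ S ∈ (List.finRange n).sublists, S ≠ [] → (S.map g).prod ≠ 1) :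
    Nat.card (Subgroup.closure (Set.range g)) = 2 ^ n := by
  let H := Subgroup.closure (Set.range g)
  have : IsMulCommutative H := Subgroup.isMulCommutative_closure (by
    rintro _ ⟨i, rfl⟩ _ ⟨j, rfl⟩
    exact hc i j)
  let h : Fin n → H := fun i => ⟨g i, Subgroup.subset_closure ⟨i, rfl⟩⟩
  have h2' : ∀ i, h i * h i = 1 := fun i => Subtype.ext (h2 i)
  let f : Finset (Fin n) → H := fun u => ∏ i, if i ∈ u then h i else 1
  have hmul : ∀ u v, f u * f v = f (symmDiff u v) := by
    intro u v
    rw [← Finset.prod_mul_distrib]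
    refine Finset.prod_congr rfl fun i _ => ?_
    by_cases hu : i ∈ u <;> by_cases hv : i ∈ v <;> simp [Finset.mem_symmDiff, hu, hv, h2']
  have hone : ∀ u, f u = 1 → u = ∅ := by
    intro u hu
    by_contra hne'
    obtain ⟨i, hi⟩ := Finset.nonempty_iff_ne_empty.mpr hne'
    refine hne ((List.finRange n).filter (· ∈ u)) (List.mem_sublists.mpr List.filter_sublist)
      (List.ne_nil_of_mem (a := i) (by simpa using hi)) ?_
    have hl : ((List.finRange n).filter (· ∈ u)).toFinset = u := by ext; simp
    have hprod : (((List.finRange n).filter (· ∈ u)).map h).prod = f u := by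
      rw [← List.prod_toFinset h ((List.nodup_finRange n).filter _), hl]
      simp [f, Finset.prod_ite_mem]
    have := congrArg H.subtype (hprod.trans hu)
    rw [map_list_prod, List.map_map, map_one] at this
    exact this
  have hinj : Function.Injective f := by
    intro u v huv
    have : f (symmDiff u v) = 1 := by rw [← hmul, huv, hmul, symmDiff_self]; simp [f]
    exact symmDiff_eq_bot.mp (hone _ this)
  have hsurj : Function.Surjective f := by
    have hsingle : ∀ i, f {i} = h i := fun i => by simp [f]
    rintro ⟨a, ha⟩
    suffices ∃ u, (f u : G) = a from this.imp fun u hu => Subtype.ext hu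
    induction ha using Subgroup.closure_induction with
    | mem a ha =>
      obtain ⟨i, rfl⟩ := ha
      exact ⟨{i}, by rw [hsingle]⟩
    | one => exact ⟨∅, by simp [f]⟩
    | mul a b _ _ iha ihb =>
      obtain ⟨u, rfl⟩ := iha
      obtain ⟨v, rfl⟩ := ihb
      exact ⟨symmDiff u v, by rw [← hmul, Subgroup.coe_mul]⟩
    | inv a _ iha =>
      obtain ⟨u, rfl⟩ := iha
      refine ⟨u, eq_inv_of_mul_eq_one_left ?_⟩
      rw [← Subgroup.coe_mul, hmul, symmDiff_self]
      simp [f]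
  rw [← Nat.card_congr (Equiv.ofBijective f ⟨hinj, hsurj⟩)]
  simp

/-- A finite subgroup is normal if some generators of the group conjugate its generators into
it. -/
theorem normal_closure_of_conj_mem {S T : Set G} [Finite (Subgroup.closure S)]
    (hT : Subgroup.closure T = ⊤)
    (h : ∀ t ∈ T, ∀ s ∈ S, t * s * t⁻¹ ∈ Subgroup.closure S) :
    (Subgroup.closure S).Normal := by
  rw [← Subgroup.normalizer_eq_top_iff, eq_top_iff, ← hT, Subgroup.closure_le]
  intro t ht
  have : Finite (Subgroup.closure S : Set G) := ‹_›
  refine Subgroup.mem_normalizer_fintype fun a ha => ?_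
  have hle : Subgroup.closure S ≤ (Subgroup.closure S).comap (MulAut.conj t).toMonoidHom :=
    (Subgroup.closure_le _).mpr fun s hs => h t ht s hs
  exact hle ha

end ElementaryAbelian

namespace CyclicWord

variable {G : Type*} [Group G]

set_option maxRecDepth 20000 in
/-- Derivations of consequences of the two families of relators of `IsSolution`. -/
def involutionCert : List (List ℕ) := [
  [24576, 19521], [46080, 15426, 6340, 18498, 4165, 2114, 54343], [35840, 26816, 36865, 32838,
  20547, 29896], [84992, 54338, 45252, 55810, 51270], [55296, 73731, 71748, 69698, 103496, 50498],
  [87040, 78016, 92417, 81992, 9352, 62786], [145408, 95234, 97474, 111618, 99397, 106689, 137217,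
  108737], [125952, 130243, 119877, 127169, 157697, 94273], [144384, 148675, 138309, 145601,
  40960, 120897], [184320, 36994, 111104, 93190, 83968], [178176, 119873, 92167, 9216], [54272,
  184448, 134150, 124928, 23552], [0, 209089, 180609, 18439, 239745], [236544, 265216, 238657,
  186688, 43015, 264321], [203776, 151560, 290817, 16513], [301056, 1090, 222277, 79046, 63621],
  [329728, 200896, 111940, 127041], [12288, 127106, 95237, 340033], [185344, 114688], [335872,
  158979, 50308, 369665], [391168, 352322], [373760, 380098], [387072, 396354, 403649], [203776,
  444547], [436224, 222273, 438340], [241664, 488579], [512000, 261120], [487424, 279554],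
  [500736, 211074, 296961, 294917], [327680, 325635], [547840, 334976], [352256, 365569], [62464,
  374914, 376965], [600064, 593027, 398468], [313344, 657411], [632832, 332800, 338049], [444416,
  351235], [370688, 472195], [391168, 482307, 402561], [497664, 411714, 701508], [435200, 728131,
  519297], [737280, 454658], [253952, 475138, 473093], [496640, 786627], [515072, 598147],
  [523264, 521410, 532484], [635904, 544897], [561152, 563329], [870400, 724098, 868545], [598016,
  721026, 923716, 697345], [739328, 948228], [975872, 758784], [778240, 981060], [757760, 675970,
  798722, 1001542], [776192, 817152, 1026052], [1035264, 836608, 795648], [731136, 733313, 856129,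
  1058885, 814081], [837632, 878592, 1048772], [902144, 1090692], [1112064, 919552], [1141760,
  1102978, 937987], [1143808, 951617, 948352, 906369], [1178624, 843970, 1141955, 609344, 968769,
  1173573], [1196032, 991297], [866304, 1013056, 1215556], [884736, 1031488, 1221764], [907264,
  1035584, 1240131], [1259520, 1052801, 926726], [1047552, 1045698, 1271813, 1071238, 945158],
  [962560, 1090880, 1301635], [1086464, 1084610, 1310725, 1110150, 984070, 985090], [1293312,
  1001537, 1129797, 1340549], [1314816, 1147008, 1020935], [1336320, 1165442, 1039367], [1355776,
  1187968], [1174528, 1400834, 1198276, 1175686], [1096704, 1397888, 1221828], [1446912, 1246402],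
  [1422336, 1264832], [935936, 1440898, 1281158, 1153159, 1445953], [1304576, 1457219], [1272832,
  1325251, 1284231], [1199104, 1542272, 1343810, 1297413, 1299457, 1213574, 1501249, 1529921],
  [627712, 3200], [1381376, 1339396], [1554432, 1585219, 1358912, 1389893, 1386624, 1260548],
  [1416192, 1376259, 267586], [1429504, 1385600], [1453056, 1404032, 1648769, 1617985], [1468416,
  1430658], [1567744, 1452163, 1651777, 138368, 1641536], [1709056, 941377, 1473664, 1471617,
  1501254, 921600, 1697793], [1689600, 1440768], [1695744, 1460227, 1707204], [1481728, 1723460],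
  [1750016, 1217603, 1510464, 1781829, 1537025], [610304, 1757248, 1601537, 1515655, 1759302],
  [1485824, 1787008, 1540292], [1838080, 1550594, 1278209, 1825797, 1799233], [1570816, 1573956,
  1847364], [1835008, 1591618, 1590400], [1843200, 1602818, 1856704, 335169], [1611776, 1671297,
  353410, 1899653], [187392, 6146, 1601536], [94208, 1916037, 1648902], [1934336, 1667138],
  [1944576, 1665154], [1684480, 1965250], [1670144, 1985604, 1705029], [1840128, 1698817],
  [1847296, 1716288, 1852550, 1724551, 2017345, 2011201], [1777664, 1735680], [1309696, 1889600,
  1758212], [1778688, 1915971, 1769600, 1379521, 2117702, 555330], [1805312, 1830080, 1798147],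
  [1806336, 1817602, 1953090, 1821702], [1836032, 1886400, 1840132], [1857536, 1904771, 2140224,
  2152513], [1862656, 1995969, 1877121, 1970311], [1885184, 2020609], [1676288, 1906882, 1959046],
  [2022400, 1899842, 2219075, 1978370], [2234368, 1921346], [443392, 1953796, 1939781], [400384,
  1959040, 1975301], [1996800, 1156352, 2294976, 1979520, 1995781, 1612034], [2026496, 431104,
  2008192, 2024453, 1622274, 2013318], [2036736, 1955075], [1972224, 2061316, 2048129, 2050182],
  [1996800, 2077828], [2100224, 1995011], [2448384, 1953856, 603328], [2127872, 620866, 1973574,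
  2418758, 2224129], [2443264, 676097, 2445319, 1998144, 1290304, 2437191], [2256896, 2016579],
  [2476032, 1329345, 2039878, 2188422], [2294784, 2349314, 2055301, 980096], [1212416, 2305024,
  2274370, 2073734, 998528], [2533376, 1386755, 2094277, 2541765], [2248704, 2070723], [2577408,
  2046018], [2311168, 2064451], [2605056, 2086977, 2307076, 407874], [2114560, 2658371], [2348032,
  975042, 2653376, 2642048, 2132038], [2138112, 2666688], [2688000, 2716672, 2156737, 2518149,
  2722817], [2139136, 2694212, 1015105, 2494599, 2176263], [2421760, 2194689], [856064, 2530371,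
  2216070], [2463744, 2234497], [2482176, 2251841], [2492416, 2228483], [2846720, 2156546,
  1002561], [93184, 2176007, 2541574], [2844672, 2185472], [2865152, 2175042], [2594816, 2195715],
  [2629632, 1093637, 2196679, 2698374], [2666496, 2618560, 2214085, 1113152], [1130496, 2233541,
  2293957], [2663424, 2197571], [2778112, 2214145], [1191936, 2544963, 2998341, 2470913, 2989255,
  2244871], [3014656, 2819137, 2212100, 521601], [1518592, 2728002, 2874695, 2871424, 2211911],
  [2211840, 2404544], [3097600, 1918209], [3119104, 2892865, 1936643], [3147776, 1960065,
  2802688], [2820096, 1979648, 3156036], [3148800, 1996930, 2839552], [2789376, 2021504, 2864128],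
  [3180544, 2041985, 3210308], [3225600, 2999361, 2061571, 3200192], [3215360, 2068739, 3254275],
  [3275776, 2088128, 3234886], [2979840, 3252421, 2105600, 3048581], [2972672, 2124993, 3271751],
  [2992128, 2151680, 3317827], [3010560, 2170112, 2918660], [2659328, 2187460, 3030023], [3381248,
  2209986], [3391488, 3156161, 2220291], [2240512, 3377218], [3441664, 3391488, 2260099],
  [3224576, 3121218, 3207365, 2278534, 3412161], [2295808, 3133570], [1209344, 3464259, 2317447],
  [2766848, 2326528, 3508293, 3503105], [3201024, 2346049], [3506176, 3071107, 1995904, 3517504,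
  2373957], [2393088, 2654272], [3341312, 2963712, 3554304, 2399238], [3270656, 3042370, 3560646,
  2428935, 3275905], [3630080, 3387457, 2447363], [2466816, 3314692], [2102272, 3318912, 2473285],
  [3648512, 2501635, 3673155], [3416064, 3359873, 3464197, 2140289, 3650757], [3678208, 2159938],
  [2177024, 3487749, 3723393], [3416064, 2196803], [2213888, 3443845], [3550208, 3452096, 3450053,
  2245894], [3768320, 2251970], [2272256, 3538946], [3810304, 2292032], [3536896, 2138113],
  [3678208, 2156674], [3899392, 3657730, 2176321, 3111173], [3683328, 2202881, 3682432, 3584007],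
  [3936256, 2218305, 3609600], [3355648, 3910724, 2102273, 3392774, 3713153], [3934208, 3943490,
  2135041, 3425542], [2064384, 3225665], [2082816, 3767297], [2110464, 3721473], [3721216,
  2119745, 3715079], [3825664, 2151746, 3778565], [2171904, 3977220], [2190336, 3674372],
  [4079616, 1396737, 3792004], [4133888, 4013441, 3896455, 3937473], [3912704, 3912706, 4029634,
  4150278], [3998720, 3965059, 3838984, 526467, 3833984], [2473984, 4084800, 3992838, 3012866],
  [3976192, 4017410, 4008067, 3746881], [3898368, 3996864, 3544197, 683463, 4028673, 4120584],
  [4256768, 4052224, 4054083, 3907712], [4116480, 4034688, 792578, 3668033], [4054016, 3949699,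
  4003073, 4084933], [4072448, 3968131, 4021505, 4101253, 3973257, 4266049], [4090880, 4074560,
  3988612, 4041985, 4053189], [816128, 4143361, 4071750, 4308161, 4346881], [3650560, 4322309,
  4029574, 4155649, 4090182], [4107264, 4084865, 4336704], [4101120, 4112578, 4366408, 4064386],
  [4087808, 4121664, 4091971, 2691202, 4373575, 2860160], [4396032, 4160771, 4119875], [4453376,
  4127808, 4226243, 4210823], [2623488, 4136068, 4121921, 4200645, 1336450, 3672128], [4018176,
  4284610, 4485121, 4159488], [4308992, 4022532, 1120321], [1733632, 4479107, 3800200, 4329793,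
  4040968, 1138753], [4303872, 4251906, 4059395, 4544513], [4220928, 4092928, 4077828, 2641089,
  4236424, 4569160], [4083712, 4296898, 4550728, 3405827], [4106240, 4285762, 3409922, 4556864],
  [4148224, 4060482, 4578496, 4584641, 4615240], [4073472, 4206848], [4657152, 4646018, 4092160,
  4165700, 2815168], [3207168, 4112641, 4476165, 4476992, 4332544, 4633665, 2084224], [3136512,
  4136193, 4110406], [4473856, 4700288, 4109568, 4128837, 4429825, 4701253], [1087488, 4319297,
  4101254, 4495360], [4408320, 66050, 1415, 4415623, 4513800, 4406273, 2893952, 4714561],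
  [4468736, 4722883, 4287616, 3212416, 4082881, 4357381], [249856, 1415], [262144, 32135,
  4569216], [280576, 50567, 4587648, 4506945], [4845568, 4605056, 4056129, 4635974, 4132933],
  [4659200, 4091972, 4617217, 3133449], [4685824, 4121729, 4840640, 2153601, 4316232, 4880449],
  [83968, 1216, 4568198], [4714496, 4110404], [4639744, 4132096, 4455749, 3745088], [2275328,
  976966, 3772678, 2508226, 4752704, 4161799], [3411968, 4107523, 4073542], [3632128, 4658245,
  4059143, 4947008], [4498432, 4068675, 4665479], [5023744, 4073536], [5042176, 4104193, 4715655,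
  5003329], [5055488, 4105473], [4751360, 5070915, 4202625, 4123909], [4132864, 4685060],
  [4128768, 5106757], [4147200, 5131397], [4917248, 4167872, 5145668, 4820097], [4190208,
  4834309], [4888576, 4177155, 4851847], [4968448, 5215233, 4866049, 4168964], [4161536, 4886658,
  3670337, 3309826, 4892679], [5003264, 4055296, 5040260, 4998273, 4074496], [5057536, 4074753,
  5262401, 4936833], [4939776, 4099328, 5011780, 5249089, 5280833], [5102592, 4122755, 4965376,
  5291137], [4982784, 4142336, 4646980], [4071424, 5300354, 5054726, 5057600, 4161666, 4778119],
  [5019648, 4179200, 5198852], [3410944, 3522885, 4196609, 5169349, 4571201, 5338177, 4643016,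
  3523648], [1567744, 3503559, 4217984, 5207175, 5382273], [5366784, 922883, 11462, 5406721],
  [5057536, 5392580, 5156864, 4242437, 5183489], [3528704, 4259971, 5167430, 5166208, 3190209],
  [5138432, 5431426, 5222404, 5136513, 4392000, 4280326, 5427264, 4665602], [4310016, 5167364],
  [4328448, 4921412, 5293057, 5493832], [5512192, 4302081, 5479488], [5541888, 4313216], [5511168,
  4320512, 5516352, 1984577], [5240832, 4400384, 4310084], [4312064, 5259394, 4993282, 5361671,
  5356675, 890368], [4295680, 5128451], [4444160, 4281408, 5623873], [5648384, 4312129], [4327424,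
  5635270, 5179457, 3828928, 3299458], [5643264, 4239424], [5369856, 4529408, 4150468, 4995137,
  1327233], [1862656, 5389445, 4167938, 5522566, 1586561], [5695488, 4192515, 5545028, 3363970],
  [1936384, 4209799, 4847687, 5479553, 3889280], [5769216, 5533889, 4203523], [5456896, 306690,
  5321, 5558273], [5583872, 4148611], [5118976, 4140420, 5592193], [5848064, 4148353, 5807296],
  [5364736, 4166787, 5825728, 5543041], [5548032, 4873280, 4170053], [237568, 5569665, 4726784,
  4058183], [5253120, 4004994, 5600384, 5888065, 3523648], [2711552, 5212355, 4023429, 5618816,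
  5906497, 3542080], [4047872, 4927617], [5742592, 5777409, 4036801, 5739654], [6004736, 4054145,
  5668992, 5969991], [1056768, 5505], [5721088, 4091011, 5705856, 6006856], [4097024, 6047747],
  [53248, 14784, 185352], [5765120, 6058114, 4594693, 5275718, 5768199, 4136322, 6047942,
  5492801], [161792, 2044097, 6067401, 4110409], [4037632, 6090822, 5931074, 21633], [6148096,
  5820480, 4036739, 575553], [5825536, 4021442, 5917827, 3220866], [2991104, 4023491, 5936262],
  [69632, 5869699, 6198407, 5406018, 4024456], [2276352, 5885058, 5974145, 4018182], [6231040,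
  3929410, 6202439, 6240385], [1328128, 4483], [6282240, 339330, 6078788, 3925122, 4721863,
  1290370], [6297600, 3818690, 6060168], [6304768, 5977217, 3816897, 6309892], [6329344, 3802433,
  6154248], [5682176, 3815491, 5858376], [3815424, 6375557], [6392832, 6151362, 6356163, 3813697,
  5199109, 6150273, 6391880], [646144, 3669000, 4100424, 6074497, 6172680, 6065153, 4552832],
  [6096896, 6389890, 4926469, 6095943, 3669448], [3557376, 4498881], [345088, 6175748, 6429760,
  6418625, 3505353, 6220809, 6119561, 6220803], [4925440, 3523013, 6444101, 5824577], [6461440,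
  6490241, 3551300, 5938241, 5825608], [3538944, 6508549], [3317760, 6501573, 2764866], [6358016,
  6317056, 3258501], [6216704, 6339585, 6534341, 3136769, 6243461], [6587392, 3031168, 2552193],
  [2932736, 6272007], [3517440, 2893890], [6601728, 2804866], [2715648, 6430725], [6688768,
  3116353, 2637189, 6356097], [2659328, 3083589, 6705216], [6482944, 6379586, 2221061, 6382596],
  [6410240, 2021762, 4819205, 3034498], [6419456, 1737026, 3649606], [6534144, 1731842, 6533252,
  6462530], [6584320, 1666114, 6463488, 5073921], [475136, 6782145, 3113984, 3319169, 6779968,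
  1595465], [1413120, 6497344, 1423688], [6493184, 6616065, 1189957], [6823936, 6388867, 5313664,
  1009093], [6554624, 636291, 6638721, 2990473], [6104064, 6570117, 651651, 6653959, 3007875],
  [1105920, 6881352, 6723586, 674953, 6580352], [613376, 6614018, 1298754], [4608000, 6239360,
  441415], [6548480, 6743173, 6741121, 6629506, 6715392, 6766728, 6640650, 5381442], [111616,
  6756488, 5162441, 4829313, 1898571, 6266050, 6039690, 1017282], [6967296, 4329537, 6775814,
  6777857, 3646592, 6675584, 6076545, 5916809, 84225, 6682634, 1070528, 6983746, 6774794, 5492865,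
  5309834], [5882880, 6302723, 3085697], [7046144, 5876928, 6787075], [5217280, 5876997, 5878918],
  [6674432, 6882561, 5868804, 7046208, 1162754], [11264, 7111815, 6870145, 6911169, 5897480,
  6865928], [5899264, 6129795, 6884361], [534528, 3105920, 3585416, 6893696, 6943041, 5710148,
  6805642, 6908929, 1916161, 6807688, 5959746, 7098440, 6903809, 6799680], [6864896, 7119043,
  6683776, 5608576, 6479041, 6846720, 5677127, 463937, 6832129], [5198848, 5636230, 5847302],
  [6066176, 5643397, 6954113, 7189642], [4792320, 6881286, 6928449, 7180361, 6041728, 5567875,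
  6672455, 105858, 166337], [6706176, 5898306, 5531013, 2684353, 6986880], [7144448, 5902400,
  5539077, 7018624, 6920201], [7073792, 5615744, 5557509, 7037056, 6938634, 5564739, 6937600,
  991488, 6932609, 2611337, 6942720], [7058432, 5379138, 5973382, 5529736, 196610], [6121472,
  7268416, 7316611, 7074945, 6750274, 5511239], [6187008, 7021696, 7084032, 5776513, 5524868,
  7292105, 4605057, 6137857, 7284800, 7334977, 623809], [6785024, 7303363, 7051456, 5508417,
  5770245, 939138], [5808128, 7024642, 5658753, 5449797, 7126144, 6912002, 7355401, 6936834],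
  [7146496, 7100418, 7103558, 5456007, 7150727, 3263490, 7146633, 7023936, 5363849, 3373122,
  5474314, 830978], [2493440, 7391367, 5381571, 7204871, 7063681, 3455233], [7424000, 2632962,
  6968321, 5345288, 1187329, 7090183], [30720, 4646087, 3866049, 5309440, 6953223, 4051009],
  [6635520, 7412737, 4646087, 3884032, 5327881, 6654024, 1203585, 1474, 7460935], [1210368,
  4178056, 7194690, 5269898, 7137408, 7195968, 7471114, 2388291, 7480385], [7164928, 36995,
  6710273, 5208393, 3981376, 1863105], [55296, 7279745, 5179841, 6335623, 7518337, 7507072],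
  [5143552, 6710595, 55490], [7303168, 6020098, 5051846, 7205191], [1515520, 4658370, 5082497,
  7035143, 1657026, 7531713, 7455881], [1665024, 430210, 995520, 7027841, 5051785, 6413569,
  7552192, 7351297, 7588938, 7553089], [107520, 7271433, 5035394, 7074056, 6176897, 7270400],
  [590848, 7279680, 5016712, 6893826, 4254088, 7385088, 7383048], [7147520, 4995138, 6451202,
  294154, 7638081], [3484672, 7414787, 7454722, 7331973, 5736641, 4997250, 5716041, 7318539,
  7330946, 4383809, 7659529], [7434240, 289026, 6944968, 7684160, 7408963, 4884552, 7435265],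
  [358400, 6143175, 4832264, 7690241, 7661761], [812032, 4701640, 7376001, 7676105, 2768064,
  6950209, 4830601, 243905], [6102016, 4829249, 4654274, 7499776, 6341002, 4559242], [7517184,
  7539970, 7741570, 7747720, 7742601, 5817478, 7417984, 5125578, 4836546, 7188552, 404738],
  [131072, 7189825, 4404352, 7044225, 7220224, 4829256, 4792385], [7455744, 24963, 7540746,
  4743491, 4845706, 7454721, 7789569], [4689920, 7250181, 7474305, 1409, 7565441], [248832,
  7671040, 4672648, 7492736, 7591937], [4670464, 7041093, 1954049, 2362753], [6716416, 4628742,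
  7651462, 7525385, 243268, 7853190], [4000768, 7637063, 4571529, 7770120, 651459], [7369728,
  6561858, 7566342, 6726913, 4590790, 7656458, 7656450, 7592192, 3742016, 7565320, 324932],
  [7917568, 7589952, 7669891, 7907392, 4443139, 7685256, 6544771, 7606601, 326081, 6743040,
  7226369, 4618632, 7635136, 6652033], [5486592, 1978561, 7906501, 5426627, 941248, 6095041,
  4622729, 5585922, 958528, 7936007], [491520, 4612483, 7741639, 7719049, 7948418], [1324032,
  7244935, 6428802, 6719680, 4604297, 7735296, 7733258, 5289410, 7926976, 940096], [4577280,
  6142277, 7742593, 7638273, 7696649, 7664640, 7953474, 1486017, 7746695, 7744641], [8016896,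
  6454464, 4446595, 7775241, 4116867, 7529601, 6454400, 1787978], [2152448, 7819458, 7778441,
  103490, 7795840, 4437185, 6977801], [4356096, 7188547, 4959681, 8006721, 8016074, 6425984],
  [8070144, 7795841, 4321603, 8030409, 7714947], [186368, 6361286, 4253832, 8050753, 1132928],
  [7145472, 7746755, 6378821, 4260290, 5886024, 7857290, 7762049, 7520321, 464321], [8115200,
  7576641, 4190595, 8080576, 6943874, 1381770, 7880714, 7604418], [7805952, 7811264, 6215941,
  8128581, 5640194, 4147272, 56321, 556353], [670720, 7917703, 6744192, 4135305, 7831562,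
  5751107], [8180736, 4768960, 8146121, 4556995, 4097416, 477570, 7926919], [3521536, 1671361,
  7954561, 6781056, 4091977, 7446530], [1009664, 7746824, 4055369, 536705, 7975041, 7928010,
  8181834, 1210498, 8209479, 7975041], [8238080, 7576898, 8184000, 7890945, 7485568, 4061639,
  4663361, 3526785, 599496], [418816, 7521603, 8254464, 4066633, 7924872, 7922817, 7915528],
  [6420480, 8257667, 977282, 8028297, 4058186], [1142784, 7944195, 4070601, 8246464, 2372993],
  [5120, 8261697, 6603009], [7985152, 8038403, 7200897, 4018633, 8089605, 4939908, 23744, 8280137,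
  6621441], [8332288, 8337474, 8109060, 8338562, 413825, 8004737, 4018377, 8143936, 8342593],
  [4031488, 8026116, 720324], [8337408, 4019393, 7678213, 8136833, 1083393, 1331649, 2194952],
  [8393728, 8068160, 3963011], [5142528, 8419462, 3963015, 51200, 8405121], [1865728, 1025],
  [18432, 8448065], [41984, 8464449], [8244224, 4646339, 8151049, 8252553, 62467, 8484935],
  [8173568, 7945282, 83973], [8529920, 107522, 8279041, 7335944, 8482880], [8548352, 119809,
  3374469], [8247296, 7521473, 4110472, 198656, 8227841, 8520777, 8165441, 8553480], [8584192,
  8182914, 7024897, 4089029, 55361, 535873], [8606720, 8277312, 383492, 8552513, 4089290, 3451969,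
  8350855], [4461568, 8625154, 6766593, 4066760, 8369280, 1365569, 700417, 8608775], [8636416,
  8606913, 8594628, 4926913, 246785, 8301702, 8627328, 4973699, 4081992, 8402952], [7480320,
  8321152, 3577029, 1788929, 8299595, 4109514, 539009, 8412171, 3857537, 8414208, 8655873],
  [4075520, 8344704, 1031492, 8640713, 8432649], [4083712, 4799874, 8688705, 8652865, 1681664],
  [8712192, 7366912, 8477700, 369857, 4073857, 8510471, 8469504], [2102272, 2046145, 6673793,
  4023818, 3116032, 5380161, 8418376], [3985408, 8708163, 5713987, 5141824, 6024329, 8745026],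
  [7410688, 8721475, 8429569, 8515713, 4010438, 8435720, 8034497, 6915136, 8524802], [3944448,
  8202309, 6140290, 8774728, 8455300, 2894848], [3223552, 1771654, 3946624, 8568966], [8813568,
  119170, 8100992, 3945601, 8815623], [8832000, 2025920, 3760193, 8360200, 8797248, 8279169,
  7374208], [36864, 3794373, 5013576], [8631296, 8639618, 157057, 3801409, 8561929, 333186,
  8638473, 8868931, 8549376], [8659968, 8564930, 8856581, 299270, 3823937, 8620233, 8855627,
  8654850, 535553, 8891457, 8553472], [8587264, 3740802, 8664197, 296387, 8903809], [7017472,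
  8890432, 1679488, 8683656, 4380736, 3669505, 4460937, 297217, 8930433], [773120, 8711174,
  3655168, 8907846, 6230147, 8599688], [8729600, 3673600, 4313224, 1473, 7687497], [1552384,
  3577091, 8170823, 7487553, 8953034, 8660106, 3685571], [8766464, 8806528, 4852038, 3558720,
  4369544, 3545537, 57344, 9005057], [3582976, 8781952, 1832131, 8485120, 866305, 9014343],
  [7077888, 8240449, 5010566, 1188224, 244161, 8711296, 3428362], [5762048, 8827906, 9054336,
  8725640, 8718344, 3335363, 9062534], [8741888, 3180994, 8378630, 329155, 8792072, 9043137,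
  5878018], [8853504, 9063552, 9090050, 3179587, 8848518, 8763393, 3391554], [7168, 1858627,
  3177728, 5050505, 917825], [8897536, 9087041, 871873, 8886277, 3146307, 9133126], [1602560,
  9157639, 3073418, 502913], [8932352, 193664, 8922120, 8845449, 8322, 2979265, 9126088, 8570945,
  46275, 9135303], [9179136, 1494528, 2867649, 2829704, 8954881], [2710528, 2921736, 8868873,
  8870915, 3887232, 9168064], [9191424, 9231488, 6489153, 9194565, 2669121, 8988677, 1266116],
  [9237504, 5305666, 2513413, 8994825, 8912009, 9003139, 718921], [9226240, 4222401, 8990722,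
  2340875, 1547520]]

set_option maxRecDepth 20000 in
/-- Derivations of `involutionTargets`, which may use `involutionCert`. -/
def involutionTargetCert : List (List ℕ) := [
  [861185], [860228, 9277569, 9038849, 5475776, 6219778, 8721485, 5031040, 8955904, 2195905,
  9247949, 8100864, 8941696, 9287811, 6675584, 9034881, 1510528, 9287752, 8949762, 9017346,
  7870529, 3428352, 9277441, 863233], [860228, 4119939, 8721485, 8072449, 9040910, 9040900,
  7364865, 1957389, 8095744, 9242688, 9235649, 3514382, 8955904, 8465729, 9271362, 2820160,
  9040905, 1957379, 8095744, 9242688, 9041922, 6009932, 847937, 9272393, 9080065, 9247937,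
  5001728, 9040000, 2488385, 784640, 9276417], [860228, 847940, 450688, 861187, 450569, 848897],
  [860228, 849988, 9277573, 258498, 55873, 9287819, 9238593, 9272397, 414852, 9272449, 9277572,
  1267009, 9287815, 9248832, 7572672, 8943618, 6833154, 9280512], [824645, 8949890, 823500,
  8721410, 8699969, 1644032, 8765444], [863301, 8534017, 8091674, 9238592, 4873731, 1300480,
  5033409, 4711489, 9250902, 9248964, 8945793, 9274520, 8954881, 9283607, 3448896, 33156, 4260244,
  9043072, 9250901, 853059, 9251009, 8552725, 2523202, 9285714, 8957061, 6433108, 9041938,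
  9279624, 537728, 5198992, 9281537, 8554754, 9239618, 9286672, 9241665, 9279617, 8946688,
  5568526, 9236544, 2225665, 8944652, 8333568, 8947712, 5828674, 9235532, 9048195, 9086028,
  8554764, 9041931, 9235651, 6219777, 8721483, 5031040, 8955904, 2195905, 9247945, 8100864,
  8941696, 3359876, 3723338, 8610889, 2469891, 7561216], [865349, 6833565, 9040897, 614913,
  7928961, 86337, 9287768, 9032835, 393537, 9031708, 8941702, 5912960, 1290650, 9286809, 9272320,
  8239235, 4212801, 8107265, 9245888, 6028673, 845888, 849987, 9284737, 9044096, 7004161, 9044116,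
  9046166, 7501956, 3115030, 9275540, 7557125, 8751380, 4119942, 9035796, 8723777, 9241792,
  3765269, 9040899, 8958145, 3559681, 9248977, 5616020, 8948867, 1180244, 9287697, 4179330,
  1416389, 8091651, 9238592, 4283602, 6336656, 9242704, 3909056, 805967, 1037889, 9046158,
  8949763, 9287745, 9285697, 3885124, 199104, 9044108, 2808142, 1335361, 9287753, 5892163,
  7262337, 9274369, 250117, 9251009, 7359681, 8955019, 9048203, 370753, 8927561, 9242699, 9235649,
  5234763, 6558857, 8534017, 9272392, 8481026, 7561539, 6764617, 9086017, 9241799, 9272392,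
  8939651, 7723008, 1916098, 9286657, 9279552, 9274369, 9285633], [9272386, 5973379, 617473,
  9242708, 9286722, 6009920, 2635843, 9279619, 9040897, 1536130, 7574733, 9043983, 7364880,
  9287759, 8945797, 434625, 9251009, 1387844, 9277569, 9038849, 8974529, 594446, 2998796, 5391490,
  9048073, 9245899, 5889153, 8954881, 7738561, 9271296], [3491910, 9044119, 9245762, 4111748,
  720385, 8626262, 9272452, 8928513, 9243712, 6285377, 8994838, 8497174, 9272342, 9288833,
  8943751, 9047041, 973826, 9248978, 2894292, 1338835, 5492866, 7594132, 4536466, 9272402,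
  9040003, 4383812, 8944656, 8946689, 6455616, 9047056, 8948865, 6046081, 9286792, 9046144,
  9077776, 2105616, 5373069, 8719617, 9271374, 9040901, 8802563, 9250893, 9284686, 228929,
  9272394, 131524, 9239618, 9279619, 9040897, 498688, 9287752, 1011713, 8952964, 9046154, 1149386,
  9092232, 1288257, 1766912, 9042113, 9288706], [853061, 9251009, 8552715, 3359875, 3723338,
  8610889, 2469891, 7561216], [855109, 8949890, 9034753, 961538, 9239640, 8947713, 9274499,
  2840131, 5689686, 9048217, 1465344, 8172632, 9040897, 866374, 9285717, 107651, 9281620, 9083074,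
  9043073, 5713985, 9040914, 9282561, 9243715, 3865619, 8941698, 2433107, 9287760, 8939655,
  4220994, 9287760, 1112257, 9278478, 4073602, 6761793, 9043983, 9279617, 9247937, 8932417,
  9271425, 5591170, 1217730, 9279617, 9040897, 9074892, 9242699, 3746113, 8733952, 8730691,
  277899, 9285705, 9040897, 2875522, 9287753, 9034756, 706624, 9287751, 3927236, 8722437],
  [8949895, 4017664, 8980673, 8626177, 9281537, 8943745, 9047041, 350592, 9247945, 8792129,
  7441600, 9272395, 9280643, 414850, 52289, 9278465, 9278595, 3200, 8949767, 9284609, 7478400,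
  9236672, 9011529, 8105090, 7431239, 7317506, 9271298], [8946695, 8939652, 7723008, 9032844,
  1737796, 9247946, 9273347, 9032832, 7692674, 4886666, 2969035, 203137, 7431239, 3890689,
  9271425, 9048257, 9276418]]

set_option maxRecDepth 20000 in
/-- Derivations of consequences of the relators of `IsSolution` and of `cElt x i = 1`. -/
def translationCert : List (List ℕ) := [
  [43008, 37953], [64512, 15426, 6340, 36930, 4165], [26624, 55363, 32837, 30786, 83016], [105472,
  36864, 53442, 73730, 51269, 49218, 101447], [92160, 63555, 42307], [89088, 111811, 74822, 47170,
  25728, 84161], [105472, 130115, 99397, 106689, 155649, 49472], [15360, 120003, 148738, 36871,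
  112833], [194560, 121922, 21632], [121856, 48256, 9537, 165062], [87040, 18629, 222337, 173120],
  [185344, 194626, 150657, 39943, 251906], [268288, 219266, 122948, 56645], [288768, 222401,
  131137, 83269, 238790], [294912, 222274, 101508, 304129], [320512, 17408, 168065, 81920,
  272576], [35840, 186560, 100359, 291008, 339969], [308224, 78081, 37892, 350273], [58368,
  178368, 25733, 88256, 56324, 368705], [169984, 11398, 395393], [368640, 418881], [387072,
  425089], [446464, 406528], [467968, 424960], [482304, 444416, 105601], [188416, 115715, 473089,
  511109], [482304, 460865, 216065], [164864, 157827, 480449, 498757, 156673], [498688, 505026],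
  [37888, 22848, 273413, 551937, 527557], [15360, 550980, 554053], [236544, 585729, 566337,
  301189, 31873, 558144, 582661], [327680, 596994, 575684, 40001, 240645, 605185], [598016,
  332930, 596161, 617477, 266369], [397312, 11329], [58368, 312453, 654401, 635973], [661504,
  664578, 150785], [53248, 6, 416897], [717824, 425985], [378880, 445506, 719940, 23617], [776192,
  93377, 3268, 476288, 751681], [798720, 115905, 25796], [148480, 764096, 498821, 136257, 46272,
  778245], [839680, 789506, 528387, 147585, 57600, 530432], [668672, 56516], [616448, 866306,
  494725, 724290, 83141], [834560, 697473, 716992, 30720], [180224, 596096, 598148, 522369]]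

set_option maxRecDepth 20000 in
/-- Derivations of `translationTargets`, which may use `translationCert`. -/
def translationTargetCert : List (List ℕ) := [
  [443651, 621569, 883910, 624642, 677894, 890881, 922693, 927746, 887808], [888836, 462087,
  185601, 624641, 1280, 926721], [890884, 497669, 934016, 897025], [885766, 928903, 893955,
  556230, 900101, 921734, 198849, 143363], [885763, 922697, 550917, 430336, 608384, 870593, 26633,
  540801, 227585, 885768, 610434, 461826, 69639, 142471, 923718, 921728, 770049], [387075, 933953,
  547840, 874561, 888902, 138497, 110656, 925761, 901184, 186369, 927745], [610306, 939139,
  925696, 119808, 878784, 607553, 604288, 934017, 609281, 516161, 147462, 548868, 618502, 148742,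
  930821, 867394, 124928, 623618], [922690, 886788, 921734, 505024, 928769], [866370, 314434,
  161920, 507970, 158731, 937090, 408769, 870465, 548866, 111752, 48192, 933894, 869570, 899141,
  327873, 543937, 497665, 933890], [883906, 624769, 550916, 430336, 608384, 728396, 901121,
  932938, 82113, 719937, 888834, 930945, 276544, 878662, 106816, 934913, 927745, 441344, 922625,
  497665, 933890], [898051, 556226, 69696, 53441, 870465, 58566, 922693, 322626, 936065, 921602],
  [900099, 929924, 188609, 151751, 693376, 883904, 14401, 621568, 883908, 886787, 937030, 677888,
  928769], [165955, 939138, 930946, 358656, 479299, 870598, 18432, 35077, 924740, 870402]]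

/-- The word of `dElt x k`. -/
def dWord (k : ℕ) : List ℕ := [2 * k, (2 * k + 7) % 18]

/-- The word of `cElt x k`. -/
def cWord (k : ℕ) : List ℕ := dWord k ++ dWord k

/-- The commutator of two words. -/
noncomputable def commWord (v w : List ℕ) : List ℕ := invAppend v (invAppend w (v ++ w))

/-- The word that expresses that `x₀` conjugates `v` to `w`. -/
noncomputable def conjWord (v w : List ℕ) : List ℕ := 0 :: v ++ 1 :: invAppend w []

/-- The `i`-th entry lists the factors of the conjugate of `cElt x i` by `x 0`. -/
def cConj : List (List ℕ) :=
  [[6, 8], [0, 1, 2, 4, 6, 8], [0, 1, 2, 3, 4, 5, 8], [0, 1, 2, 4, 7], [2, 4, 5, 6, 7], [0, 1],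
  [1, 2, 3, 4, 7, 8], [0, 4, 5, 8], [3, 4]]

/-- The `i`-th entry lists the factors of the conjugate of `dElt x i` by `x 0`. -/
def dConj : List (List ℕ) :=
  [[0, 1, 3, 4], [1, 3, 5], [2, 3, 4, 5], [0, 1], [0, 2, 3, 4, 5], [0, 1, 2, 3, 4], [3, 4],
  [0, 1, 2, 4], [0, 1, 5]]

/-- The words that express that the elements given by the words `v k` commute and that
conjugation by `x 0` maps each of them to a product of such elements. -/
noncomputable def abelianTargets (v : ℕ → List ℕ) (conj : List (List ℕ)) : List (List ℕ) :=
  [1, 2, 3, 4].map (fun k => commWord (v 0) (v k)) ++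
    (List.range 9).map fun i => conjWord (v i) ((conj.getD i []).flatMap v)

/-- The words that express that the elements `cElt x i` are commuting involutions and that
conjugation by `x 0` maps each of them to a product of such elements. -/
noncomputable def involutionTargets : List (List ℕ) :=
  (cWord 0 ++ cWord 0) :: abelianTargets cWord cConj

/-- The words that express that the elements `dElt x i` commute and that conjugation by `x 0`
maps each of them to a product of such elements. -/
noncomputable def translationTargets : List (List ℕ) := abelianTargets dWord dConj

/-- The word of `x₀ x₃ x₁⁻¹`. -/
def relWord : List ℕ := [0, 6, 3]

/-- The word of `x₀ x₄ x₈ x₃ x₇ x₂ x₆ x₁ x₅`. -/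
def prodWord : List ℕ := [0, 8, 16, 6, 14, 4, 12, 2, 10]

theorem check_involutionCert :
    check involutionTargets involutionTargetCert involutionCert [prodWord, relWord] = true := by
  decide +kernel

theorem check_translationCert :
    check translationTargets translationTargetCert translationCert
      [cWord 0, prodWord, relWord] = true := by
  decide +kernel

/-! ### Solutions of the relations -/

/-- The difference of `x i` and `x (i + 3)`. -/
def dElt (x : ZMod 9 → G) (i : ZMod 9) : G := x i * (x (i + 3))⁻¹

/-- The square of `dElt x i`. -/
def cElt (x : ZMod 9 → G) (i : ZMod 9) : G := dElt x i * dElt x i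

/-- The relations of the quotient of `H(9,3)` by the normal closure of `H93w`. -/
structure IsSolution (x : ZMod 9 → G) : Prop where
  rel : ∀ i, x i * x (i + 3) = x (i + 1)
  prod : x 0 * x 4 * x 8 * x 3 * x 7 * x 2 * x 6 * x 1 * x 5 = 1

variable {K : Type*} [Group K] {x : ZMod 9 → G}

theorem map_dElt (f : G →* K) (i : ZMod 9) : f (dElt x i) = dElt (fun j => f (x j)) i := by
  simp [dElt]

theorem map_cElt (f : G →* K) (i : ZMod 9) : f (cElt x i) = cElt (fun j => f (x j)) i := by
  simp [cElt, map_dElt]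

theorem dElt_shift (s i : ZMod 9) : dElt (fun j => x (j + s)) i = dElt x (i + s) := by
  simp only [dElt, add_right_comm i s 3]

theorem cElt_shift (s i : ZMod 9) : cElt (fun j => x (j + s)) i = cElt x (i + s) := by
  simp only [cElt, dElt_shift]

theorem dElt_mul_dElt_mul_dElt (i : ZMod 9) :
    dElt x i * dElt x (i + 3) * dElt x (i + 6) = 1 := by
  have h3 : i + 3 + 3 = i + 6 := by rw [add_assoc]; rfl
  have h6 : i + 6 + 3 = i := by rw [add_assoc]; exact add_zero i
  simp [dElt, h3, h6]

theorem IsSolution.map (hx : IsSolution x) (f : G →* K) : IsSolution fun i => f (x i) where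
  rel i := by rw [← map_mul, hx.rel]
  prod := by simp only [← map_mul, hx.prod, map_one]

theorem IsSolution.shift_four (hx : IsSolution x) : IsSolution fun i => x (i + 4) where
  rel i := by simp only [add_right_comm i _ 4, hx.rel]
  prod := by
    change x 4 * x 8 * x 3 * x 7 * x 2 * x 6 * x 1 * x 5 * x 0 = 1
    rw [mul_eq_one_comm]
    simpa only [mul_assoc] using hx.prod

theorem IsSolution.shift (hx : IsSolution x) (s : ZMod 9) : IsSolution fun i => x (i + s) := by
  have h : ∀ n : ℕ, IsSolution fun i => x (i + n * 4) := by
    intro n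
    induction n with
    | zero => simpa using hx
    | succ n ih =>
      convert ih.shift_four using 3
      push_cast
      ring
  convert h (s * 7).val using 3
  have h28 : (7 * 4 : ZMod 9) = 1 := by decide
  rw [ZMod.natCast_val, ZMod.cast_id', id, mul_assoc, h28, mul_one]

theorem letter_two_mul (k : ℕ) : letter x (2 * k) = x k := by
  simp [letter]

theorem letter_two_mul_add_one (k : ℕ) : letter x ((2 * k + 7) % 18) = (x (k + 3))⁻¹ := by
  have h : (2 * k + 7) % 18 % 2 = 1 := by omega
  have h' : (((2 * k + 7) % 18 / 2 : ℕ) : ZMod 9) = ((k + 3 : ℕ) : ZMod 9) := by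
    rw [ZMod.natCast_eq_natCast_iff']
    omega
  rw [letter, h, h', Nat.cast_add]
  rfl

theorem eval_dWord (k : ℕ) : eval x (dWord k) = dElt x k := by
  rw [dWord, eval_cons, eval_cons, eval_nil, mul_one, letter_two_mul, letter_two_mul_add_one, dElt]

theorem eval_cWord (k : ℕ) : eval x (cWord k) = cElt x k := by
  rw [cWord, eval_append, eval_dWord, cElt]

theorem eval_commWord_eq_one_iff (v w : List ℕ) :
    eval x (commWord v w) = 1 ↔ Commute (eval x v) (eval x w) := by
  rw [commWord, eval_invAppend, eval_invAppend, eval_append, inv_mul_eq_one, eq_inv_mul_iff_mul_eq]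
  exact eq_comm

theorem eval_conjWord_eq_one_iff (v w : List ℕ) :
    eval x (conjWord v w) = 1 ↔ x 0 * eval x v * (x 0)⁻¹ = eval x w := by
  have h0 : letter x 0 = x 0 := letter_two_mul 0
  have h1 : letter x 1 = (x 0)⁻¹ := by simp [letter]
  rw [conjWord, List.cons_append, eval_cons, eval_append, eval_cons, eval_invAppend, eval_nil, h0,
    h1, mul_one, ← mul_assoc, ← mul_assoc, mul_inv_eq_one]

theorem Holds.commute {v : ℕ → List ℕ} {conj : List (List ℕ)} {e : ZMod 9 → G}
    (h : Holds x (abelianTargets v conj))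
    (he : ∀ (k : ℕ) s, eval (fun i => x (i + s)) (v k) = e (k + s)) (i j : ZMod 9) :
    Commute (e i) (e j) := by
  have key : ∀ k ∈ [1, 2, 3, 4], ∀ s : ZMod 9, Commute (e s) (e ((k : ℕ) + s)) := by
    intro k hk s
    have := h _ (List.mem_append_left _ (List.mem_map_of_mem hk)) s
    rw [eval_commWord_eq_one_iff, he, he] at this
    simpa using this
  have hij : ∀ i j : ZMod 9,
      i = j ∨ ∃ k ∈ [1, 2, 3, 4], j = (k : ℕ) + i ∨ i = (k : ℕ) + j := by decide
  rcases hij i j with rfl | ⟨k, hk, rfl | rfl⟩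
  · exact Commute.refl _
  · exact key k hk i
  · exact (key k hk j).symm

theorem Holds.conj_mem {v : ℕ → List ℕ} {conj : List (List ℕ)} {e : ZMod 9 → G}
    (h : Holds x (abelianTargets v conj))
    (he : ∀ (k : ℕ) s, eval (fun i => x (i + s)) (v k) = e (k + s)) (s i : ZMod 9) :
    x s * e i * (x s)⁻¹ ∈ Subgroup.closure (Set.range e) := by
  have hi : (i - s).val ∈ List.range 9 := List.mem_range.mpr (ZMod.val_lt _)
  have := h _ (List.mem_append_right _ (List.mem_map_of_mem hi)) s
  rw [eval_conjWord_eq_one_iff, he, zero_add, ZMod.natCast_val, ZMod.cast_id', id,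
    sub_add_cancel] at this
  rw [this]
  induction conj.getD (i - s).val [] with
  | nil => exact one_mem _
  | cons k l ih =>
    rw [List.flatMap_cons, eval_append, he]
    exact mul_mem (Subgroup.subset_closure ⟨_, rfl⟩) ih

theorem IsSolution.holds (hx : IsSolution x) : Holds x [prodWord, relWord] := by
  intro w hw s
  have h := hx.shift s
  generalize (fun i => x (i + s)) = y at h ⊢
  simp only [List.mem_cons, List.not_mem_nil, or_false] at hw
  rcases hw with rfl | rfl
  · simpa [eval, prodWord, letter, mul_assoc] using h.prod
  · have := h.rel 0
    simp only [zero_add] at this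
    simp [eval, relWord, letter, ← this]

theorem IsSolution.holds_involutionTargets (hx : IsSolution x) : Holds x involutionTargets :=
  hx.holds.of_check check_involutionCert

theorem IsSolution.holds_translationTargets (hx : IsSolution x) (hc : ∀ i, cElt x i = 1) :
    Holds x translationTargets := by
  refine Holds.of_check (fun w hw s => ?_) check_translationCert
  rcases List.mem_cons.mp hw with rfl | hw
  · rw [eval_cWord, cElt_shift, hc]
  · exact hx.holds w hw s

theorem eval_shift_dWord (k : ℕ) (s : ZMod 9) :
    eval (fun i => x (i + s)) (dWord k) = dElt x (k + s) := by
  rw [eval_dWord, dElt_shift]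

theorem eval_shift_cWord (k : ℕ) (s : ZMod 9) :
    eval (fun i => x (i + s)) (cWord k) = cElt x (k + s) := by
  rw [eval_cWord, cElt_shift]

theorem IsSolution.cElt_mul_self (hx : IsSolution x) (i : ZMod 9) : cElt x i * cElt x i = 1 := by
  have := hx.holds_involutionTargets _ List.mem_cons_self i
  rwa [eval_append, eval_shift_cWord, Nat.cast_zero, zero_add] at this

theorem IsSolution.holds_cElt (hx : IsSolution x) : Holds x (abelianTargets cWord cConj) :=
  fun w hw => hx.holds_involutionTargets w (List.mem_cons_of_mem _ hw)

/-! ### Permutation representations -/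

/-- The base `2 ^ 7` digits of the `i`-th entry are the values of `perm128 i`. -/
def table128 : List ℕ := [
  448217704389404364833592254433301826691067685303087895361843091438034015084243932341574059798483406756868979364836901893010584993881636066851509613191262846261812391318770065540699547286541195594186547390027411654052319161308270212276322061415987576633602229627271760132,
  412722225490886247681420124044091244817187357793838511355558322673525905974482139333540401655277105568697402031976357081102681686690651904161674314157942027862437324189176764074034413183139693425495209308414861956378748365128321333650832919753314324731436132747560044422,
  334163430050653333629463327507501108326890392173969423998754151790528681501710405775608905555795255523735251210029866134557582599479954603336479777593163542060265353228027174811419231861017031584832510274373953644367631752836983248377963317041217728806457398938522716296,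
  461962067997114743584695462548579203957577648229511139591379940118406392197319959305746113942747153562533694509124847790868235327581942104385131236291428816795832209893540512516779855877222143157392452500096088140606547978205510614041675967928164707695153623900931358986,
  496869917796569770680526558873164319754709084306685414098322677069384750519123818308804257485843135486402862495364352782250450363077382763536682433756588068955432563620011990509179918794929988791126264338584063604307299967936439180880778334884847569196552229537500367627,
  461859025028129311612589140825355253874037563935578938116404532741250876442955898207813688154908731430036257905504050841298303820747906633472895381142229615209342662607475819663717015870677702712072564410530254408660494966164849358238532151192553159626782023708703722380,
  205059646708344422711833396988394346602297531812289603611677612896113111379124978707143190839642234744975905982907959933075268557848764564337197858794771651105362858915502017592751759398396479997284864320715628815624324612309756862574074117032554985417606872733283665422,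
  469017722924856916628934991527148872263432536462892659210740796699138091656850757620860343379453332558578805128053353430005729071905771564233537348241351649920026298951538570318065364176828563596228627642895330457162281358420547392459535302193106686179104680368242986256,
  296704111998902829283092226131972165976503955603217851469223646785842808369584000789486535556285475233011650191513619858290425363104673229174853851828057023297603563882122660546980054303224724122742323329727046062419498479973157568799139138896180199434490748574804459525]

/-- The base `2 ^ 7` digits of the `i`-th entry are the values of the inverse of `perm128 i`. -/
def inverseTable128 : List ℕ := [
  490140804047970812823856542503492816239345475968233013390419435326690432555530582734266728973416824523053004372034888124952977247706085732890173518147736423441024463827087280669601292704364261521295539091932523037849960502876694495921315091917050276599260432867220981891,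
  523708236235771571511390532779516240624666787522679368990733321346359560093586754256347707603294783619915809848147693095978670999127911175918031997130381922490803158723284975674297819028645738096300203409605152478262152004648247767146657765571947008869631578287154350469,
  424511409633382773896800458979503919461645820913214147320293589771217313097226563840254197678393237278180428545758076047001374328752191371960831182839679718635641318619241360241911229089621052432922102166056065424886175231564940407233040755577601209780764904801886912903,
  320555774377084178360625797744599504935192439947306687668937497066055275001151520405902747372709423304177502582015700741359391938735806797239651707082559683408345140230535400444424537837529129722254929802957304953145649315290423310661142612259033364748773410015438457353,
  329367851828385662616774797619894216841793080072568019921439491264145221945384028845201979914483566266522054523276693115077873027727050587748791688930929549870890395450171654396299955349594890424238414008615050501126557742842599827669059170652150879397047118127180417666,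
  337624735287418219454235699342240142342768183293387676172124312070431773548092551350038617116320533879063304149519123228446637630355271338815581283110186291584569181202824586947980888508694844790333804350027815188191823821312246411067991603266464753993410766185072920962,
  470092277497550246214488832454977764563530286045771221943164223387167880253701208857075465013996336557962828628972945282537339701770056588288934968339913178094984382841184581981246103728299991046822284553853558327292632737512822523432423184065738517801346072954269846541,
  452181510691575964106404501576866825686065130230299564445370523379723970632950606932666629362788544990225400581057850300671318368688023776011976852540806851556608916740012897394926923596784250612697599556769225091781986824675120585676603696735975609102976307869104770191,
  374442888417417514254469591405037574196928891960920904440429497170023726215724256057353130967955901428056254819812856642744803414696644348059018902463082384582965618346086726965690866207681141235861284208225614930313361700305352683564425108817663001250574762899381898625]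

/-- The base `2 ^ 4` digits of the `i`-th entry are the values of `perm16 i`. -/
def table16 : List ℕ := [
  14982255331435963680,
  13617370043442549570,
  18287580687711273330,
  14982255331685443425,
  15775137497965807440,
  16107628654616576370,
  11231850932610495060,
  17994359748787766820,
  14483254906736349270]

/-- The base `2 ^ 4` digits of the `i`-th entry are the values of the inverse of `perm16 i`. -/
def inverseTable16 : List ℕ := [
  17122628232095887680,
  15685752420828258420,
  17937165149531422755,
  17122628231260234500,
  11384165870765036640,
  16860222243456040995,
  14545194112171131510,
  18058265640912838995,
  15906617806797694770]

/-- The `p`-th digit in base `2 ^ b` of the `i`-th entry of the list `t`. -/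
def lookup (b : ℕ) (t : List ℕ) (i : ZMod 9) (p : Fin (2 ^ b)) : Fin (2 ^ b) :=
  ⟨(t.getD i.val 0 >>> (b * p)) % 2 ^ b, Nat.mod_lt _ (Nat.two_pow_pos b)⟩

/-- A solution of the relations by permutations of 128 points. -/
def perm128 (i : ZMod 9) : Equiv.Perm (Fin (2 ^ 7)) where
  toFun := lookup 7 table128 i
  invFun := lookup 7 inverseTable128 i
  left_inv := by revert i; unfold Function.LeftInverse; decide +kernel
  right_inv := by revert i; unfold Function.RightInverse Function.LeftInverse; decide +kernel

/-- A solution of the relations by permutations of 16 points. -/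
def perm16 (i : ZMod 9) : Equiv.Perm (Fin (2 ^ 4)) where
  toFun := lookup 4 table16 i
  invFun := lookup 4 inverseTable16 i
  left_inv := by revert i; unfold Function.LeftInverse; decide +kernel
  right_inv := by revert i; unfold Function.RightInverse Function.LeftInverse; decide +kernel

theorem isSolution_perm128 : IsSolution perm128 where
  rel i := by ext p : 1; revert i p; decide +kernel
  prod := by ext p : 1; revert p; decide +kernel

theorem isSolution_perm16 : IsSolution perm16 where
  rel i := by ext p : 1; revert i p; decide +kernel
  prod := by ext p : 1; revert p; decide +kernel

theorem cElt_perm16 (i : ZMod 9) : cElt perm16 i = 1 := by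
  ext p : 1
  revert i p
  decide +kernel

theorem exists_prod_cElt_perm128_ne : ∀ S ∈ (List.finRange 9).sublists, S ≠ [] →
    ∃ q ∈ ([(0, 5), (1, 86), (2, 39)] : List (ZMod 9 × Fin (2 ^ 7))),
      (S.map (cElt fun i => perm128 (i + q.1))).prod q.2 ≠ q.2 := by
  decide +kernel

theorem exists_prod_dElt_perm16_ne : ∀ S ∈ (List.finRange 6).sublists, S ≠ [] →
    ∃ p ∈ ([1, 10] : List (Fin (2 ^ 4))),
      (S.map fun i : Fin 6 => dElt perm16 (i : ℕ)).prod p ≠ p := by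
  decide +kernel

/-! ### The order of the group -/

theorem closure_range_map_eq_top (hgen : Subgroup.closure (Set.range x) = ⊤) {f : G →* K}
    (hf : Function.Surjective f) : Subgroup.closure (Set.range fun i => f (x i)) = ⊤ := by
  have : Set.range (fun i => f (x i)) = f '' Set.range x := Set.range_comp f x
  rw [this, ← MonoidHom.map_closure, hgen, ← MonoidHom.range_eq_map,
    MonoidHom.range_eq_top.mpr hf]

theorem exists_lift_quotient_closure {S : Set G} [(Subgroup.closure S).Normal] (f : G →* K)
    (hf : ∀ a ∈ S, f a = 1) : ∃ f' : G ⧸ Subgroup.closure S →* K, ∀ a : G, f' a = f a :=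
  ⟨QuotientGroup.lift _ f ((Subgroup.closure_le f.ker).mpr hf), fun _ => rfl⟩

theorem prod_map_ne_one {ι α : Type*} {g : ι → G} {y : ι → Equiv.Perm α} {S : List ι} {p : α}
    (f : G →* Equiv.Perm α) (hf : ∀ i, f (g i) = y i) (hp : (S.map y).prod p ≠ p) :
    (S.map g).prod ≠ 1 := by
  intro h
  have hy : y = f ∘ g := funext fun i => (hf i).symm
  rw [hy, ← List.map_map, ← map_list_prod, h, map_one] at hp
  exact hp rfl

theorem IsSolution.card_closure_range_cElt (hx : IsSolution x)
    (hf : ∀ s, ∃ f : G →* Equiv.Perm (Fin (2 ^ 7)), ∀ i, f (x i) = perm128 (i + s)) :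
    Nat.card (Subgroup.closure (Set.range (cElt x))) = 2 ^ 9 := by
  refine card_closure_range_of_involutions (n := 9) (hx.holds_cElt.commute eval_shift_cWord)
    hx.cElt_mul_self fun S hS hne h1 => ?_
  obtain ⟨q, -, hq⟩ := exists_prod_cElt_perm128_ne S hS hne
  obtain ⟨f, hf⟩ := hf q.1
  exact prod_map_ne_one f (fun i => by simp only [map_cElt, hf]) hq h1

theorem closure_range_dElt_eq :
    Subgroup.closure (Set.range fun i : Fin 6 => dElt x (i : ℕ)) =
      Subgroup.closure (Set.range (dElt x)) := by
  refine le_antisymm (Subgroup.closure_mono ?_) ((Subgroup.closure_le _).mpr ?_)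
  · rintro _ ⟨i, rfl⟩
    exact ⟨_, rfl⟩
  · have hlt : ∀ i : Fin 6, dElt x (i : ℕ) ∈
        Subgroup.closure (Set.range fun i : Fin 6 => dElt x (i : ℕ)) :=
      fun i => Subgroup.subset_closure ⟨i, rfl⟩
    have hge : ∀ i : Fin 3, dElt x ((i : ℕ) + 6) ∈
        Subgroup.closure (Set.range fun i : Fin 6 => dElt x (i : ℕ)) := by
      intro i
      rw [eq_inv_of_mul_eq_one_right (dElt_mul_dElt_mul_dElt (x := x) (i : ℕ))]
      refine inv_mem (mul_mem (hlt (i.castLE (by norm_num))) ?_)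
      simpa using hlt (i.addNat 3)
    have hcases : ∀ i : ZMod 9,
        (∃ j : Fin 6, i = (j : ℕ)) ∨ ∃ j : Fin 3, i = ((j : ℕ) : ZMod 9) + 6 := by decide
    rintro _ ⟨i, rfl⟩
    rcases hcases i with ⟨j, rfl⟩ | ⟨j, rfl⟩
    · exact hlt j
    · exact hge j

theorem IsSolution.card_closure_range_dElt (hx : IsSolution x) (hc : ∀ i, cElt x i = 1)
    (f : G →* Equiv.Perm (Fin (2 ^ 4))) (hf : ∀ i, f (x i) = perm16 i) :
    Nat.card (Subgroup.closure (Set.range (dElt x))) = 2 ^ 6 := by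
  have hd := (hx.holds_translationTargets hc).commute eval_shift_dWord
  rw [← closure_range_dElt_eq]
  refine card_closure_range_of_involutions (fun i j => hd _ _) (fun i => hc _)
    fun S hS hne h1 => ?_
  obtain ⟨p, -, hp⟩ := exists_prod_dElt_perm16_ne S hS hne
  exact prod_map_ne_one f (fun i => by simp only [map_dElt, hf]) hp h1

/-- The solution of the relations in the cyclic group of order 7. -/
def zmod7Solution (i : ZMod 9) : Multiplicative (ZMod 7) := Multiplicative.ofAdd (2 ^ i.val)

theorem isSolution_zmod7Solution : IsSolution zmod7Solution where
  rel := by decide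
  prod := by decide

theorem dElt_zmod7Solution (i : ZMod 9) : dElt zmod7Solution i = 1 := by
  revert i
  decide

theorem IsSolution.card_eq_seven (hx : IsSolution x) (hd : ∀ i, dElt x i = 1)
    (hgen : Subgroup.closure (Set.range x) = ⊤) (f : G →* Multiplicative (ZMod 7))
    (hf : ∀ i, f (x i) = zmod7Solution i) : Nat.card G = 7 := by
  have h3 : ∀ i, x (i + 3) = x i := fun i => (mul_inv_eq_one.mp (hd i)).symm
  have h1 : ∀ i, x (i + 1) = x i ^ 2 := fun i => by rw [← hx.rel, h3, sq]
  have hpow : ∀ n : ℕ, x n = x 0 ^ 2 ^ n := by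
    intro n
    induction n with
    | zero => simp
    | succ n ih => rw [Nat.cast_succ, h1, ih, ← pow_mul, pow_succ]
  have h7 : x 0 ^ 7 = 1 := by
    have h8 : x 0 ^ 8 = x 0 := (hpow 3).symm.trans (h3 0)
    rwa [pow_succ, mul_eq_right] at h8
  have hne : x 0 ≠ 1 := by
    intro h
    have := hf 0
    rw [h, map_one] at this
    revert this
    decide
  have : Fact (Nat.Prime 7) := ⟨by norm_num⟩
  have htop : Subgroup.zpowers (x 0) = ⊤ := by
    rw [eq_top_iff, ← hgen, Subgroup.closure_le]
    rintro _ ⟨i, rfl⟩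
    have := hpow i.val
    rw [ZMod.natCast_val, ZMod.cast_id', id] at this
    rw [this]
    exact Subgroup.npow_mem_zpowers _ _
  rw [← Subgroup.card_top (G := G), ← htop, Nat.card_zpowers, orderOf_eq_prime h7 hne]

/-- The order of a group generated by a solution `x` with `cElt x i = 1` for all `i`, and
universal among those. -/
theorem IsSolution.card_eq_of_cElt_eq_one (hx : IsSolution x) (hc : ∀ i, cElt x i = 1)
    (hgen : Subgroup.closure (Set.range x) = ⊤)
    (hlift : ∀ {H : Type} [Group H] (y : ZMod 9 → H), IsSolution y → (∀ i, cElt y i = 1) →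
      ∃ f : G →* H, ∀ i, f (x i) = y i) :
    Nat.card G = 7 * 2 ^ 6 := by
  let D := Subgroup.closure (Set.range (dElt x))
  have hD : Nat.card D = 2 ^ 6 := by
    obtain ⟨f, hf⟩ := hlift _ isSolution_perm16 cElt_perm16
    exact hx.card_closure_range_dElt hc f hf
  have : Finite D := Nat.finite_of_card_ne_zero (by rw [hD]; norm_num)
  have : D.Normal := normal_closure_of_conj_mem hgen (by
    rintro _ ⟨s, rfl⟩ _ ⟨i, rfl⟩
    exact (hx.holds_translationTargets hc).conj_mem eval_shift_dWord s i)
  obtain ⟨f, hf⟩ := hlift _ isSolution_zmod7Solution fun i => by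
    rw [cElt, dElt_zmod7Solution, mul_one]
  obtain ⟨f', hf'⟩ := exists_lift_quotient_closure (S := Set.range (dElt x)) f (by
    rintro _ ⟨i, rfl⟩
    simp only [map_dElt, hf, dElt_zmod7Solution])
  have hquot : Nat.card (G ⧸ D) = 7 := by
    refine (hx.map (QuotientGroup.mk' D)).card_eq_seven (fun i => ?_)
      (closure_range_map_eq_top hgen (QuotientGroup.mk'_surjective D)) f'
      fun i => (hf' (x i)).trans (hf i)
    rw [← map_dElt]
    exact (QuotientGroup.eq_one_iff _).mpr (Subgroup.subset_closure ⟨i, rfl⟩)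
  rw [Subgroup.card_eq_card_quotient_mul_card_subgroup D, hquot, hD]

/-- The order of a group generated by a universal solution of the relations. -/
theorem IsSolution.card_eq (hx : IsSolution x) (hgen : Subgroup.closure (Set.range x) = ⊤)
    (hlift : ∀ {H : Type} [Group H] (y : ZMod 9 → H), IsSolution y →
      ∃ f : G →* H, ∀ i, f (x i) = y i) :
    Nat.card G = 7 * 2 ^ 6 * 2 ^ 9 := by
  let Z := Subgroup.closure (Set.range (cElt x))
  have hZ : Nat.card Z = 2 ^ 9 :=
    hx.card_closure_range_cElt fun s => hlift _ (isSolution_perm128.shift s)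
  have : Finite Z := Nat.finite_of_card_ne_zero (by rw [hZ]; norm_num)
  have : Z.Normal := normal_closure_of_conj_mem hgen (by
    rintro _ ⟨s, rfl⟩ _ ⟨i, rfl⟩
    exact hx.holds_cElt.conj_mem eval_shift_cWord s i)
  have hquot : Nat.card (G ⧸ Z) = 7 * 2 ^ 6 := by
    refine (hx.map (QuotientGroup.mk' Z)).card_eq_of_cElt_eq_one (fun i => ?_)
      (closure_range_map_eq_top hgen (QuotientGroup.mk'_surjective Z)) fun y hy hc => ?_
    · rw [← map_cElt]
      exact (QuotientGroup.eq_one_iff _).mpr (Subgroup.subset_closure ⟨i, rfl⟩)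
    · obtain ⟨f, hf⟩ := hlift y hy
      obtain ⟨f', hf'⟩ := exists_lift_quotient_closure (S := Set.range (cElt x)) f (by
        rintro _ ⟨i, rfl⟩
        simp only [map_cElt, hf, hc])
      exact ⟨f', fun i => (hf' (x i)).trans (hf i)⟩
  rw [Subgroup.card_eq_card_quotient_mul_card_subgroup Z, hquot, hZ]

end CyclicWord

/-- The images of the generators of `H(9,3)` in its quotient by the normal closure of `H93w`. -/
def quotientGen (i : ZMod 9) : PresentedGroup H93Rels ⧸ Subgroup.normalClosure {H93w} :=
  QuotientGroup.mk' _ (PresentedGroup.of i)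

theorem isSolution_quotientGen : CyclicWord.IsSolution quotientGen where
  rel i := by
    have h : (PresentedGroup.of i * PresentedGroup.of (i + 3) * (PresentedGroup.of (i + 1))⁻¹ :
        PresentedGroup H93Rels) = 1 := PresentedGroup.one_of_mem ⟨i, rfl⟩
    rw [quotientGen, quotientGen, ← map_mul, mul_inv_eq_one.mp h, quotientGen]
  prod := by
    simp only [quotientGen, ← map_mul]
    exact (QuotientGroup.eq_one_iff _).mpr
      (Subgroup.subset_normalClosure (Set.mem_singleton H93w))

theorem closure_range_quotientGen : Subgroup.closure (Set.range quotientGen) = ⊤ :=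
  CyclicWord.closure_range_map_eq_top (PresentedGroup.closure_range_of H93Rels)
    (QuotientGroup.mk'_surjective _)

theorem exists_lift_quotientGen {H : Type*} [Group H] {y : ZMod 9 → H}
    (hy : CyclicWord.IsSolution y) :
    ∃ f : PresentedGroup H93Rels ⧸ Subgroup.normalClosure {H93w} →* H,
      ∀ i, f (quotientGen i) = y i := by
  have hrel : ∀ r ∈ H93Rels, FreeGroup.lift y r = 1 := by
    rintro _ ⟨i, rfl⟩
    simp [hy.rel]
  have hker : Subgroup.normalClosure {H93w} ≤ (PresentedGroup.toGroup hrel).ker := by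
    refine Subgroup.normalClosure_le_normal (Set.singleton_subset_iff.mpr ?_)
    simpa [H93w, MonoidHom.mem_ker] using hy.prod
  exact ⟨QuotientGroup.lift _ _ hker, fun i => PresentedGroup.toGroup.of hrel⟩

/-- The quotient of `H(9,3)` by the normal closure of
`w = x₀ x₄ x₈ x₃ x₇ x₂ x₆ x₁ x₅` is finite of order `2¹⁵ · 7 = 229376`. -/
theorem stmt_11 :
    Nat.card (PresentedGroup H93Rels ⧸ Subgroup.normalClosure {H93w}) = 229376 := by
  have h := isSolution_quotientGen.card_eq closure_range_quotientGen fun _ hy =>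
    exists_lift_quotientGen hy
  norm_num at h
  exact h
end
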